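/- (Full rank theorem) Let n ≥ 2, 1 ≤ k ≤ n−1 be integers and p ≥ 0 a real number. Let f be a smooth, even, positive function on 𝕊ⁿ satisfying Assumption (A). If φ ∈ C⁴(𝕊ⁿ) with φ > 1 is an even, h-convex solution of σ_k(A[φ]) = φ^{p−k} f on 𝕊ⁿ (i.e. A[φ] ≥ 0), then A[φ] > 0 everywhere, i.e. φ is a uniformly h-convex solution. -/

import Mathlib

open scoped RealInnerProductSpace
open Finset

noncomputable section

/-- Euclidean space `ℝ^(n+1)`, the ambient space of the unit sphere `𝕊ⁿ`. -/
abbrev Euc (n : ℕ) : Type := EuclideanSpace ℝ (Fin (n + 1))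

/-- The unit sphere `𝕊ⁿ ⊆ ℝ^(n+1)`. -/
def uSphere (n : ℕ) : Set (Euc n) := Metric.sphere (0 : Euc n) 1

/-- Orthogonal projection onto the tangent space of the sphere at (the normalization of) `x`. -/
def tanProj {n : ℕ} (x v : Euc n) : Euc n := v - (⟪x, v⟫ / ‖x‖ ^ 2) • x

/-- `f` is (the 0-homogeneous extension of) a function on the sphere. -/
def Homog0 {n : ℕ} (f : Euc n → ℝ) : Prop := ∀ (c : ℝ) (y : Euc n), 0 < c → f (c • y) = f y

/-- Smoothness of a function on the sphere, expressed via its 0-homogeneous extension. -/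
def SmoothFn {n : ℕ} (f : Euc n → ℝ) : Prop := ContDiffOn ℝ (⊤ : ℕ∞) f {y : Euc n | y ≠ 0}

/-- `f(x) = f(-x)` for all `x`. -/
def EvenFn {n : ℕ} (f : Euc n → ℝ) : Prop := ∀ y, f (-y) = f y

/-- Covariant (tangential) derivative of a function on the sphere, in direction `v`. -/
def covD {n : ℕ} (f : Euc n → ℝ) (x v : Euc n) : ℝ := fderiv ℝ f x (tanProj x v)

/-- Spherical (tangential) gradient. -/
def gradS {n : ℕ} (f : Euc n → ℝ) (x : Euc n) : Euc n := tanProj x (gradient f x)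

/-- Covariant Hessian `(D²f)(v,w)` of a function on the round sphere. -/
def hessS {n : ℕ} (f : Euc n → ℝ) (x v w : Euc n) : ℝ :=
  fderiv ℝ (fun y => covD f y w) x (tanProj x v)

/-- The symmetric 2-tensor
`A[φ](v,w) = (D²φ)(v,w) - (|Dφ|²/(2φ)) σ(v,w) + ((φ - 1/φ)/2) σ(v,w)` on the sphere. -/
def Aform {n : ℕ} (φ : Euc n → ℝ) (x v w : Euc n) : ℝ :=
  hessS φ x v w +
    ((φ x - (φ x)⁻¹) / 2 - ‖gradS φ x‖ ^ 2 / (2 * φ x)) * ⟪tanProj x v, tanProj x w⟫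

/-- `φ` is h-convex: `A[φ] ≥ 0` on the sphere. -/
def HConvex {n : ℕ} (φ : Euc n → ℝ) : Prop :=
  ∀ x ∈ uSphere n, ∀ v : Euc n, ⟪x, v⟫ = 0 → 0 ≤ Aform φ x v v

/-- `φ` is uniformly h-convex: `A[φ] > 0` on the sphere. -/
def UnifHConvex {n : ℕ} (φ : Euc n → ℝ) : Prop :=
  ∀ x ∈ uSphere n, ∀ v : Euc n, ⟪x, v⟫ = 0 → v ≠ 0 → 0 < Aform φ x v v

/-- `σ_k` of a square matrix: the sum of its principal `k × k` minors
(equivalently, the `k`-th elementary symmetric function of its eigenvalues). -/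
def sigmaMat {N : ℕ} (k : ℕ) (M : Matrix (Fin N) (Fin N) ℝ) : ℝ :=
  ∑ s ∈ Finset.powersetCard k (Finset.univ : Finset (Fin N)),
    Matrix.det (Matrix.of fun i j : {a : Fin N // a ∈ s} => M i.1 j.1)

/-- `e` is an orthonormal frame of the tangent space of `𝕊ⁿ` at `x`. -/
def OrthoFrame {n : ℕ} (x : Euc n) (e : Fin n → Euc n) : Prop :=
  (∀ i, ⟪x, e i⟫ = 0) ∧ ∀ i j, ⟪e i, e j⟫ = if i = j then 1 else 0

/-- The matrix of `A[φ]` at `x` with respect to an orthonormal tangent frame `e`. -/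
def Amat {n : ℕ} (φ : Euc n → ℝ) (x : Euc n) (e : Fin n → Euc n) : Matrix (Fin n) (Fin n) ℝ :=
  Matrix.of fun i j => Aform φ x (e i) (e j)

/-- `φ` solves the horospherical `p`-Christoffel-Minkowski equation
`σ_k(A[φ]) = φ^(p-k) f` on `𝕊ⁿ`. -/
def SolvesCM (n k : ℕ) (p : ℝ) (f φ : Euc n → ℝ) : Prop :=
  ∀ x ∈ uSphere n, ∀ e : Fin n → Euc n, OrthoFrame x e →
    sigmaMat k (Amat φ x e) = φ x ^ (p - (k : ℝ)) * f x

/-- Supremum (maximum) of a function over the sphere. -/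
def sphSup {n : ℕ} (f : Euc n → ℝ) : ℝ := sSup (f '' uSphere n)

/-- Infimum (minimum) of a function over the sphere. -/
def sphInf {n : ℕ} (f : Euc n → ℝ) : ℝ := sInf (f '' uSphere n)

/-- The function `f^(-1/q)`. -/
def negPowExt {n : ℕ} (f : Euc n → ℝ) (q : ℝ) : Euc n → ℝ := fun y => f y ^ (-(1 / q))

/-- Assumption 1.3 of the paper (Assumption (A)): the gradient-and-Hessian conditions on the
prescribed function `f`, according to the value of `p`. -/
def AssumptionA (n k : ℕ) (p : ℝ) (f : Euc n → ℝ) : Prop :=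
  ((p = 0) →
    ∀ x ∈ uSphere n, ∀ v : Euc n, ⟪x, v⟫ = 0 →
      0 ≤ hessS (negPowExt f (k : ℝ)) x v v - ‖gradS (negPowExt f (k : ℝ)) x‖ * ‖v‖ ^ 2 +
          negPowExt f (k : ℝ) x /
              (2 + 8 * sphSup fun y => (f y / (n.choose k : ℝ)) ^ (1 / (k : ℝ))) * ‖v‖ ^ 2) ∧
  ((0 < p ∧ p ≤ (k : ℝ) / 2) →
    ∀ x ∈ uSphere n, ∀ v : Euc n, ⟪x, v⟫ = 0 →
      0 ≤ hessS (negPowExt f (k : ℝ)) x v v -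
            (((k : ℝ) + 2 * p) / (k : ℝ)) * ‖gradS (negPowExt f (k : ℝ)) x‖ * ‖v‖ ^ 2 +
          (p ^ 2 / (k : ℝ) ^ 2) * negPowExt f (k : ℝ) x * ‖v‖ ^ 2) ∧
  (((k : ℝ) / 2 < p ∧ p < (k : ℝ)) →
    ∀ x ∈ uSphere n, ∀ v : Euc n, ⟪x, v⟫ = 0 →
      0 ≤ hessS (negPowExt f (k : ℝ)) x v v -
            ((3 * (k : ℝ) - 2 * p) ^ 2 / (p * (2 * p - (k : ℝ)))) *
              (‖gradS (negPowExt f (k : ℝ)) x‖ ^ 2 / (2 * negPowExt f (k : ℝ) x)) * ‖v‖ ^ 2 +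
          (p / (2 * (k : ℝ))) * negPowExt f (k : ℝ) x * ‖v‖ ^ 2) ∧
  (((k : ℝ) ≤ p ∧ p < 2 * (k : ℝ)) →
    ∀ x ∈ uSphere n, ∀ v : Euc n, ⟪x, v⟫ = 0 →
      0 ≤ hessS (negPowExt f p) x v v -
            (‖gradS (negPowExt f p) x‖ ^ 2 / (2 * negPowExt f p x)) * ‖v‖ ^ 2 +
          (1 / 2) * negPowExt f p x * ‖v‖ ^ 2) ∧
  ((p = 2 * (k : ℝ)) →
    sphSup f < (n.choose k : ℝ) / 2 ^ k ∧
    ∀ x ∈ uSphere n, ∀ v : Euc n, ⟪x, v⟫ = 0 →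
      0 ≤ hessS (negPowExt f p) x v v -
            (‖gradS (negPowExt f p) x‖ ^ 2 / (2 * negPowExt f p x)) * ‖v‖ ^ 2 +
          (1 / 2) * negPowExt f p x * ‖v‖ ^ 2) ∧
  ((2 * (k : ℝ) < p) →
    2 ≤ k ∧
    sphInf f ≤
      (k : ℝ) ^ k * (p - 2 * (k : ℝ)) ^ ((p - 2 * (k : ℝ)) / 2) / p ^ (p / 2) * (n.choose k : ℝ) ∧
    ∀ x ∈ uSphere n, ∀ v : Euc n, ⟪x, v⟫ = 0 →
      0 ≤ hessS (negPowExt f p) x v v -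
            (‖gradS (negPowExt f p) x‖ ^ 2 / (2 * negPowExt f p x)) * ‖v‖ ^ 2 +
          ((k : ℝ) / p) * negPowExt f p x * ‖v‖ ^ 2)

/-- `f : ℝ → F` is differentiable, twice at `0`, with `2`-jet `(a, b, c)` at `0`. -/
def HasJet {F : Type*} [NormedAddCommGroup F] [NormedSpace ℝ F] (f : ℝ → F) (a b c : F) : Prop :=
  ∃ f₁ : ℝ → F, (∀ t, HasDerivAt f (f₁ t) t) ∧ HasDerivAt f₁ c 0 ∧ f 0 = a ∧ f₁ 0 = b

section Jets

variable {F G : Type*} [NormedAddCommGroup F] [NormedSpace ℝ F] [NormedAddCommGroup G]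
  [NormedSpace ℝ G]

theorem HasJet.eq {f : ℝ → F} {a b c a' b' c' : F} (h : HasJet f a b c) (h' : HasJet f a' b' c') :
    a = a' ∧ b = b' ∧ c = c' := by
  obtain ⟨f₁, h1, h2, h3, h4⟩ := h
  obtain ⟨g₁, k1, k2, k3, k4⟩ := h'
  have : f₁ = g₁ := funext fun t => (h1 t).unique (k1 t)
  subst this
  exact ⟨h3.symm.trans k3, h4.symm.trans k4, h2.unique k2⟩

theorem HasJet.congr {f g : ℝ → F} {a b c : F} (h : HasJet f a b c) (hfg : ∀ t, g t = f t) :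
    HasJet g a b c := by
  rwa [show g = f from funext hfg]

theorem HasJet.of_eq {f : ℝ → F} {a b c a' b' c' : F} (h : HasJet f a b c)
    (ha : a = a') (hb : b = b') (hc : c = c') : HasJet f a' b' c' := by
  subst ha hb hc; exact h

theorem HasJet.const (a : F) : HasJet (fun _ => a) a 0 0 :=
  ⟨fun _ => 0, fun t => hasDerivAt_const t a, hasDerivAt_const 0 0, rfl, rfl⟩

theorem HasJet.add {f g : ℝ → F} {a b c a' b' c' : F} (h : HasJet f a b c)
    (h' : HasJet g a' b' c') : HasJet (fun t => f t + g t) (a + a') (b + b') (c + c') := by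
  obtain ⟨f₁, h1, h2, h3, h4⟩ := h
  obtain ⟨g₁, k1, k2, k3, k4⟩ := h'
  exact ⟨fun t => f₁ t + g₁ t, fun t => (h1 t).add (k1 t), h2.add k2, by simp [h3, k3],
    by simp [h4, k4]⟩

theorem HasJet.sum {ι : Type*} (s : Finset ι) {f : ι → ℝ → F} {a b c : ι → F}
    (h : ∀ i ∈ s, HasJet (f i) (a i) (b i) (c i)) :
    HasJet (fun t => ∑ i ∈ s, f i t) (∑ i ∈ s, a i) (∑ i ∈ s, b i) (∑ i ∈ s, c i) := by
  classical
  induction s using Finset.induction_on with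
  | empty => simpa using HasJet.const (0 : F)
  | insert i s hi ih =>
    simp only [Finset.sum_insert hi]
    exact (h i (by simp)).add (ih fun j hj => h j (by simp [hj]))

theorem HasJet.clm (L : F →L[ℝ] G) {f : ℝ → F} {a b c : F} (h : HasJet f a b c) :
    HasJet (fun t => L (f t)) (L a) (L b) (L c) := by
  obtain ⟨f₁, h1, h2, h3, h4⟩ := h
  exact ⟨fun t => L (f₁ t), fun t => L.hasFDerivAt.comp_hasDerivAt t (h1 t),
    L.hasFDerivAt.comp_hasDerivAt 0 h2, by simp [h3], by simp [h4]⟩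

theorem HasJet.clm_apply {L : ℝ → F →L[ℝ] G} {f : ℝ → F} {A B C : F →L[ℝ] G} {a b c : F}
    (hL : HasJet L A B C) (h : HasJet f a b c) :
    HasJet (fun t => L t (f t)) (A a) (B a + A b) (C a + 2 • B b + A c) := by
  obtain ⟨f₁, h1, h2, h3, h4⟩ := h
  obtain ⟨L₁, k1, k2, k3, k4⟩ := hL
  refine ⟨fun t => L₁ t (f t) + L t (f₁ t), fun t => (k1 t).clm_apply (h1 t), ?_, by simp [h3, k3],
    by simp [h3, k3, h4, k4]⟩
  have := (k2.clm_apply (h1 0)).add ((k1 0).clm_apply h2)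
  rw [h3, h4, k3, k4] at this
  refine this.congr_deriv ?_
  rw [two_smul]; abel

theorem HasJet.smul {r : ℝ → ℝ} {f : ℝ → F} {x y z : ℝ} {a b c : F}
    (hr : HasJet r x y z) (h : HasJet f a b c) :
    HasJet (fun t => r t • f t) (x • a) (y • a + x • b) (z • a + (2 * y) • b + x • c) := by
  have := (hr.clm (ContinuousLinearMap.lsmul ℝ ℝ : ℝ →L[ℝ] F →L[ℝ] F)).clm_apply h
  refine this.of_eq (by simp) (by simp) (by simp [mul_smul, two_smul])

theorem HasJet.mul {f g : ℝ → ℝ} {a b c a' b' c' : ℝ} (h : HasJet f a b c)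
    (h' : HasJet g a' b' c') :
    HasJet (fun t => f t * g t) (a * a') (b * a' + a * b') (c * a' + 2 * b * b' + a * c') :=
  h.smul h'

theorem HasJet.inner {E : Type*} [NormedAddCommGroup E] [InnerProductSpace ℝ E]
    {f g : ℝ → E} {a b c a' b' c' : E} (h : HasJet f a b c) (h' : HasJet g a' b' c') :
    HasJet (fun t => ⟪f t, g t⟫) ⟪a, a'⟫ (⟪b, a'⟫ + ⟪a, b'⟫)
      (⟪c, a'⟫ + 2 * ⟪b, b'⟫ + ⟪a, c'⟫) := by
  have := (h.clm (innerSL ℝ)).clm_apply h'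
  exact this.of_eq rfl rfl (by rw [two_smul, two_mul]; rfl)

/-- Composition of a scalar function of one variable with a curve. -/
theorem HasJet.scomp {g g₁ : ℝ → ℝ} {g₂ : ℝ} {f : ℝ → ℝ} {a b c : ℝ} (h : HasJet f a b c)
    (hg : ∀ t, HasDerivAt g (g₁ (f t)) (f t)) (hg₁ : HasDerivAt g₁ g₂ a) :
    HasJet (fun t => g (f t)) (g a) (g₁ a * b) (g₂ * b ^ 2 + g₁ a * c) := by
  obtain ⟨f₁, h1, h2, h3, h4⟩ := h
  refine ⟨fun t => g₁ (f t) * f₁ t, fun t => (hg t).comp t (h1 t), ?_, by simp [h3],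
    by simp [h3, h4]⟩
  have := ((h3 ▸ hg₁).comp 0 (h1 0)).mul h2
  refine this.congr_deriv ?_
  simp only [h3, h4, Function.comp_apply]; ring

/-- Composition of a function with a curve. -/
theorem HasJet.fcomp {g : F → G} {g' : F → F →L[ℝ] G} {g'' : F →L[ℝ] F →L[ℝ] G}
    {f : ℝ → F} {a b c : F} (h : HasJet f a b c)
    (hg : ∀ t, HasFDerivAt g (g' (f t)) (f t)) (hg' : HasFDerivAt g' g'' a) :
    HasJet (fun t => g (f t)) (g a) (g' a b) (g'' b b + g' a c) := by
  obtain ⟨f₁, h1, h2, h3, h4⟩ := h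
  refine ⟨fun t => g' (f t) (f₁ t), fun t => (hg t).comp_hasDerivAt t (h1 t), ?_, by simp [h3],
    by simp [h3, h4]⟩
  have hg0 : HasFDerivAt g' g'' (f 0) := by rw [h3]; exact hg'
  have := (hg0.comp_hasDerivAt 0 (h1 0)).clm_apply h2
  refine this.congr_deriv ?_
  simp [h3, h4]

theorem HasJet.nonneg_min {f : ℝ → ℝ} {b c : ℝ} (h : HasJet f 0 b c) (hf : ∀ t, 0 ≤ f t) :
    b = 0 ∧ 0 ≤ c := by
  obtain ⟨f₁, h1, h2, h3, h4⟩ := h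
  have hb : b = 0 := by
    rw [← h4]
    refine IsLocalMin.hasDerivAt_eq_zero (f := f) (a := 0) ?_ (h1 0)
    exact Filter.Eventually.of_forall fun t => by simpa [h3] using hf t
  refine ⟨hb, ?_⟩
  by_contra hc
  push Not at hc
  have key := hasDerivAt_iff_isLittleO.mp h2
  rw [h4, hb] at key
  have ev := key.def (show 0 < -c / 2 by linarith)
  obtain ⟨δ, hδ, hball⟩ := Metric.eventually_nhds_iff.mp ev
  obtain ⟨ξ, hξ, hξ'⟩ := exists_hasDerivAt_eq_slope f f₁ (show (0 : ℝ) < δ / 2 by linarith)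
    (fun t _ => (h1 t).continuousAt.continuousWithinAt) (fun t _ => h1 t)
  have hx := hball (y := ξ) (by
    rw [Real.dist_eq, sub_zero, abs_of_pos hξ.1]; linarith [hξ.2])
  simp only [sub_zero, smul_eq_mul, Real.norm_eq_abs, abs_of_pos hξ.1] at hx
  have h5 := (abs_le.mp hx).2
  have h6 : f₁ ξ < 0 := by nlinarith [hξ.1]
  rw [hξ', h3] at h6
  have := hf (δ / 2)
  have : 0 ≤ (f (δ / 2) - 0) / (δ / 2 - 0) := by
    apply div_nonneg <;> linarith
  linarith

end Jets

section Det

variable {m : Type*} [Fintype m] [DecidableEq m]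

theorem hasDerivAt_det {M M' : ℝ → Matrix m m ℝ} {t : ℝ}
    (h : ∀ i j, HasDerivAt (fun s => M s i j) (M' t i j) t) :
    HasDerivAt (fun s => (M s).det) (∑ i, ((M t).updateRow i (M' t i)).det) t := by
  simp only [← Matrix.det_transpose (M _), ← Matrix.det_transpose ((M t).updateRow _ _)]
  simp only [Matrix.det_apply, Matrix.transpose_apply]
  rw [Finset.sum_comm]
  refine HasDerivAt.fun_sum fun σ _ => ?_
  simp only [← Finset.smul_sum]
  refine HasDerivAt.const_smul (Equiv.Perm.sign σ) ?_
  have := HasDerivAt.fun_finsetProd (u := Finset.univ) (f := fun i s => M s i (σ i))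
    (f' := fun i => M' t i (σ i)) (x := t) (fun i _ => h i (σ i))
  refine this.congr_deriv (Finset.sum_congr rfl fun i _ => ?_)
  rw [← Finset.mul_prod_erase _ _ (Finset.mem_univ i)]
  simp only [Matrix.updateRow_self, smul_eq_mul]
  rw [mul_comm]
  congr 1
  refine Finset.prod_congr rfl fun j hj => ?_
  rw [Matrix.updateRow_ne (Finset.ne_of_mem_erase hj)]

theorem HasJet.det {M : ℝ → Matrix m m ℝ} {D X Z : Matrix m m ℝ}
    (h : ∀ i j, HasJet (fun s => M s i j) (D i j) (X i j) (Z i j)) :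
    HasJet (fun s => (M s).det) D.det (∑ i, (D.updateRow i (X i)).det)
      (∑ i, ((D.updateRow i (Z i)).det +
        ∑ j ∈ Finset.univ.erase i, ((D.updateRow i (X i)).updateRow j (X j)).det)) := by
  choose M₁ h1 h2 h3 h4 using h
  have hD : M 0 = D := by ext i j; exact h3 i j
  have hX : (Matrix.of fun i j => M₁ i j 0) = X := by ext i j; exact h4 i j
  refine ⟨fun t => ∑ i, ((M t).updateRow i (fun j => M₁ i j t)).det, fun t => ?_, ?_,
    by simp only [hD], ?_⟩
  · exact hasDerivAt_det (M' := fun t i j => M₁ i j t) fun i j => h1 i j t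
  · refine HasDerivAt.fun_sum fun i _ => ?_
    have := hasDerivAt_det (t := 0) (M := fun t => (M t).updateRow i (fun j => M₁ i j t))
      (M' := fun t a b => if a = i then Z i b else M₁ a b t) (fun a b => by
        by_cases ha : a = i
        · subst ha; simpa using h2 a b
        · simpa [ha, Matrix.updateRow_ne] using h1 a b 0)
    refine this.congr_deriv ?_
    rw [← Finset.add_sum_erase _ _ (Finset.mem_univ i)]
    congr 1
    · simp [hD]
    · refine Finset.sum_congr rfl fun j hj => ?_
      have hj' := Finset.ne_of_mem_erase hj
      simp only [hj', if_false, hD]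
      rw [show (fun b => M₁ i b 0) = X i from funext fun b => h4 i b,
        show (fun b => M₁ j b 0) = X j from funext fun b => h4 j b]
  · simp only [hD]
    refine Finset.sum_congr rfl fun i _ => ?_
    rw [show (fun b => M₁ i b 0) = X i from funext fun b => h4 i b]

theorem det_updateRow_diagonal (d : m → ℝ) (i : m) (r : m → ℝ) :
    ((Matrix.diagonal d).updateRow i r).det = r i * ∏ j ∈ Finset.univ.erase i, d j := by
  rw [← Matrix.cramer_transpose_apply, Matrix.cramer_eq_adjugate_mulVec,
    Matrix.diagonal_transpose, Matrix.adjugate_diagonal, Matrix.mulVec_diagonal, mul_comm]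

theorem det_updateRow_updateRow_diagonal (d : m → ℝ) {i j : m} (hij : j ≠ i) (r s : m → ℝ) :
    (((Matrix.diagonal d).updateRow i r).updateRow j s).det =
      (r i * s j - r j * s i) * ∏ l ∈ (Finset.univ.erase i).erase j, d l := by
  rw [← Matrix.det_transpose, Matrix.det_apply]
  rw [← Finset.sum_subset (Finset.subset_univ {1, Equiv.swap i j})]
  · have h1 : (1 : Equiv.Perm m) ≠ Equiv.swap i j := by
      intro h
      have := congrArg (fun σ : Equiv.Perm m => σ i) h
      simp at this
      exact hij this.symm
    rw [Finset.sum_pair h1]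
    have hp : ∀ σ : Equiv.Perm m, (∀ l, l ≠ i → l ≠ j → σ l = l) →
        ∏ l, (((Matrix.diagonal d).updateRow i r).updateRow j s).transpose (σ l) l =
        s (σ j) * r (σ i) * ∏ l ∈ (Finset.univ.erase i).erase j, d l := by
      intro σ hσ
      rw [← Finset.mul_prod_erase _ _ (Finset.mem_univ i),
        ← Finset.mul_prod_erase _ _ (Finset.mem_erase.mpr ⟨hij, Finset.mem_univ j⟩)]
      rw [← mul_assoc]
      congr 1
      · simp [Matrix.updateRow_ne hij.symm, mul_comm]
      · refine Finset.prod_congr rfl fun l hl => ?_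
        simp only [Finset.mem_erase, Finset.mem_univ, and_true] at hl
        simp [Matrix.updateRow_ne hl.1, Matrix.updateRow_ne hl.2, hσ l hl.2 hl.1]
    rw [hp 1 (by simp), hp (Equiv.swap i j) fun l h1 h2 => Equiv.swap_apply_of_ne_of_ne h1 h2]
    rw [Equiv.Perm.sign_swap hij.symm]
    simp
    ring
  · intro σ _ hσ
    simp only [Finset.mem_insert, Finset.mem_singleton, not_or] at hσ
    have : ∃ l, l ≠ i ∧ l ≠ j ∧ σ l ≠ l := by
      by_contra hcon
      push Not at hcon
      by_cases hi : σ i = i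
      · apply hσ.1
        ext l
        by_cases hli : l = i
        · subst hli; simpa using hi
        · by_cases hlj : l = j
          · subst hlj
            by_contra hl
            have hl' : σ l ≠ l := hl
            by_cases h2 : σ l = i
            · exact hli (σ.injective (h2.trans hi.symm))
            · exact hl' (σ.injective (hcon _ h2 hl'))
          · exact hcon l hli hlj
      · apply hσ.2
        have hij' : σ i = j := by
          by_contra h2
          exact hi (σ.injective (hcon _ hi h2))
        have hji : σ j = i := by
          by_contra h2
          by_cases h3 : σ j = j
          · exact hij (σ.injective (h3.trans hij'.symm))
          · exact h3 (σ.injective (hcon _ h2 h3))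
        ext l
        by_cases hli : l = i
        · subst hli; simp [hij']
        · by_cases hlj : l = j
          · subst hlj; simp [hji]
          · rw [Equiv.swap_apply_of_ne_of_ne hli hlj, hcon l hli hlj]
    obtain ⟨l, h1, h2, h3⟩ := this
    rw [Finset.prod_eq_zero (Finset.mem_univ l), smul_zero]
    simp [Matrix.updateRow_ne h1, Matrix.updateRow_ne h2, Matrix.diagonal_apply_ne _ (Ne.symm h3)]

end Det

section ElementarySymmetric

variable {n : ℕ}

/-- The `k`-th elementary symmetric polynomial of `d`. -/
def esS (k : ℕ) (d : Fin n → ℝ) : ℝ := ∑ s ∈ powersetCard k univ, ∏ i ∈ s, d i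

/-- The first partial derivative of `esS`. -/
def esF (k : ℕ) (d : Fin n → ℝ) (i : Fin n) : ℝ :=
  ∑ s ∈ powersetCard k univ, if i ∈ s then ∏ l ∈ s.erase i, d l else 0

/-- The mixed second partial derivative of `esS`. -/
def esFF (k : ℕ) (d : Fin n → ℝ) (i j : Fin n) : ℝ :=
  ∑ s ∈ powersetCard k univ, if i ∈ s ∧ j ∈ s then ∏ l ∈ (s.erase i).erase j, d l else 0

/-- The part of `esF k d i` not containing the variable `d j`. -/
def esG (k : ℕ) (d : Fin n → ℝ) (i j : Fin n) : ℝ :=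
  ∑ s ∈ powersetCard k univ, if i ∈ s ∧ j ∉ s then ∏ l ∈ s.erase i, d l else 0

theorem prod_erase_subtype {s : Finset (Fin n)} (d : Fin n → ℝ) (i : {a // a ∈ s}) :
    ∏ j ∈ univ.erase i, d j.1 = ∏ j ∈ s.erase i.1, d j := by
  refine Finset.prod_bij (fun j _ => j.1) ?_ ?_ ?_ ?_
  · intro j hj
    simp only [mem_erase, mem_univ, and_true] at hj
    exact mem_erase.mpr ⟨fun h => hj (Subtype.ext h), j.2⟩
  · intro a _ b _ h; exact Subtype.ext h
  · intro b hb
    obtain ⟨h1, h2⟩ := mem_erase.mp hb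
    exact ⟨⟨b, h2⟩, mem_erase.mpr ⟨fun h => h1 (congrArg Subtype.val h), mem_univ _⟩, rfl⟩
  · intros; rfl

theorem prod_erase_erase_subtype {s : Finset (Fin n)} (d : Fin n → ℝ) (i j : {a // a ∈ s}) :
    ∏ l ∈ (univ.erase i).erase j, d l.1 = ∏ l ∈ (s.erase i.1).erase j.1, d l := by
  refine Finset.prod_bij (fun j _ => j.1) ?_ ?_ ?_ ?_
  · intro l hj
    simp only [mem_erase, mem_univ, and_true] at hj
    exact mem_erase.mpr ⟨fun h => hj.1 (Subtype.ext h),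
      mem_erase.mpr ⟨fun h => hj.2 (Subtype.ext h), l.2⟩⟩
  · intro a _ b _ h; exact Subtype.ext h
  · intro b hb
    obtain ⟨h0, h1, h2⟩ := by simpa only [mem_erase] using hb
    exact ⟨⟨b, h2⟩, mem_erase.mpr ⟨fun h => h0 (congrArg Subtype.val h),
      mem_erase.mpr ⟨fun h => h1 (congrArg Subtype.val h), mem_univ _⟩⟩, rfl⟩
  · intros; rfl

theorem sum_erase_subtype {s : Finset (Fin n)} (g : Fin n → ℝ) (i : {a // a ∈ s}) :
    ∑ j ∈ univ.erase i, g j.1 = ∑ j ∈ s.erase i.1, g j := by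
  rw [Finset.sum_erase_eq_sub (mem_univ i), Finset.sum_erase_eq_sub i.2, Finset.sum_coe_sort s g]

theorem sum_esF_mul (k : ℕ) (d x : Fin n → ℝ) :
    ∑ i, esF k d i * x i =
      ∑ s ∈ powersetCard k univ, ∑ i ∈ s, (∏ l ∈ s.erase i, d l) * x i := by
  simp only [esF, Finset.sum_mul]
  rw [Finset.sum_comm]
  refine Finset.sum_congr rfl fun s _ => ?_
  simp only [ite_mul, zero_mul]
  rw [← Finset.sum_filter]
  simp

theorem sum_esFF_mul (k : ℕ) (d : Fin n → ℝ) (x : Fin n → Fin n → ℝ) :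
    ∑ i, ∑ j ∈ univ.erase i, esFF k d i j * x i j =
      ∑ s ∈ powersetCard k univ, ∑ i ∈ s, ∑ j ∈ s.erase i,
        (∏ l ∈ (s.erase i).erase j, d l) * x i j := by
  simp only [esFF, Finset.sum_mul]
  have : ∀ i, (∑ j ∈ univ.erase i, ∑ s ∈ powersetCard k univ,
      (if i ∈ s ∧ j ∈ s then ∏ l ∈ (s.erase i).erase j, d l else 0) * x i j) =
      ∑ s ∈ powersetCard k univ, ∑ j ∈ univ.erase i,
      (if i ∈ s ∧ j ∈ s then ∏ l ∈ (s.erase i).erase j, d l else 0) * x i j := fun i =>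
    Finset.sum_comm
  simp only [this]
  rw [Finset.sum_comm]
  refine Finset.sum_congr rfl fun s _ => ?_
  rw [← Finset.sum_subset (Finset.subset_univ s)]
  · refine Finset.sum_congr rfl fun i hi => ?_
    rw [← Finset.sum_subset (Finset.erase_subset_erase i (Finset.subset_univ s))]
    · refine Finset.sum_congr rfl fun j hj => ?_
      rw [if_pos ⟨hi, mem_of_mem_erase hj⟩]
    · intro j hj hj'
      have : j ∉ s := fun h => hj' (mem_erase.mpr ⟨ne_of_mem_erase hj, h⟩)
      simp [this]
  · intro i _ hi
    simp [hi]

theorem diagonal_subtype (d : Fin n → ℝ) (s : Finset (Fin n)) :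
    (Matrix.of fun i j : {a // a ∈ s} => Matrix.diagonal d i.1 j.1) =
      Matrix.diagonal fun i : {a // a ∈ s} => d i.1 := by
  ext i j
  by_cases h : i = j
  · subst h
    rw [Matrix.of_apply, Matrix.diagonal_apply_eq, Matrix.diagonal_apply_eq]
  · rw [Matrix.of_apply, Matrix.diagonal_apply_ne _ h,
      Matrix.diagonal_apply_ne _ fun h' => h (Subtype.ext h')]

theorem HasJet.sigmaMat (k : ℕ) {M : ℝ → Matrix (Fin n) (Fin n) ℝ} {d : Fin n → ℝ}
    {X Z : Fin n → Fin n → ℝ}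
    (h : ∀ i j, HasJet (fun s => M s i j) (Matrix.diagonal d i j) (X i j) (Z i j)) :
    HasJet (fun s => sigmaMat k (M s)) (esS k d) (∑ i, esF k d i * X i i)
      (∑ i, esF k d i * Z i i +
        ∑ i, ∑ j ∈ univ.erase i, esFF k d i j * (X i i * X j j - X i j * X j i)) := by
  rw [sum_esF_mul, sum_esF_mul k d fun i => Z i i,
    sum_esFF_mul k d fun i j => X i i * X j j - X i j * X j i, ← Finset.sum_add_distrib]
  refine HasJet.sum _ fun s _ => ?_
  have hd := diagonal_subtype d s
  have := HasJet.det (M := fun t => Matrix.of fun i j : {a // a ∈ s} => M t i.1 j.1)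
    (D := Matrix.diagonal fun i : {a // a ∈ s} => d i.1)
    (X := Matrix.of fun i j : {a // a ∈ s} => X i.1 j.1)
    (Z := Matrix.of fun i j : {a // a ∈ s} => Z i.1 j.1) (fun i j => by
      rw [← hd]; exact h i.1 j.1)
  refine this.of_eq ?_ ?_ ?_
  · rw [Matrix.det_diagonal]; exact Finset.prod_coe_sort s d
  · rw [← Finset.sum_coe_sort s]
    refine Finset.sum_congr rfl fun i _ => ?_
    rw [det_updateRow_diagonal, prod_erase_subtype, mul_comm]; rfl
  · rw [← Finset.sum_coe_sort s, ← Finset.sum_coe_sort s, ← Finset.sum_add_distrib]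
    refine Finset.sum_congr rfl fun i _ => ?_
    rw [det_updateRow_diagonal, prod_erase_subtype, mul_comm]
    congr 1
    rw [← sum_erase_subtype]
    refine Finset.sum_congr rfl fun j hj => ?_
    rw [det_updateRow_updateRow_diagonal _ (ne_of_mem_erase hj), prod_erase_erase_subtype, mul_comm]
    rfl

theorem esF_eq (k : ℕ) (d : Fin n → ℝ) {i j : Fin n} (hij : j ≠ i) :
    esF k d i = esG k d i j + d j * esFF k d i j := by
  simp only [esF, esG, esFF, Finset.mul_sum]
  rw [← Finset.sum_add_distrib]
  refine Finset.sum_congr rfl fun s _ => ?_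
  by_cases hi : i ∈ s <;> by_cases hj : j ∈ s <;> simp [hi, hj]
  rw [Finset.mul_prod_erase _ _ (mem_erase.mpr ⟨hij, hj⟩)]

theorem esG_symm (k : ℕ) (d : Fin n → ℝ) (i j : Fin n) : esG k d i j = esG k d j i := by
  simp only [esG, ← Finset.sum_filter]
  refine Finset.sum_nbij' (fun s => insert j (s.erase i)) (fun s => insert i (s.erase j)) ?_ ?_ ?_ ?_
    ?_
  · intro s hs
    simp only [mem_filter, mem_powersetCard_univ] at hs ⊢
    obtain ⟨h1, h2, h3⟩ := hs
    have hne : i ≠ j := fun h => h3 (h ▸ h2)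
    refine ⟨?_, by simp, by simp [hne]⟩
    rw [card_insert_of_notMem (by simp [h3]), card_erase_of_mem h2, h1]
    have := card_pos.mpr ⟨i, h2⟩
    omega
  · intro s hs
    simp only [mem_filter, mem_powersetCard_univ] at hs ⊢
    obtain ⟨h1, h2, h3⟩ := hs
    have hne : j ≠ i := fun h => h3 (h ▸ h2)
    refine ⟨?_, by simp, by simp [hne]⟩
    rw [card_insert_of_notMem (by simp [h3]), card_erase_of_mem h2, h1]
    have := card_pos.mpr ⟨j, h2⟩
    omega
  · intro s hs
    simp only [mem_filter, mem_powersetCard_univ] at hs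
    obtain ⟨h1, h2, h3⟩ := hs
    rw [erase_insert (by simp [h3]), insert_erase h2]
  · intro s hs
    simp only [mem_filter, mem_powersetCard_univ] at hs
    obtain ⟨h1, h2, h3⟩ := hs
    rw [erase_insert (by simp [h3]), insert_erase h2]
  · intro s hs
    simp only [mem_filter, mem_powersetCard_univ] at hs
    rw [erase_insert (by simp [hs.2.2])]

theorem esF_nonneg (k : ℕ) {d : Fin n → ℝ} (hd : ∀ i, 0 ≤ d i) (i : Fin n) : 0 ≤ esF k d i :=
  Finset.sum_nonneg fun s _ => by
    split_ifs
    · exact Finset.prod_nonneg fun l _ => hd l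
    · exact le_rfl

theorem esG_nonneg (k : ℕ) {d : Fin n → ℝ} (hd : ∀ i, 0 ≤ d i) (i j : Fin n) : 0 ≤ esG k d i j :=
  Finset.sum_nonneg fun s _ => by
    split_ifs
    · exact Finset.prod_nonneg fun l _ => hd l
    · exact le_rfl

theorem esFF_nonneg (k : ℕ) {d : Fin n → ℝ} (hd : ∀ i, 0 ≤ d i) (i j : Fin n) :
    0 ≤ esFF k d i j :=
  Finset.sum_nonneg fun s _ => by
    split_ifs
    · exact Finset.prod_nonneg fun l _ => hd l
    · exact le_rfl

theorem prod_le_pow_of_le {d : Fin n → ℝ} {C : ℝ} (hC : 1 ≤ C) (hd : ∀ i, 0 ≤ d i)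
    (hdC : ∀ i, d i ≤ C) (s : Finset (Fin n)) : ∏ i ∈ s, d i ≤ C ^ n :=
  calc ∏ i ∈ s, d i ≤ ∏ _i ∈ s, C := Finset.prod_le_prod (fun i _ => hd i) fun i _ => hdC i
    _ = C ^ s.card := by simp
    _ ≤ C ^ n := pow_le_pow_right₀ hC (by simpa using Finset.card_le_univ s)

theorem card_powersetCard_univ_le (k : ℕ) :
    ((powersetCard k (univ : Finset (Fin n))).card : ℝ) ≤ 2 ^ n := by
  rw [card_powersetCard]
  have : (univ : Finset (Fin n)).card = n := by simp
  rw [this]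
  exact_mod_cast Nat.choose_le_two_pow n k

theorem esF_le (k : ℕ) {d : Fin n → ℝ} {C : ℝ} (hC : 1 ≤ C) (hd : ∀ i, 0 ≤ d i)
    (hdC : ∀ i, d i ≤ C) (i : Fin n) : esF k d i ≤ 2 ^ n * C ^ n := by
  have h0 : (0 : ℝ) ≤ C ^ n := by positivity
  calc esF k d i ≤ ∑ _s ∈ powersetCard k (univ : Finset (Fin n)), C ^ n :=
        Finset.sum_le_sum fun s _ => by
          split_ifs
          · exact prod_le_pow_of_le hC hd hdC _
          · exact h0
    _ ≤ 2 ^ n * C ^ n := by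
        rw [Finset.sum_const, nsmul_eq_mul]
        exact mul_le_mul_of_nonneg_right (card_powersetCard_univ_le k) h0

theorem esFF_le (k : ℕ) {d : Fin n → ℝ} {C : ℝ} (hC : 1 ≤ C) (hd : ∀ i, 0 ≤ d i)
    (hdC : ∀ i, d i ≤ C) (i j : Fin n) : esFF k d i j ≤ 2 ^ n * C ^ n := by
  have h0 : (0 : ℝ) ≤ C ^ n := by positivity
  calc esFF k d i j ≤ ∑ _s ∈ powersetCard k (univ : Finset (Fin n)), C ^ n :=
        Finset.sum_le_sum fun s _ => by
          split_ifs
          · exact prod_le_pow_of_le hC hd hdC _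
          · exact h0
    _ ≤ 2 ^ n * C ^ n := by
        rw [Finset.sum_const, nsmul_eq_mul]
        exact mul_le_mul_of_nonneg_right (card_powersetCard_univ_le k) h0

/-- Quantitative ellipticity: since `k < n`, every partial derivative of `esS k` is bounded below
in terms of `esS k`. -/
theorem esS_le_mul_esF {k : ℕ} (hk1 : 1 ≤ k) {d : Fin n → ℝ} {C : ℝ} (hC : 1 ≤ C)
    (hd : ∀ i, 0 ≤ d i) (hdC : ∀ i, d i ≤ C) (l : Fin n) :
    esS k d ≤ 2 ^ n * C * esF k d l := by
  have hmain : ∀ s ∈ powersetCard k (univ : Finset (Fin n)), ∏ i ∈ s, d i ≤ C * esF k d l := by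
    intro s hs
    have hcard := mem_powersetCard_univ.mp hs
    have hterm : ∀ t ∈ powersetCard k (univ : Finset (Fin n)), l ∈ t →
        ∏ i ∈ t.erase l, d i ≤ esF k d l := by
      intro t ht hlt
      have := Finset.single_le_sum (f := fun s : Finset (Fin n) =>
        if l ∈ s then ∏ i ∈ s.erase l, d i else 0) (s := powersetCard k univ) (fun s _ => by
          split_ifs
          · exact Finset.prod_nonneg fun l _ => hd l
          · exact le_rfl) ht
      simpa only [esF, hlt, if_true] using this
    by_cases hl : l ∈ s
    · rw [← Finset.mul_prod_erase _ _ hl]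
      exact mul_le_mul (hdC l) (hterm s hs hl) (Finset.prod_nonneg fun l _ => hd l) (by linarith)
    · obtain ⟨i, hi⟩ : s.Nonempty := card_pos.mp (by omega)
      have hl' : l ∉ s.erase i := fun h => hl (mem_of_mem_erase h)
      have := hterm (insert l (s.erase i)) (by
        rw [mem_powersetCard_univ, card_insert_of_notMem hl', card_erase_of_mem hi]; omega)
        (by simp)
      rw [erase_insert hl'] at this
      rw [← Finset.mul_prod_erase _ _ hi]
      exact mul_le_mul (hdC i) this (Finset.prod_nonneg fun l _ => hd l) (by linarith)
  have h0 : 0 ≤ C * esF k d l := mul_nonneg (by linarith) (esF_nonneg k hd l)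
  calc esS k d ≤ ∑ _s ∈ powersetCard k (univ : Finset (Fin n)), C * esF k d l :=
        Finset.sum_le_sum hmain
    _ ≤ 2 ^ n * (C * esF k d l) := by
        rw [Finset.sum_const, nsmul_eq_mul]
        exact mul_le_mul_of_nonneg_right (card_powersetCard_univ_le k) h0
    _ = _ := by ring

theorem sum_esF_mul_self (k : ℕ) (d : Fin n → ℝ) : ∑ i, esF k d i * d i = k * esS k d := by
  rw [sum_esF_mul, esS, Finset.mul_sum]
  refine Finset.sum_congr rfl fun s hs => ?_
  rw [Finset.sum_congr rfl fun i hi => Finset.prod_erase_mul s d hi, Finset.sum_const,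
    mem_powersetCard_univ.mp hs, nsmul_eq_mul]

theorem sigmaMat_diagonal (k : ℕ) (d : Fin n → ℝ) :
    sigmaMat k (Matrix.diagonal d) = esS k d := by
  unfold sigmaMat esS
  refine Finset.sum_congr rfl fun s _ => ?_
  have hd := diagonal_subtype d s
  rw [hd, Matrix.det_diagonal]
  exact Finset.prod_coe_sort s d

theorem le_esS (k : ℕ) {d : Fin n → ℝ} {c : ℝ} (hc : 0 ≤ c) (hd : ∀ i, c ≤ d i) :
    n.choose k * c ^ k ≤ esS k d := by
  unfold esS
  calc (n.choose k * c ^ k : ℝ) = ∑ s ∈ powersetCard k (univ : Finset (Fin n)), c ^ k := by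
        rw [Finset.sum_const, card_powersetCard, nsmul_eq_mul]; simp
    _ ≤ _ := Finset.sum_le_sum fun s hs => by
        rw [← mem_powersetCard_univ.mp hs, ← Finset.prod_const]
        exact Finset.prod_le_prod (fun i _ => hc) fun i _ => hd i

/-- Inverse concavity of `esS k ^ (1/k)` in diagonal directions. -/
theorem esS_inverse_concave {k : ℕ} (hk : 1 ≤ k) {d : Fin n → ℝ} (hd : ∀ i, 0 ≤ d i)
    (y : Fin n → ℝ) :
    (1 + 1 / (k : ℝ)) * (∑ i, esF k d i * (d i * y i)) ^ 2 ≤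
      esS k d * (∑ i, ∑ j ∈ univ.erase i, esFF k d i j * ((d i * y i) * (d j * y j)) +
        2 * ∑ i, esF k d i * (d i * y i ^ 2)) := by
  have hk' : (0 : ℝ) < k := by exact_mod_cast hk
  rw [sum_esF_mul, sum_esF_mul k d fun i => d i * y i ^ 2,
    sum_esFF_mul k d fun i j => (d i * y i) * (d j * y j)]
  set P := powersetCard k (univ : Finset (Fin n))
  have e1 : ∑ s ∈ P, ∑ i ∈ s, (∏ l ∈ s.erase i, d l) * (d i * y i) =
      ∑ s ∈ P, (∏ l ∈ s, d l) * ∑ i ∈ s, y i := by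
    refine Finset.sum_congr rfl fun s _ => ?_
    rw [Finset.mul_sum]
    refine Finset.sum_congr rfl fun i hi => ?_
    rw [← Finset.prod_erase_mul s d hi]; ring
  have e2 : ∑ s ∈ P, ∑ i ∈ s, (∏ l ∈ s.erase i, d l) * (d i * y i ^ 2) =
      ∑ s ∈ P, (∏ l ∈ s, d l) * ∑ i ∈ s, y i ^ 2 := by
    refine Finset.sum_congr rfl fun s _ => ?_
    rw [Finset.mul_sum]
    refine Finset.sum_congr rfl fun i hi => ?_
    rw [← Finset.prod_erase_mul s d hi]; ring
  have e3 : ∑ s ∈ P, ∑ i ∈ s, ∑ j ∈ s.erase i, (∏ l ∈ (s.erase i).erase j, d l) *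
      ((d i * y i) * (d j * y j)) =
      ∑ s ∈ P, (∏ l ∈ s, d l) * ((∑ i ∈ s, y i) ^ 2 - ∑ i ∈ s, y i ^ 2) := by
    refine Finset.sum_congr rfl fun s _ => ?_
    have : (∑ i ∈ s, y i) ^ 2 - ∑ i ∈ s, y i ^ 2 = ∑ i ∈ s, ∑ j ∈ s.erase i, y i * y j := by
      rw [sq, Finset.sum_mul_sum, ← Finset.sum_sub_distrib]
      refine Finset.sum_congr rfl fun i hi => ?_
      rw [Finset.sum_erase_eq_sub hi]; ring
    rw [this, Finset.mul_sum]
    refine Finset.sum_congr rfl fun i hi => ?_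
    rw [Finset.mul_sum]
    refine Finset.sum_congr rfl fun j hj => ?_
    rw [← Finset.prod_erase_mul s d hi, ← Finset.prod_erase_mul (s.erase i) d hj]; ring
  rw [e1, e2, e3, Finset.mul_sum, ← Finset.sum_add_distrib]
  have hp : ∀ s ∈ P, 0 ≤ ∏ l ∈ s, d l := fun s _ => Finset.prod_nonneg fun l _ => hd l
  have hCS : (∑ s ∈ P, (∏ l ∈ s, d l) * ∑ i ∈ s, y i) ^ 2 ≤
      esS k d * ∑ s ∈ P, (∏ l ∈ s, d l) * (∑ i ∈ s, y i) ^ 2 := by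
    refine Finset.sum_sq_le_sum_mul_sum_of_sq_le_mul P hp
      (fun s hs => mul_nonneg (hp s hs) (sq_nonneg _)) fun s _ => le_of_eq (by ring)
  have hS : 0 ≤ esS k d := Finset.sum_nonneg hp
  calc _ ≤ (1 + 1 / (k : ℝ)) * (esS k d * ∑ s ∈ P, (∏ l ∈ s, d l) * (∑ i ∈ s, y i) ^ 2) :=
        mul_le_mul_of_nonneg_left hCS (by positivity)
    _ = esS k d * ∑ s ∈ P, (1 + 1 / (k : ℝ)) * ((∏ l ∈ s, d l) * (∑ i ∈ s, y i) ^ 2) := by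
        rw [← Finset.mul_sum]; ring
    _ ≤ _ := by
        refine mul_le_mul_of_nonneg_left (Finset.sum_le_sum fun s hs => ?_) hS
        have h1 : (∑ i ∈ s, y i) ^ 2 ≤ k * ∑ i ∈ s, y i ^ 2 := by
          have := sq_sum_le_card_mul_sum_sq (s := s) (f := y)
          rwa [mem_powersetCard_univ.mp hs] at this
        have h2 : 1 / (k : ℝ) * (∑ i ∈ s, y i) ^ 2 ≤ ∑ i ∈ s, y i ^ 2 := by
          rw [div_mul_eq_mul_div, one_mul, div_le_iff₀ hk']; linarith
        nlinarith [mul_le_mul_of_nonneg_left h2 (hp s hs)]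

end ElementarySymmetric

section AlgebraicInequality

variable {n : ℕ}

theorem esFF_symm (k : ℕ) (d : Fin n → ℝ) (i j : Fin n) : esFF k d i j = esFF k d j i := by
  simp only [esFF]
  refine Finset.sum_congr rfl fun s _ => ?_
  rw [Finset.erase_right_comm]
  simp only [and_comm]

theorem offdiag_row_bound {k : ℕ} {d a η : Fin n → ℝ} {S : Fin n → Fin n → ℝ} {i₀ j : Fin n}
    {C : ℝ} (hC : 1 ≤ C) (hd : ∀ i, 0 ≤ d i)
    (hS0 : ∀ l, S i₀ l = d l * a l + η l) (hSs : ∀ j l, S j l = S l j) (hj : j ≠ i₀)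
    (hdeg : d j = 0 → ∀ l, S j l = 0) (ha : |a j| ≤ C) (hdC : ∀ i, d i ≤ C)
    (hFC : ∀ i, esF k d i ≤ C) (hFFC : ∀ i j, esFF k d i j ≤ C) :
    2 * esF k d j * (d j * a j ^ 2) - 6 * C ^ 4 * (d i₀ + |η j|) ≤
      ∑ l ∈ univ.erase j, (2 * (esF k d l * (S j l ^ 2 / d j)) - esFF k d j l * S j l ^ 2) -
        esFF k d i₀ j * S i₀ j ^ 2 := by
  have hC2 : C ≤ C ^ 2 := by nlinarith
  have hC3 : C ^ 2 ≤ C ^ 4 := by nlinarith [sq_nonneg (C ^ 2), sq_nonneg C]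
  have hμ : 0 ≤ d i₀ := hd i₀
  have hη := abs_nonneg (η j)
  rcases (hd j).eq_or_lt with h0 | hpos
  · have hS := hdeg h0.symm
    have : ∑ l ∈ univ.erase j, (2 * (esF k d l * (S j l ^ 2 / d j)) - esFF k d j l * S j l ^ 2)
        = 0 := Finset.sum_eq_zero fun l _ => by rw [hS l]; simp
    rw [this, hSs i₀ j, hS i₀, ← h0]
    have : 0 ≤ 6 * C ^ 4 * (d i₀ + |η j|) := by positivity
    nlinarith
  · have hterm : ∀ l ∈ univ.erase j,
        0 ≤ 2 * (esF k d l * (S j l ^ 2 / d j)) - esFF k d j l * S j l ^ 2 := by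
      intro l hl
      have e := esF_eq k d (i := l) (j := j) (ne_of_mem_erase hl).symm
      rw [esFF_symm k d j l]
      have h1 : d j * esFF k d l j ≤ esF k d l := by
        have := esG_nonneg k hd l j; linarith
      have h2 : (d j * esFF k d l j) * (S j l ^ 2 / d j) ≤ esF k d l * (S j l ^ 2 / d j) :=
        mul_le_mul_of_nonneg_right h1 (by positivity)
      have h3 : (d j * esFF k d l j) * (S j l ^ 2 / d j) = esFF k d l j * S j l ^ 2 := by
        field_simp
      have h4 : 0 ≤ esFF k d l j * S j l ^ 2 := mul_nonneg (esFF_nonneg k hd l j) (sq_nonneg _)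
      linarith
    have hsingle := Finset.single_le_sum hterm (mem_erase.mpr ⟨hj.symm, mem_univ i₀⟩)
    refine le_trans ?_ (sub_le_sub_right hsingle _)
    have e1 := esF_eq k d (i := i₀) (j := j) hj
    have e2 := esF_eq k d (i := j) (j := i₀) hj.symm
    rw [esG_symm k d j i₀, esFF_symm k d j i₀] at e2
    rw [esFF_symm k d j i₀, hSs j i₀, e1]
    have hG := esG_nonneg k hd i₀ j
    have hGC : esG k d i₀ j ≤ C := by
      have := hFC i₀
      have := mul_nonneg (hd j) (esFF_nonneg k hd i₀ j)
      linarith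
    have hFF := esFF_nonneg k hd i₀ j
    have hFFc := hFFC i₀ j
    set G := esG k d i₀ j
    set H := esFF k d i₀ j
    set s := S i₀ j
    have hs : s = d j * a j + η j := hS0 j
    have h1 : 2 * ((G + d j * H) * (s ^ 2 / d j)) - H * s ^ 2 - H * s ^ 2 =
        2 * G * (s ^ 2 / d j) := by field_simp; ring
    have h2 : d j * a j ^ 2 + 2 * a j * η j ≤ s ^ 2 / d j := by
      rw [le_div_iff₀ hpos, hs]; nlinarith [sq_nonneg (η j)]
    rw [e2, h1]
    have h3 : 2 * G * (d j * a j ^ 2 + 2 * a j * η j) ≤ 2 * G * (s ^ 2 / d j) :=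
      mul_le_mul_of_nonneg_left h2 (by positivity)
    have ha2 : a j ^ 2 ≤ C ^ 2 := sq_le_sq' (abs_le.mp ha).1 (abs_le.mp ha).2
    have h4 : H * (d j * a j ^ 2) ≤ C * (C * C ^ 2) := by
      gcongr
      · exact hdC j
    have h5 : d i₀ * (H * (d j * a j ^ 2)) ≤ d i₀ * C ^ 4 := by
      refine mul_le_mul_of_nonneg_left (h4.trans (le_of_eq (by ring))) hμ
    have h6 : -(C * C * |η j|) ≤ G * (a j * η j) := by
      have : |G * (a j * η j)| ≤ C * C * |η j| := by
        rw [abs_mul, abs_mul, abs_of_nonneg hG, ← mul_assoc]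
        gcongr
      exact (abs_le.mp this).1
    have h7 : C * C * |η j| ≤ C ^ 4 * |η j| :=
      mul_le_mul_of_nonneg_right (by nlinarith) hη
    have h8 : 0 ≤ C ^ 4 * d i₀ := by positivity
    have h9 : 0 ≤ C ^ 4 * |η j| := by positivity
    nlinarith

theorem sum_offdiag_split (i₀ : Fin n) (g : Fin n → Fin n → ℝ) :
    ∑ i, ∑ j ∈ univ.erase i, g i j =
      ∑ j ∈ univ.erase i₀, (∑ l ∈ univ.erase j, g j l + g i₀ j) := by
  rw [← Finset.add_sum_erase _ _ (mem_univ i₀), Finset.sum_add_distrib, add_comm]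

set_option maxHeartbeats 1000000 in
/-- The algebraic inequality behind the constant rank argument: the concavity defect of the
equation, together with the good third order terms, is nonnegative up to an error controlled by
the smallest eigenvalue and its gradient. -/
theorem algebraic_inequality {k : ℕ} (hk : 1 ≤ k) {d a η : Fin n → ℝ} {S : Fin n → Fin n → ℝ}
    {i₀ : Fin n} {C : ℝ} (hC : 1 ≤ C) (hd : ∀ i, 0 ≤ d i)
    (hS0 : ∀ l, S i₀ l = d l * a l + η l) (hSs : ∀ j l, S j l = S l j)
    (hdeg : ∀ j, j ≠ i₀ → d j = 0 → ∀ l, S j l = 0) (ha : ∀ j, |a j| ≤ C) (hdC : ∀ i, d i ≤ C)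
    (hSC : ∀ j l, |S j l| ≤ C)
    (hFC : ∀ i, esF k d i ≤ C) (hFFC : ∀ i j, esFF k d i j ≤ C) (hσ : 1 ≤ C * esS k d)
    {X : Fin n → Fin n → ℝ}
    (hX : ∀ j l, X j l = S j l - d i₀ * a i₀ * if j = l then 1 else 0) :
    (1 + 1 / (k : ℝ)) * (∑ l, esF k d l * X l l) ^ 2 / esS k d ≤
      ∑ i, ∑ j ∈ univ.erase i, esFF k d i j * (X i i * X j j - X i j * X j i) +
        ∑ l, esF k d l * ∑ j ∈ univ.erase i₀, 2 * (S j l ^ 2 / d j) -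
        2 * ∑ l, esF k d l * (d l * a l ^ 2) +
        30 * n ^ 2 * C ^ 6 * (d i₀ + ∑ l, |η l|) := by
  have hC0 : 0 < C := by linarith
  have hσ0 : 0 < esS k d := by
    by_contra h
    nlinarith
  set δ := d i₀ + ∑ l, |η l| with hδ
  have hη0 : 0 ≤ ∑ l, |η l| := Finset.sum_nonneg fun l _ => abs_nonneg _
  have hδ0 : 0 ≤ δ := add_nonneg (hd i₀) hη0
  have hηδ : ∀ l, d i₀ + |η l| ≤ δ := fun l => by
    have := Finset.single_le_sum (f := fun l => |η l|) (fun l _ => abs_nonneg _) (mem_univ l)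
    simp only [hδ]; linarith
  have hn1 : (1 : ℝ) ≤ n := by
    have : 0 < n := i₀.pos
    exact_mod_cast this
  have hF0 := fun i => esF_nonneg k hd i
  have hFF0 := fun i j => esFF_nonneg k hd i j
  -- the diagonal part
  set y : Fin n → ℝ := fun j => if j = i₀ then 0 else S j j / d j with hy
  set z : Fin n → ℝ := fun j => d j * y j with hz
  have hθ : |d i₀ * a i₀| ≤ C * δ := by
    rw [abs_mul, abs_of_nonneg (hd i₀), mul_comm C]
    have : d i₀ ≤ δ := by linarith
    gcongr
    exact ha i₀
  have hzS : ∀ j, j ≠ i₀ → z j = S j j := fun j hj => by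
    simp only [hz, hy, if_neg hj]
    rcases eq_or_ne (d j) 0 with h | h
    · rw [h, hdeg j hj h]; simp
    · field_simp
  have hz0 : z i₀ = 0 := by simp [hz, hy]
  have hr : ∀ j, |X j j - z j| ≤ C * δ := fun j => by
    by_cases hj : j = i₀
    · subst hj
      rw [hz0, hX, hS0]
      simp only [if_true]
      have : d j * a j + η j - d j * a j * 1 - 0 = η j := by ring
      rw [this]
      have := hηδ j
      have := hd j
      nlinarith
    · rw [hzS j hj, hX]
      simp only [if_true]
      have : S j j - d i₀ * a i₀ * 1 - S j j = -(d i₀ * a i₀) := by ring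
      rw [this, abs_neg]; exact hθ
  have hC12 : C ≤ C ^ 2 := by nlinarith
  have hzC : ∀ j, |z j| ≤ 2 * C ^ 2 := fun j => by
    by_cases hj : j = i₀
    · rw [hj, hz0, abs_zero]; positivity
    · rw [hzS j hj]; have := hSC j j; nlinarith
  have hXC : ∀ j, |X j j| ≤ 2 * C ^ 2 := fun j => by
    rw [hX]
    simp only [if_true]
    have h1 := hSC j j
    have h2 : |d i₀ * a i₀| ≤ C * C := by
      rw [abs_mul, abs_of_nonneg (hd i₀)]
      exact mul_le_mul (hdC i₀) (ha i₀) (abs_nonneg _) hC0.le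
    have := abs_sub (S j j) (d i₀ * a i₀ * 1)
    rw [mul_one] at this ⊢
    nlinarith
  have hconc := esS_inverse_concave hk hd y
  have hdiag : ∑ l, esF k d l * (d l * y l ^ 2) =
      ∑ j ∈ univ.erase i₀, esF k d j * (S j j ^ 2 / d j) := by
    rw [← Finset.add_sum_erase _ _ (mem_univ i₀)]
    have : y i₀ = 0 := by simp [hy]
    rw [this]
    simp only [ne_eq, OfNat.ofNat_ne_zero, not_false_eq_true, zero_pow, mul_zero, zero_add]
    refine Finset.sum_congr rfl fun j hj => ?_
    simp only [hy, if_neg (ne_of_mem_erase hj)]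
    rcases eq_or_ne (d j) 0 with h | h
    · rw [h]; simp
    · field_simp
  have hquad : ∑ i, ∑ j ∈ univ.erase i, esFF k d i j * (z i * z j) - 4 * n ^ 2 * C ^ 4 * δ ≤
      ∑ i, ∑ j ∈ univ.erase i, esFF k d i j * (X i i * X j j) := by
    have : ∑ i, ∑ j ∈ univ.erase i, (esFF k d i j * (z i * z j) - esFF k d i j * (X i i * X j j)) ≤
        ∑ i : Fin n, ∑ j : Fin n, 4 * C ^ 4 * δ := by
      refine Finset.sum_le_sum fun i _ => ?_
      refine le_trans (Finset.sum_le_sum (g := fun _ => 4 * C ^ 4 * δ) fun j _ => ?_)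
        (Finset.sum_le_sum_of_subset_of_nonneg (Finset.subset_univ _) fun _ _ _ => by positivity)
      have e : esFF k d i j * (z i * z j) - esFF k d i j * (X i i * X j j) =
        -(esFF k d i j * ((X i i - z i) * X j j + z i * (X j j - z j))) := by ring
      rw [e]
      refine (neg_le_abs _).trans ?_
      rw [abs_mul, abs_of_nonneg (hFF0 i j)]
      calc esFF k d i j * |(X i i - z i) * X j j + z i * (X j j - z j)|
          ≤ C * (C * δ * (2 * C ^ 2) + 2 * C ^ 2 * (C * δ)) := by
            refine mul_le_mul (hFFC i j) ?_ (abs_nonneg _) hC0.le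
            refine (abs_add_le _ _).trans (add_le_add ?_ ?_)
            · rw [abs_mul]
              exact mul_le_mul (hr i) (hXC j) (abs_nonneg _) (by positivity)
            · rw [abs_mul]
              exact mul_le_mul (hzC i) (hr j) (abs_nonneg _) (by positivity)
        _ = 4 * C ^ 4 * δ := by ring
    simp only [Finset.sum_sub_distrib, Finset.sum_const, card_univ, Fintype.card_fin,
      nsmul_eq_mul] at this
    linarith
  have hlin : (∑ l, esF k d l * X l l) ^ 2 ≤
      (∑ l, esF k d l * z l) ^ 2 + 4 * n ^ 2 * C ^ 5 * δ := by
    have e : (∑ l, esF k d l * X l l) ^ 2 - (∑ l, esF k d l * z l) ^ 2 =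
        (∑ l, esF k d l * (X l l - z l)) * ∑ l, esF k d l * (X l l + z l) := by
      simp only [mul_sub, mul_add, Finset.sum_sub_distrib, Finset.sum_add_distrib]; ring
    have h1 : |∑ l, esF k d l * (X l l - z l)| ≤ n * (C * (C * δ)) := by
      refine (Finset.abs_sum_le_sum_abs _ _).trans ?_
      refine (Finset.sum_le_sum (g := fun _ => C * (C * δ)) fun l _ => ?_).trans (by simp)
      rw [abs_mul, abs_of_nonneg (hF0 l)]
      exact mul_le_mul (hFC l) (hr l) (abs_nonneg _) hC0.le
    have h2 : |∑ l, esF k d l * (X l l + z l)| ≤ n * (C * (4 * C ^ 2)) := by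
      refine (Finset.abs_sum_le_sum_abs _ _).trans ?_
      refine (Finset.sum_le_sum (g := fun _ => C * (4 * C ^ 2)) fun l _ => ?_).trans (by simp)
      rw [abs_mul, abs_of_nonneg (hF0 l)]
      refine mul_le_mul (hFC l) ((abs_add_le _ _).trans ?_) (abs_nonneg _) hC0.le
      have := hXC l
      have := hzC l
      linarith
    have h3 := le_abs_self ((∑ l, esF k d l * (X l l - z l)) * ∑ l, esF k d l * (X l l + z l))
    rw [abs_mul] at h3
    have h4 := mul_le_mul h1 h2 (abs_nonneg _) (by positivity)
    have : (n * (C * (C * δ)) * (n * (C * (4 * C ^ 2))) : ℝ) = 4 * n ^ 2 * C ^ 5 * δ := by ring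
    linarith
  -- the off-diagonal part
  have hoff := Finset.sum_le_sum (s := univ.erase i₀) fun j hj =>
    offdiag_row_bound (k := k) (η := η) hC hd hS0 hSs (ne_of_mem_erase hj)
      (hdeg j (ne_of_mem_erase hj)) (ha j) hdC hFC hFFC
  have hXX : ∑ i, ∑ j ∈ univ.erase i, esFF k d i j * (X i i * X j j - X i j * X j i) =
      ∑ i, ∑ j ∈ univ.erase i, esFF k d i j * (X i i * X j j) -
      ∑ j ∈ univ.erase i₀, (∑ l ∈ univ.erase j, esFF k d j l * S j l ^ 2 +
        esFF k d i₀ j * S i₀ j ^ 2) := by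
    rw [← sum_offdiag_split i₀ fun j l => esFF k d j l * S j l ^ 2, ← Finset.sum_sub_distrib]
    refine Finset.sum_congr rfl fun i _ => ?_
    rw [← Finset.sum_sub_distrib]
    refine Finset.sum_congr rfl fun j hj => ?_
    have hne := ne_of_mem_erase hj
    rw [hX i j, hX j i, if_neg hne, if_neg hne.symm, hSs j i]
    ring
  have h3 : ∑ l, esF k d l * ∑ j ∈ univ.erase i₀, 2 * (S j l ^ 2 / d j) =
      ∑ j ∈ univ.erase i₀, ∑ l ∈ univ.erase j, 2 * (esF k d l * (S j l ^ 2 / d j)) +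
      2 * ∑ l, esF k d l * (d l * y l ^ 2) := by
    rw [hdiag, Finset.mul_sum, ← Finset.sum_add_distrib]
    simp only [Finset.mul_sum]
    rw [Finset.sum_comm]
    refine Finset.sum_congr rfl fun j _ => ?_
    rw [← Finset.sum_erase_add _ _ (mem_univ j)]
    congr 1
    · exact Finset.sum_congr rfl fun l _ => by ring
    · ring
  have h4 : ∑ l, esF k d l * (d l * a l ^ 2) = esF k d i₀ * (d i₀ * a i₀ ^ 2) +
      ∑ j ∈ univ.erase i₀, esF k d j * (d j * a j ^ 2) :=
    (Finset.add_sum_erase _ _ (mem_univ i₀)).symm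
  have h5 : esF k d i₀ * (d i₀ * a i₀ ^ 2) ≤ C ^ 3 * δ := by
    have h1 : a i₀ ^ 2 ≤ C ^ 2 := sq_le_sq' (abs_le.mp (ha i₀)).1 (abs_le.mp (ha i₀)).2
    have h2 : d i₀ ≤ δ := by linarith
    calc _ ≤ C * (δ * C ^ 2) := by
          have := hd i₀
          gcongr
          · exact hFC i₀
      _ = _ := by ring
  have h6 : ∑ j ∈ univ.erase i₀, 6 * C ^ 4 * (d i₀ + |η j|) ≤ n * (6 * C ^ 4 * δ) := by
    refine (Finset.sum_le_sum (g := fun _ => 6 * C ^ 4 * δ) fun j _ =>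
      mul_le_mul_of_nonneg_left (hηδ j) (by positivity)).trans ?_
    rw [Finset.sum_const, nsmul_eq_mul]
    refine mul_le_mul_of_nonneg_right ?_ (by positivity)
    have := Finset.card_le_univ (univ.erase i₀)
    rw [Fintype.card_fin] at this
    exact_mod_cast this
  simp only [Finset.sum_sub_distrib] at hoff
  rw [hXX, h3, div_le_iff₀ hσ0]
  have hoff' : 2 * ∑ j ∈ univ.erase i₀, esF k d j * (d j * a j ^ 2) =
      ∑ j ∈ univ.erase i₀, 2 * esF k d j * (d j * a j ^ 2) := by
    rw [Finset.mul_sum]; exact Finset.sum_congr rfl fun _ _ => by ring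
  rw [h4, Finset.sum_add_distrib]
  have hk1 : (1 + 1 / (k : ℝ)) ≤ 2 := by
    have hk' : (1 : ℝ) ≤ k := by exact_mod_cast hk
    have : 1 / (k : ℝ) ≤ 1 := by rw [div_le_one (by linarith)]; exact hk'
    linarith
  have hk0 : 0 ≤ 1 + 1 / (k : ℝ) := by positivity
  have h7 : (1 + 1 / (k : ℝ)) * (∑ l, esF k d l * X l l) ^ 2 ≤
      (1 + 1 / (k : ℝ)) * (∑ l, esF k d l * z l) ^ 2 + 8 * n ^ 2 * C ^ 5 * δ := by
    have h := mul_le_mul_of_nonneg_left hlin hk0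
    have h' : (1 + 1 / (k : ℝ)) * (4 * n ^ 2 * C ^ 5 * δ) ≤ 2 * (4 * n ^ 2 * C ^ 5 * δ) :=
      mul_le_mul_of_nonneg_right hk1 (by positivity)
    linarith
  have h8 : 8 * n ^ 2 * C ^ 5 * δ ≤ esS k d * (8 * n ^ 2 * C ^ 6 * δ) := by
    have h := mul_le_mul_of_nonneg_left hσ (show (0 : ℝ) ≤ 8 * n ^ 2 * C ^ 5 * δ by positivity)
    rw [mul_one] at h
    refine h.trans (le_of_eq (by ring))
  have p1 : (n : ℝ) ^ 2 * C ^ 4 * δ ≤ n ^ 2 * C ^ 6 * δ := by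
    have : C ^ 4 ≤ C ^ 6 := pow_le_pow_right₀ hC (by norm_num)
    gcongr
  have p2 : (n : ℝ) * (C ^ 4 * δ) ≤ n ^ 2 * C ^ 6 * δ := by
    have : C ^ 4 ≤ C ^ 6 := pow_le_pow_right₀ hC (by norm_num)
    have : (n : ℝ) ≤ n ^ 2 := le_self_pow₀ hn1 two_ne_zero
    rw [← mul_assoc]
    gcongr
  have p3 : C ^ 3 * δ ≤ n ^ 2 * C ^ 6 * δ := by
    have : C ^ 3 ≤ C ^ 6 := pow_le_pow_right₀ hC (by norm_num)
    have h1 : (1 : ℝ) ≤ n ^ 2 := one_le_pow₀ hn1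
    calc C ^ 3 * δ ≤ 1 * C ^ 6 * δ := by rw [one_mul]; gcongr
      _ ≤ _ := by gcongr
  refine h7.trans ((add_le_add hconc h8).trans ?_)
  rw [← mul_add, mul_comm]
  refine mul_le_mul_of_nonneg_right ?_ hσ0.le
  simp only [hz] at hquad
  have p0 : 0 ≤ (n : ℝ) ^ 2 * C ^ 6 * δ := by positivity
  linarith

end AlgebraicInequality

section Calculus

set_option maxSynthPendingDepth 3

variable {n : ℕ} {G : Type*} [NormedAddCommGroup G] [NormedSpace ℝ G]

theorem isOpen_ne_zero_euc : IsOpen {y : Euc n | y ≠ 0} := isOpen_ne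

theorem fderiv_self_of_ray {F : Euc n → G} {y : Euc n} (hF : DifferentiableAt ℝ F y) {g : ℝ → ℝ}
    {g' : ℝ} (hg : HasDerivAt g g' 1) (h : ∀ c : ℝ, 0 < c → F (c • y) = g c • F y) :
    fderiv ℝ F y y = g' • F y := by
  have h1 : HasDerivAt (fun c : ℝ => c • y) ((1 : ℝ) • y) 1 := (hasDerivAt_id (1 : ℝ)).smul_const y
  rw [one_smul] at h1
  have hF' : HasFDerivAt F (fderiv ℝ F y) ((1 : ℝ) • y) := by
    rw [one_smul]; exact hF.hasFDerivAt
  have h2 : HasDerivAt (fun c : ℝ => F (c • y)) (fderiv ℝ F y y) 1 :=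
    hF'.comp_hasDerivAt (1 : ℝ) h1
  have h3 : HasDerivAt (fun c : ℝ => g c • F y) (g' • F y) 1 := hg.smul_const (F y)
  refine h2.unique (h3.congr_of_eventuallyEq ?_)
  filter_upwards [lt_mem_nhds (show (0 : ℝ) < 1 by norm_num)] with c hc using h c hc

theorem fderiv_smul_of_homog {F : Euc n → G} {g : ℝ → ℝ}
    (hF : ∀ y, y ≠ 0 → DifferentiableAt ℝ F y)
    (h : ∀ c : ℝ, 0 < c → ∀ y, y ≠ 0 → F (c • y) = g c • F y) {c : ℝ} (hc : 0 < c) {y : Euc n}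
    (hy : y ≠ 0) : fderiv ℝ F (c • y) = (c⁻¹ * g c) • fderiv ℝ F y := by
  have hcy : c • y ≠ 0 := smul_ne_zero hc.ne' hy
  have h1 : HasFDerivAt (fun z => F (c • z))
      ((fderiv ℝ F (c • y)).comp (c • ContinuousLinearMap.id ℝ (Euc n))) y :=
    (hF _ hcy).hasFDerivAt.comp y ((hasFDerivAt_id y).const_smul c)
  have h2 : HasFDerivAt (fun z => g c • F z) (g c • fderiv ℝ F y) y :=
    (hF y hy).hasFDerivAt.const_smul (g c)
  have h3 := h1.unique (h2.congr_of_eventuallyEq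
    (by filter_upwards [isOpen_ne_zero_euc.mem_nhds hy] with z hz using h c hc z hz))
  ext v
  have h4 := congrArg (fun L : Euc n →L[ℝ] G => c⁻¹ • L v) h3
  simp only [ContinuousLinearMap.comp_apply, smul_apply,
    ContinuousLinearMap.id_apply, map_smul, smul_smul, inv_mul_cancel₀ hc.ne', one_smul] at h4
  simpa using h4

/-- Second Fréchet derivative of a function. -/
def d2 (g : Euc n → ℝ) : Euc n → Euc n →L[ℝ] Euc n →L[ℝ] ℝ := fderiv ℝ (fderiv ℝ g)

/-- Third Fréchet derivative of a function. -/
def d3 (g : Euc n → ℝ) : Euc n → Euc n →L[ℝ] Euc n →L[ℝ] Euc n →L[ℝ] ℝ := fderiv ℝ (d2 g)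

/-- Fourth Fréchet derivative of a function. -/
def d4 (g : Euc n → ℝ) : Euc n → Euc n →L[ℝ] Euc n →L[ℝ] Euc n →L[ℝ] Euc n →L[ℝ] ℝ :=
  fderiv ℝ (d3 g)

/-- `g` is `C²` away from the origin. -/
abbrev C2Off (g : Euc n → ℝ) : Prop := ContDiffOn ℝ 2 g {y : Euc n | y ≠ 0}

/-- `g` is `C⁴` away from the origin. -/
abbrev C4Off (g : Euc n → ℝ) : Prop := ContDiffOn ℝ 4 g {y : Euc n | y ≠ 0}

theorem C4Off.c2 {g : Euc n → ℝ} (h : C4Off g) : C2Off g := ContDiffOn.of_le h (by norm_num)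

theorem C2Off.hasFDerivAt {g : Euc n → ℝ} (h : C2Off g) {y : Euc n} (hy : y ≠ 0) :
    HasFDerivAt g (fderiv ℝ g y) y :=
  ((ContDiffOn.differentiableOn h (by norm_num)).differentiableAt
    (isOpen_ne_zero_euc.mem_nhds hy)).hasFDerivAt

theorem C2Off.contDiffOn_fderiv {g : Euc n → ℝ} (h : C2Off g) :
    ContDiffOn ℝ 1 (fderiv ℝ g) {y : Euc n | y ≠ 0} :=
  ContDiffOn.fderiv_of_isOpen h isOpen_ne_zero_euc (by norm_num)

theorem C2Off.hasFDerivAt_fderiv {g : Euc n → ℝ} (h : C2Off g) {y : Euc n} (hy : y ≠ 0) :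
    HasFDerivAt (fderiv ℝ g) (d2 g y) y :=
  ((h.contDiffOn_fderiv.differentiableOn (by norm_num)).differentiableAt
    (isOpen_ne_zero_euc.mem_nhds hy)).hasFDerivAt

theorem C4Off.contDiffOn_fderiv {g : Euc n → ℝ} (h : C4Off g) :
    ContDiffOn ℝ 3 (fderiv ℝ g) {y : Euc n | y ≠ 0} :=
  ContDiffOn.fderiv_of_isOpen h isOpen_ne_zero_euc (by norm_num)

theorem C4Off.contDiffOn_d2 {g : Euc n → ℝ} (h : C4Off g) :
    ContDiffOn ℝ 2 (d2 g) {y : Euc n | y ≠ 0} :=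
  ContDiffOn.fderiv_of_isOpen h.contDiffOn_fderiv isOpen_ne_zero_euc (by norm_num)

theorem C4Off.contDiffOn_d3 {g : Euc n → ℝ} (h : C4Off g) :
    ContDiffOn ℝ 1 (d3 g) {y : Euc n | y ≠ 0} :=
  ContDiffOn.fderiv_of_isOpen h.contDiffOn_d2 isOpen_ne_zero_euc (by norm_num)

theorem C4Off.hasFDerivAt_d2 {g : Euc n → ℝ} (h : C4Off g) {y : Euc n} (hy : y ≠ 0) :
    HasFDerivAt (d2 g) (d3 g y) y :=
  ((h.contDiffOn_d2.differentiableOn (by norm_num)).differentiableAt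
    (isOpen_ne_zero_euc.mem_nhds hy)).hasFDerivAt

theorem C4Off.hasFDerivAt_d3 {g : Euc n → ℝ} (h : C4Off g) {y : Euc n} (hy : y ≠ 0) :
    HasFDerivAt (d3 g) (d4 g y) y :=
  ((h.contDiffOn_d3.differentiableOn (by norm_num)).differentiableAt
    (isOpen_ne_zero_euc.mem_nhds hy)).hasFDerivAt

theorem second_symm {F : Euc n → G} {y : Euc n}
    (hF : ContDiffOn ℝ 2 F {y : Euc n | y ≠ 0}) (hy : y ≠ 0) (u v : Euc n) :
    fderiv ℝ (fderiv ℝ F) y u v = fderiv ℝ (fderiv ℝ F) y v u :=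
  ((hF.contDiffAt (isOpen_ne_zero_euc.mem_nhds hy)).isSymmSndFDerivAt (by simp)) u v

theorem C2Off.d2_symm {g : Euc n → ℝ} (h : C2Off g) {y : Euc n} (hy : y ≠ 0) (u v : Euc n) :
    d2 g y u v = d2 g y v u := second_symm h hy u v

theorem C4Off.d3_symm₁ {g : Euc n → ℝ} (h : C4Off g) {y : Euc n} (hy : y ≠ 0) (u v : Euc n) :
    d3 g y u v = d3 g y v u := second_symm (h.contDiffOn_fderiv.of_le (by norm_num)) hy u v

theorem C4Off.d4_symm₁ {g : Euc n → ℝ} (h : C4Off g) {y : Euc n} (hy : y ≠ 0) (u v : Euc n) :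
    d4 g y u v = d4 g y v u := second_symm h.contDiffOn_d2 hy u v

theorem C4Off.d3_symm₂ {g : Euc n → ℝ} (h : C4Off g) {y : Euc n} (hy : y ≠ 0) (u v w : Euc n) :
    d3 g y u v w = d3 g y u w v := by
  have key : ∀ v w, HasFDerivAt (fun z => d2 g z v w)
      ((((d3 g y).flip v).flip w)) y := fun v w => by
    have h1 := (h.hasFDerivAt_d2 hy).clm_apply (hasFDerivAt_const v y)
    have h2 := h1.clm_apply (hasFDerivAt_const w y)
    refine h2.congr_fderiv ?_
    ext u; simp
  have h3 := (key v w).unique ((key w v).congr_of_eventuallyEq (by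
    filter_upwards [isOpen_ne_zero_euc.mem_nhds hy] with z hz using h.c2.d2_symm hz v w))
  simpa using congrArg (fun L : Euc n →L[ℝ] ℝ => L u) h3

theorem C4Off.d4_symm₂ {g : Euc n → ℝ} (h : C4Off g) {y : Euc n} (hy : y ≠ 0) (u v w : Euc n) :
    d4 g y u v w = d4 g y u w v := by
  have key : ∀ v w, HasFDerivAt (fun z => d3 g z v w)
      ((((d4 g y).flip v).flip w)) y := fun v w => by
    have h1 := (h.hasFDerivAt_d3 hy).clm_apply (hasFDerivAt_const v y)
    have h2 := h1.clm_apply (hasFDerivAt_const w y)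
    refine h2.congr_fderiv ?_
    ext u; simp
  have h3 := (key v w).unique ((key w v).congr_of_eventuallyEq (by
    filter_upwards [isOpen_ne_zero_euc.mem_nhds hy] with z hz using h.d3_symm₁ hz v w))
  simpa using congrArg (fun L : Euc n →L[ℝ] Euc n →L[ℝ] ℝ => L u) h3

theorem C4Off.d4_symm₃ {g : Euc n → ℝ} (h : C4Off g) {y : Euc n} (hy : y ≠ 0)
    (u v w z : Euc n) : d4 g y u v w z = d4 g y u v z w := by
  have key : ∀ v w z, HasFDerivAt (fun x => d3 g x v w z)
      (((((d4 g y).flip v).flip w)).flip z) y := fun v w z => by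
    have h1 := (h.hasFDerivAt_d3 hy).clm_apply (hasFDerivAt_const v y)
    have h2 := h1.clm_apply (hasFDerivAt_const w y)
    have h3 := h2.clm_apply (hasFDerivAt_const z y)
    refine h3.congr_fderiv ?_
    ext u; simp
  have h3 := (key v w z).unique ((key v z w).congr_of_eventuallyEq (by
    filter_upwards [isOpen_ne_zero_euc.mem_nhds hy] with x hx using h.d3_symm₂ hx v w z))
  simpa using congrArg (fun L : Euc n →L[ℝ] ℝ => L u) h3

theorem C4Off.d4_swap {g : Euc n → ℝ} (h : C4Off g) {y : Euc n} (hy : y ≠ 0) (u v : Euc n) :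
    d4 g y u u v v = d4 g y v v u u := by
  rw [h.d4_symm₂ hy u u v, h.d4_symm₁ hy u v, h.d4_symm₃ hy v u u v, h.d4_symm₂ hy v u v]

/-- One-homogeneity away from the origin. -/
def Homog1 (g : Euc n → ℝ) : Prop := ∀ c : ℝ, 0 < c → ∀ y : Euc n, y ≠ 0 → g (c • y) = c * g y

theorem Homog1.fderiv_self {g : Euc n → ℝ} (hh : Homog1 g) (h : C2Off g) {y : Euc n}
    (hy : y ≠ 0) : fderiv ℝ g y y = g y := by
  simpa using fderiv_self_of_ray (h.hasFDerivAt hy).differentiableAt (hasDerivAt_id (1 : ℝ))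
    (g := id) fun c hc => hh c hc y hy

theorem Homog1.fderiv_smul {g : Euc n → ℝ} (hh : Homog1 g) (h : C2Off g) {c : ℝ} (hc : 0 < c)
    {y : Euc n} (hy : y ≠ 0) : fderiv ℝ g (c • y) = fderiv ℝ g y := by
  have := fderiv_smul_of_homog (g := id) (fun y hy => (h.hasFDerivAt hy).differentiableAt) hh hc hy
  simpa [hc.ne'] using this

theorem Homog1.d2_self {g : Euc n → ℝ} (hh : Homog1 g) (h : C2Off g) {y : Euc n}
    (hy : y ≠ 0) : d2 g y y = 0 := by
  have := fderiv_self_of_ray (h.hasFDerivAt_fderiv hy).differentiableAt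
    (hasDerivAt_const (1 : ℝ) (1 : ℝ)) fun c hc => by
      rw [one_smul]; exact hh.fderiv_smul h hc hy
  rw [zero_smul] at this
  exact this

theorem Homog1.d2_smul {g : Euc n → ℝ} (hh : Homog1 g) (h : C2Off g) {c : ℝ} (hc : 0 < c)
    {y : Euc n} (hy : y ≠ 0) : d2 g (c • y) = c⁻¹ • d2 g y := by
  have := fderiv_smul_of_homog (g := fun _ => 1)
    (fun y hy => (h.hasFDerivAt_fderiv hy).differentiableAt)
    (fun c hc y hy => by rw [one_smul]; exact hh.fderiv_smul h hc hy) hc hy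
  rw [mul_one] at this
  exact this

theorem Homog1.d3_self {g : Euc n → ℝ} (hh : Homog1 g) (h : C4Off g) {y : Euc n}
    (hy : y ≠ 0) : d3 g y y = -d2 g y := by
  have hi : HasDerivAt (fun c : ℝ => c⁻¹) (-1) 1 := by
    simpa using hasDerivAt_inv (one_ne_zero (α := ℝ))
  have := fderiv_self_of_ray (F := d2 g) (h.hasFDerivAt_d2 hy).differentiableAt hi
    fun c hc => hh.d2_smul h.c2 hc hy
  rw [neg_one_smul] at this
  exact this

theorem Homog1.d2_self_right {g : Euc n → ℝ} (hh : Homog1 g) (h : C2Off g) {y : Euc n}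
    (hy : y ≠ 0) (u : Euc n) : d2 g y u y = 0 := by
  rw [h.d2_symm hy, hh.d2_self h hy]; rfl

theorem Homog1.d3_self₂ {g : Euc n → ℝ} (hh : Homog1 g) (h : C4Off g) {y : Euc n}
    (hy : y ≠ 0) (u : Euc n) : d3 g y u y = -d2 g y u := by
  rw [h.d3_symm₁ hy, hh.d3_self h hy]; rfl

theorem Homog1.d3_self₃ {g : Euc n → ℝ} (hh : Homog1 g) (h : C4Off g) {y : Euc n}
    (hy : y ≠ 0) (u v : Euc n) : d3 g y u v y = -d2 g y u v := by
  rw [h.d3_symm₂ hy, hh.d3_self₂ h hy]; rfl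

theorem Homog0.fderiv_self {g : Euc n → ℝ} (hh : Homog0 g) (h : C2Off g) {y : Euc n}
    (hy : y ≠ 0) : fderiv ℝ g y y = 0 := by
  have := fderiv_self_of_ray (h.hasFDerivAt hy).differentiableAt
    (hasDerivAt_const (1 : ℝ) (1 : ℝ)) fun c hc => by rw [one_smul]; exact hh c y hc
  simpa using this

end Calculus

section Geodesics

set_option maxSynthPendingDepth 3

variable {n : ℕ}

/-- The unit speed great circle through `y` with initial velocity `u`. -/
def geo (y u : Euc n) (t : ℝ) : Euc n := Real.cos t • y + Real.sin t • u

theorem norm_geo {y u : Euc n} (hy : ‖y‖ = 1) (hu : ‖u‖ = 1) (hyu : ⟪y, u⟫ = 0) (t : ℝ) :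
    ‖geo y u t‖ = 1 := by
  have h : ‖geo y u t‖ ^ 2 = 1 := by
    rw [geo, norm_add_sq_real, norm_smul, norm_smul, inner_smul_left, inner_smul_right, hyu, hy, hu]
    simp [Real.cos_sq_add_sin_sq]
  nlinarith [norm_nonneg (geo y u t)]

theorem geo_ne_zero {y u : Euc n} (hy : ‖y‖ = 1) (hu : ‖u‖ = 1) (hyu : ⟪y, u⟫ = 0) (t : ℝ) :
    geo y u t ≠ 0 := by
  intro h
  have := norm_geo hy hu hyu t
  rw [h, norm_zero] at this
  exact zero_ne_one this

theorem hasDerivAt_geo (y u : Euc n) (t : ℝ) :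
    HasDerivAt (geo y u) (geo u (-y) t) t := by
  have := ((Real.hasDerivAt_cos t).smul_const y).add ((Real.hasDerivAt_sin t).smul_const u)
  refine this.congr_deriv ?_
  simp only [geo, smul_neg, neg_smul]; abel

theorem hasJet_geo (y u : Euc n) : HasJet (geo y u) y u (-y) :=
  ⟨geo u (-y), hasDerivAt_geo y u, (hasDerivAt_geo u (-y) 0).congr_deriv (by simp [geo]),
    by simp [geo], by simp [geo]⟩

variable {g : Euc n → ℝ} {y u : Euc n}

theorem C2Off.hasJet_geo (h : C2Off g) (hy : ‖y‖ = 1) (hu : ‖u‖ = 1) (hyu : ⟪y, u⟫ = 0) :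
    HasJet (fun t => g (geo y u t)) (g y) (fderiv ℝ g y u)
      (d2 g y u u - fderiv ℝ g y y) := by
  have hy0 : y ≠ 0 := by rintro rfl; simp at hy
  refine ((_root_.hasJet_geo y u).fcomp (fun t => h.hasFDerivAt (geo_ne_zero hy hu hyu t))
    (h.hasFDerivAt_fderiv hy0)).of_eq rfl rfl ?_
  rw [map_neg, sub_eq_add_neg]

theorem C4Off.hasJet_fderiv_geo (h : C4Off g) (hh : Homog1 g) (hy : ‖y‖ = 1) (hu : ‖u‖ = 1)
    (hyu : ⟪y, u⟫ = 0) :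
    HasJet (fun t => fderiv ℝ g (geo y u t)) (fderiv ℝ g y) (d2 g y u) (d3 g y u u) := by
  have hy0 : y ≠ 0 := by rintro rfl; simp at hy
  refine ((_root_.hasJet_geo y u).fcomp
    (fun t => h.c2.hasFDerivAt_fderiv (geo_ne_zero hy hu hyu t))
    (h.hasFDerivAt_d2 hy0)).of_eq rfl rfl ?_
  rw [map_neg, hh.d2_self h.c2 hy0]; simp

theorem C4Off.hasJet_d2_geo (h : C4Off g) (hh : Homog1 g) (hy : ‖y‖ = 1) (hu : ‖u‖ = 1)
    (hyu : ⟪y, u⟫ = 0) :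
    HasJet (fun t => d2 g (geo y u t)) (d2 g y) (d3 g y u) (d4 g y u u + d2 g y) := by
  have hy0 : y ≠ 0 := by rintro rfl; simp at hy
  refine ((_root_.hasJet_geo y u).fcomp (fun t => h.hasFDerivAt_d2 (geo_ne_zero hy hu hyu t))
    (h.hasFDerivAt_d3 hy0)).of_eq rfl rfl ?_
  rw [map_neg, hh.d3_self h hy0, neg_neg]

end Geodesics

section Frames

variable {n : ℕ} {y : Euc n} {e : Fin n → Euc n}

/-- The orthonormal basis of the ambient space made of a point of the sphere and a tangent frame. -/
theorem OrthoFrame.exists_basis (he : OrthoFrame y e) (hy : ‖y‖ = 1) :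
    ∃ b : OrthonormalBasis (Fin (n + 1)) ℝ (Euc n), b 0 = y ∧ ∀ l : Fin n, b l.succ = e l := by
  have hon : Orthonormal ℝ (Fin.cons y e : Fin (n + 1) → Euc n) := by
    rw [orthonormal_iff_ite]
    intro i j
    refine Fin.cases ?_ (fun i => ?_) i <;> refine Fin.cases ?_ (fun j => ?_) j
    · simp [hy]
    · simp [he.1 j, (Fin.succ_ne_zero j).symm]
    · simp [real_inner_comm, he.1 i, Fin.succ_ne_zero]
    · simp [he.2 i j]
  let b := basisOfOrthonormalOfCardEqFinrank hon (by simp)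
  have hb : ⇑b = Fin.cons y e := coe_basisOfOrthonormalOfCardEqFinrank hon (by simp)
  refine ⟨b.toOrthonormalBasis (by rw [hb]; exact hon), ?_, fun l => ?_⟩
  · simp [hb]
  · simp [hb]

theorem OrthoFrame.expand (he : OrthoFrame y e) (hy : ‖y‖ = 1) (z : Euc n) :
    z = ⟪y, z⟫ • y + ∑ l, ⟪e l, z⟫ • e l := by
  obtain ⟨b, h0, hs⟩ := he.exists_basis hy
  have := b.sum_repr' z
  rw [Fin.sum_univ_succ, h0] at this
  simp only [hs] at this
  exact this.symm

theorem OrthoFrame.norm_sq (he : OrthoFrame y e) (hy : ‖y‖ = 1) (z : Euc n) :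
    ‖z‖ ^ 2 = ⟪y, z⟫ ^ 2 + ∑ l, ⟪e l, z⟫ ^ 2 := by
  obtain ⟨b, h0, hs⟩ := he.exists_basis hy
  have := b.sum_sq_norm_inner_right z
  rw [Fin.sum_univ_succ, h0] at this
  simp only [hs, Real.norm_eq_abs, sq_abs] at this
  exact this.symm

theorem OrthoFrame.clm_norm_sq (he : OrthoFrame y e) (hy : ‖y‖ = 1) (T : Euc n →L[ℝ] ℝ) :
    ‖T‖ ^ 2 = T y ^ 2 + ∑ l, T (e l) ^ 2 := by
  have h := he.norm_sq hy ((InnerProductSpace.toDual ℝ (Euc n)).symm T)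
  have h2 : ∀ v, ⟪v, (InnerProductSpace.toDual ℝ (Euc n)).symm T⟫ = T v := fun v => by
    rw [real_inner_comm, InnerProductSpace.toDual_symm_apply]
  simpa only [h2, LinearIsometryEquiv.norm_map] using h

theorem OrthoFrame.norm_eq_one (he : OrthoFrame y e) (l : Fin n) : ‖e l‖ = 1 := by
  have := he.2 l l
  rw [if_pos rfl, real_inner_self_eq_norm_sq] at this
  nlinarith [norm_nonneg (e l)]

end Frames

section Hessian

variable {n : ℕ} {g : Euc n → ℝ} {x v w : Euc n}

theorem ne_zero_of_norm_eq_one (hx : ‖x‖ = 1) : x ≠ 0 := by rintro rfl; simp at hx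

theorem mem_uSphere : x ∈ uSphere n ↔ ‖x‖ = 1 := by simp [uSphere]

theorem tanProj_of_orthogonal (h : ⟪x, v⟫ = 0) : tanProj x v = v := by simp [tanProj, h]

theorem hessS_eq_d2 (hg : C2Off g) (hh : Homog0 g) (hx : ‖x‖ = 1) (hv : ⟪x, v⟫ = 0)
    (w : Euc n) : hessS g x v w = d2 g x v w := by
  have hx0 := ne_zero_of_norm_eq_one hx
  have h1 : (fun y => covD g y w) =ᶠ[nhds x] fun y => fderiv ℝ g y w := by
    filter_upwards [isOpen_ne_zero_euc.mem_nhds hx0] with y hy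
    simp [covD, tanProj, hh.fderiv_self hg hy]
  have h2 : HasFDerivAt (fun y => fderiv ℝ g y w) ((d2 g x).flip w) x := by
    have := (hg.hasFDerivAt_fderiv hx0).clm_apply (hasFDerivAt_const w x)
    refine this.congr_fderiv ?_
    ext u; simp
  rw [hessS, tanProj_of_orthogonal hv, (h2.congr_of_eventuallyEq h1).fderiv]
  rfl

/-- The two-jet of a function on the sphere along a great circle. -/
theorem hasJet_geo_hessS (hg : C2Off g) (hh : Homog0 g) (hx : ‖x‖ = 1) (hv : ‖v‖ = 1)
    (hxv : ⟪x, v⟫ = 0) :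
    HasJet (fun t => g (geo x v t)) (g x) (fderiv ℝ g x v) (hessS g x v v) := by
  refine (hg.hasJet_geo hx hv hxv).of_eq rfl rfl ?_
  rw [hh.fderiv_self hg (ne_zero_of_norm_eq_one hx), hessS_eq_d2 hg hh hx hxv, sub_zero]

theorem norm_gradS (hg : C2Off g) (hh : Homog0 g) (hx : ‖x‖ = 1) :
    ‖gradS g x‖ = ‖fderiv ℝ g x‖ := by
  have h : ⟪x, gradient g x⟫ = 0 := by
    rw [gradient, real_inner_comm, InnerProductSpace.toDual_symm_apply,
      hh.fderiv_self hg (ne_zero_of_norm_eq_one hx)]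
  rw [gradS, tanProj_of_orthogonal h, gradient, LinearIsometryEquiv.norm_map]

theorem norm_gradS_sq (hg : C2Off g) (hh : Homog0 g) (hx : ‖x‖ = 1) {e : Fin n → Euc n}
    (he : OrthoFrame x e) : ‖gradS g x‖ ^ 2 = ∑ l, fderiv ℝ g x (e l) ^ 2 := by
  rw [norm_gradS hg hh hx, he.clm_norm_sq hx, hh.fderiv_self hg (ne_zero_of_norm_eq_one hx)]
  ring

/-- The 1-homogeneous extension of a function on the sphere. -/
def radial (g : Euc n → ℝ) (x : Euc n) : ℝ := ‖x‖ * g x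

theorem radial_of_norm_eq_one (hx : ‖x‖ = 1) : radial g x = g x := by simp [radial, hx]

theorem Homog0.radial (hh : Homog0 g) : Homog1 (radial g) := fun c hc y _ => by
  rw [_root_.radial, _root_.radial, hh c y hc, norm_smul, Real.norm_of_nonneg hc.le, mul_assoc]

theorem C4Off.radial (hg : C4Off g) : C4Off (radial g) :=
  ContDiffOn.mul (fun _ hy => (contDiffAt_norm ℝ hy).contDiffWithinAt) hg

theorem fderiv_radial (hg : C4Off g) (hx : ‖x‖ = 1) (hv : ⟪x, v⟫ = 0) :
    fderiv ℝ (radial g) x v = fderiv ℝ g x v := by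
  have hx0 := ne_zero_of_norm_eq_one hx
  have h1 : HasFDerivAt (fun y : Euc n => ‖y‖) (innerSL ℝ x) x := by
    have h := (contDiffAt_norm ℝ hx0 (n := 1)).differentiableAt (by norm_num)
    have h2 := h.hasFDerivAt.norm_sq
    have := (hasStrictFDerivAt_norm_sq x).hasFDerivAt
    have h3 := this.sqrt (by rw [hx]; norm_num)
    have h4 : (fun y : Euc n => √(‖y‖ ^ 2)) = fun y => ‖y‖ := by
      ext y; exact Real.sqrt_sq (norm_nonneg y)
    rw [h4] at h3
    refine h3.congr_fderiv ?_
    ext u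
    simp [hx]
  have h2 := h1.mul (hg.c2.hasFDerivAt hx0)
  have h3 : HasFDerivAt (radial g) _ x := h2
  rw [h3.fderiv]
  simp [hx, hv]

theorem d2_radial_self (hg : C4Off g) (hh : Homog0 g) (hx : ‖x‖ = 1) (hv : ⟪x, v⟫ = 0) :
    d2 (radial g) x v v = d2 g x v v + g x * ⟪v, v⟫ := by
  have hx0 := ne_zero_of_norm_eq_one hx
  have unit : ∀ u : Euc n, ‖u‖ = 1 → ⟪x, u⟫ = 0 → d2 (radial g) x u u = d2 g x u u + g x := by
    intro u hu hxu
    have h1 := hg.radial.c2.hasJet_geo hx hu hxu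
    have h2 := (hg.c2.hasJet_geo hx hu hxu).congr fun t =>
      radial_of_norm_eq_one (g := g) (norm_geo hx hu hxu t)
    have h3 := (h1.eq h2).2.2
    rw [hh.radial.fderiv_self hg.radial.c2 hx0, hh.fderiv_self hg.c2 hx0,
      radial_of_norm_eq_one hx] at h3
    linarith
  rcases eq_or_ne v 0 with rfl | hv0
  · simp
  · have hn : ‖v‖ ≠ 0 := norm_ne_zero_iff.mpr hv0
    have h := unit (‖v‖⁻¹ • v) (by rw [norm_smul, norm_inv, norm_norm, inv_mul_cancel₀ hn])
      (by rw [inner_smul_right, hv, mul_zero])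
    simp only [map_smul, smul_apply, smul_eq_mul] at h
    rw [real_inner_self_eq_norm_sq]
    field_simp at h
    linarith

theorem d2_radial (hg : C4Off g) (hh : Homog0 g) (hx : ‖x‖ = 1) (hv : ⟪x, v⟫ = 0)
    (hw : ⟪x, w⟫ = 0) : d2 (radial g) x v w = d2 g x v w + g x * ⟪v, w⟫ := by
  have hx0 := ne_zero_of_norm_eq_one hx
  have h1 := d2_radial_self hg hh hx (v := v + w) (by rw [inner_add_right, hv, hw, add_zero])
  have h2 := d2_radial_self hg hh hx hv
  have h3 := d2_radial_self hg hh hx hw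
  simp only [map_add, add_apply, inner_add_left, inner_add_right] at h1
  rw [hg.c2.d2_symm hx0 w v, hg.radial.c2.d2_symm hx0 w v, real_inner_comm v w] at h1
  linarith

/-- The scalar part of `A[φ]` in terms of the homogeneous extension. -/
def kap (Φ : Euc n → ℝ) (x : Euc n) : ℝ := (‖fderiv ℝ Φ x‖ ^ 2 + 1) / (2 * Φ x)

theorem exists_orthoFrame_of_isSymmetric (hx : ‖x‖ = 1) (B : Euc n →L[ℝ] Euc n →L[ℝ] ℝ)
    (hB : ∀ u v, B u v = B v u) (hBx : ∀ v, B x v = 0) :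
    ∃ (e : Fin n → Euc n) (W : Fin n → ℝ), OrthoFrame x e ∧ ∀ l z, B (e l) z = W l * ⟪e l, z⟫ := by
  have hx0 := ne_zero_of_norm_eq_one hx
  let K : Submodule ℝ (Euc n) := (Submodule.span ℝ {x})ᗮ
  let J := InnerProductSpace.toDual ℝ (Euc n)
  have hJ : ∀ u v, ⟪J.symm (B u), v⟫ = B u v := fun u v => InnerProductSpace.toDual_symm_apply
  have hmem : ∀ v, v ∈ K ↔ ⟪x, v⟫ = 0 := fun v => Submodule.mem_orthogonal_singleton_iff_inner_right
  have hmaps : ∀ v, J.symm (B v) ∈ K := fun v => by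
    rw [hmem, real_inner_comm, hJ, hB, hBx]
  let T : K →ₗ[ℝ] K :=
    { toFun := fun v => ⟨J.symm (B v), hmaps v⟩
      map_add' := fun u v => by ext1; simp
      map_smul' := fun c v => by ext1; simp }
  have hT : T.IsSymmetric := fun u v => by
    change ⟪J.symm (B u), (v : Euc n)⟫ = ⟪(u : Euc n), J.symm (B v)⟫
    rw [hJ, real_inner_comm, hJ, hB]
  have hdim : Module.finrank ℝ K = n := by
    have : Fact (Module.finrank ℝ (Euc n) = n + 1) := ⟨by simp⟩
    exact Submodule.finrank_orthogonal_span_singleton hx0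
  let b := hT.eigenvectorBasis hdim
  refine ⟨fun l => b l, hT.eigenvalues hdim, ⟨fun i => (hmem _).mp (b i).2, fun i j => ?_⟩,
    fun l z => ?_⟩
  · exact orthonormal_iff_ite.mp b.orthonormal i j
  · have h1 := hT.apply_eigenvectorBasis hdim l
    have h2 : J.symm (B (b l : Euc n)) = hT.eigenvalues hdim l • (b l : Euc n) :=
      congrArg Subtype.val h1
    rw [← hJ, h2, inner_smul_left]; rfl

theorem Aform_eq (hg : C4Off g) (hh : Homog0 g) (hx : ‖x‖ = 1) (hgx : 0 < g x) (hv : ⟪x, v⟫ = 0)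
    (hw : ⟪x, w⟫ = 0) :
    Aform g x v w = d2 (radial g) x v w - kap (radial g) x * ⟪v, w⟫ := by
  have hx0 := ne_zero_of_norm_eq_one hx
  obtain ⟨e, -, he, -⟩ := exists_orthoFrame_of_isSymmetric hx 0 (by simp) (by simp)
  rw [Aform, hessS_eq_d2 hg.c2 hh hx hv, tanProj_of_orthogonal hv, tanProj_of_orthogonal hw,
    d2_radial hg hh hx hv hw, norm_gradS_sq hg.c2 hh hx he, kap, he.clm_norm_sq hx,
    hh.radial.fderiv_self hg.radial.c2 hx0, radial_of_norm_eq_one hx]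
  simp only [fderiv_radial hg hx (he.1 _)]
  field_simp
  ring

end Hessian

section JetsOnSphere

set_option maxSynthPendingDepth 3

variable {n : ℕ} {Φ : Euc n → ℝ} {y : Euc n} {e : Fin n → Euc n} {W : Fin n → ℝ}

theorem HasJet.inv {f : ℝ → ℝ} {a b c : ℝ} (h : HasJet f a b c) (hf : ∀ t, f t ≠ 0) :
    HasJet (fun t => (f t)⁻¹) a⁻¹ (-b / a ^ 2) (2 * b ^ 2 / a ^ 3 - c / a ^ 2) := by
  have ha : a ≠ 0 := by obtain ⟨_, _, _, h0, _⟩ := h; rw [← h0]; exact hf 0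
  have h2 : HasDerivAt (fun x : ℝ => -(x ^ 2)⁻¹) (2 / a ^ 3) a := by
    have := ((hasDerivAt_pow 2 a).inv (pow_ne_zero 2 ha)).neg
    refine this.congr_deriv ?_
    field_simp
    norm_num
    ring
  refine (h.scomp (g := fun x => x⁻¹) (fun t => hasDerivAt_inv (hf t)) h2).of_eq rfl ?_ ?_
  · field_simp
  · field_simp
    ring

theorem HasJet.sub {F : Type*} [NormedAddCommGroup F] [NormedSpace ℝ F] {f g : ℝ → F}
    {a b c a' b' c' : F} (h : HasJet f a b c)
    (h' : HasJet g a' b' c') : HasJet (fun t => f t - g t) (a - a') (b - b') (c - c') :=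
  ((h.add (h'.clm (-ContinuousLinearMap.id ℝ F))).of_eq (by simp [sub_eq_add_neg])
    (by simp [sub_eq_add_neg]) (by simp [sub_eq_add_neg])).congr
    (by intro t; simp [sub_eq_add_neg])

theorem hasJet_kap (h : C4Off Φ) (hh : Homog1 Φ) (hpos : ∀ x, ‖x‖ = 1 → 0 < Φ x) (hy : ‖y‖ = 1)
    (he : OrthoFrame y e) (hW : ∀ l z, d2 Φ y (e l) z = W l * ⟪e l, z⟫) (m : Fin n) :
    HasJet (fun t => kap Φ (geo y (e m) t)) (kap Φ y)
      ((W m - kap Φ y) * (fderiv ℝ Φ y (e m) / Φ y))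
      (∑ l, fderiv ℝ Φ y (e l) / Φ y * d3 Φ y (e m) (e m) (e l) -
        2 * (W m - kap Φ y) * (fderiv ℝ Φ y (e m) / Φ y) ^ 2 - (W m - kap Φ y) +
        (W m - kap Φ y) * W m / Φ y) := by
  have hy0 := ne_zero_of_norm_eq_one hy
  have hu := he.norm_eq_one m
  have hyu := he.1 m
  have hφ := hpos y hy
  have J1 := h.hasJet_fderiv_geo hh hy hu hyu
  have J0 := h.c2.hasJet_geo hy hu hyu
  have Jy := J1.clm_apply (HasJet.const y)
  have Jsq := (Jy.mul Jy).add (HasJet.sum univ fun l _ =>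
    (J1.clm_apply (HasJet.const (e l))).mul (J1.clm_apply (HasJet.const (e l))))
  have Jinv := (((HasJet.const (2 : ℝ)).mul J0).inv fun t =>
    mul_ne_zero two_ne_zero (hpos _ (norm_geo hy hu hyu t)).ne')
  have Jk := (Jsq.add (HasJet.const 1)).mul Jinv
  have e1 : ∀ l, d2 Φ y (e m) (e l) = if m = l then W m else 0 := fun l => by
    rw [hW, he.2]; simp
  have hd2y : d2 Φ y (e m) y = 0 := hh.d2_self_right h.c2 hy0 _
  have hd3y : d3 Φ y (e m) (e m) y = -W m := by
    rw [hh.d3_self₃ h hy0, e1, if_pos rfl]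
  have hTy := hh.fderiv_self h.c2 hy0
  have hκ : kap Φ y = (Φ y * Φ y + ∑ l, fderiv ℝ Φ y (e l) * fderiv ℝ Φ y (e l) + 1) /
      (2 * Φ y) := by
    rw [kap, he.clm_norm_sq hy, hTy]; simp only [sq]
  refine (Jk.congr fun t => ?_).of_eq ?_ ?_ ?_
  · rw [kap, he.clm_norm_sq hy]; simp only [sq]; rw [div_eq_mul_inv]
  · rw [hκ, hTy, div_eq_mul_inv]
  · simp only [hTy, hd2y, e1, map_zero, add_zero, mul_zero, zero_mul, zero_add, ite_mul, mul_ite,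
      Finset.sum_add_distrib, Finset.sum_ite_eq, mem_univ, if_true]
    rw [hκ]
    field_simp
    ring
  · have hs : ∑ l, fderiv ℝ Φ y (e l) / Φ y * d3 Φ y (e m) (e m) (e l) =
        (∑ l, fderiv ℝ Φ y (e l) * d3 Φ y (e m) (e m) (e l)) / Φ y := by
      rw [Finset.sum_div]; exact Finset.sum_congr rfl fun _ _ => by ring
    have hs2 : ∑ l, d3 Φ y (e m) (e m) (e l) * fderiv ℝ Φ y (e l) =
        ∑ l, fderiv ℝ Φ y (e l) * d3 Φ y (e m) (e m) (e l) :=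
      Finset.sum_congr rfl fun _ _ => by ring
    rw [hs]
    simp only [hTy, hd2y, hd3y, e1, map_zero, add_zero, mul_zero, zero_mul, zero_add, ite_mul,
      mul_ite, smul_zero, Finset.sum_add_distrib, Finset.sum_ite_eq, mem_univ, if_true, hs2]
    rw [hκ]
    field_simp
    ring

theorem min_condition (h : C4Off Φ) (hh : Homog1 Φ) (hy : ‖y‖ = 1)
    (he : OrthoFrame y e) (hW : ∀ l z, d2 Φ y (e l) z = W l * ⟪e l, z⟫) {η : Euc n → ℝ}
    (hmin : ∀ x, ‖x‖ = 1 → ∀ v, ⟪x, v⟫ = 0 → 0 ≤ d2 Φ x v v - (kap Φ x + η x) * ⟪v, v⟫)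
    {i₀ l : Fin n} (hi₀ : W i₀ = kap Φ y + η y) {κ₁ κ₂ η₁ η₂ : ℝ}
    (hκ : HasJet (fun t => kap Φ (geo y (e l) t)) (kap Φ y) κ₁ κ₂)
    (hη : HasJet (fun t => η (geo y (e l) t)) (η y) η₁ η₂) {w : Euc n} (hyw : ⟪y, w⟫ = 0)
    (hiw : ⟪e i₀, w⟫ = 0) :
    d3 Φ y (e l) (e i₀) (e i₀) = κ₁ + η₁ ∧
      0 ≤ d4 Φ y (e l) (e l) (e i₀) (e i₀) + W i₀ + 2 * W i₀ * (if i₀ = l then 1 else 0) +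
        4 * d3 Φ y (e l) (e i₀) w + 2 * (d2 Φ y w w - W i₀ * ⟪w, w⟫) - κ₂ - η₂ := by
  have hy0 := ne_zero_of_norm_eq_one hy
  have hu := he.norm_eq_one l
  have hyu := he.1 l
  have Jx := hasJet_geo y (e l)
  have J2 := h.hasJet_d2_geo hh hy hu hyu
  have Jv : HasJet (fun t : ℝ => e i₀ + t • w) (e i₀) w 0 :=
    ⟨fun _ => w, fun t => by simpa using ((hasDerivAt_id t).smul_const w).const_add (e i₀),
      hasDerivAt_const _ _, by simp, rfl⟩
  have Jxv := Jx.inner Jv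
  have Jq := (Jv.inner Jv).sub (Jxv.mul Jxv)
  have J := ((J2.clm_apply Jv).clm_apply Jv).sub ((hκ.add hη).mul Jq)
  have e1 : d2 Φ y (e i₀) (e i₀) = W i₀ := by rw [hW, he.2]; simp
  have e2 : d2 Φ y (e i₀) w = 0 := by rw [hW, hiw, mul_zero]
  have e3 : d2 Φ y w (e i₀) = 0 := by rw [h.c2.d2_symm hy0, e2]
  have e4 : ⟪w, e i₀⟫ = 0 := by rw [real_inner_comm, hiw]
  have e5 : ⟪e i₀, e i₀⟫ = 1 := by rw [he.2]; simp
  have e6 : ⟪e l, e i₀⟫ = if i₀ = l then 1 else 0 := by rw [he.2]; simp only [eq_comm]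
  have e7 : d3 Φ y (e l) w (e i₀) = d3 Φ y (e l) (e i₀) w := h.d3_symm₂ hy0 _ _ _
  simp only [map_zero, add_apply, smul_apply, e1, e2, e3, e4, e5, e6, e7, hiw, he.1 i₀, hyw,
    inner_zero_left, inner_zero_right, inner_neg_left, mul_zero, zero_mul, add_zero, zero_add,
    sub_zero, neg_zero, mul_one] at J
  rw [← hi₀, sub_self] at J
  obtain ⟨J1, J2⟩ := J.nonneg_min fun t => by
    set x := geo y (e l) t
    set v := e i₀ + t • w
    have hx : ‖x‖ = 1 := norm_geo hy hu hyu t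
    have hx0 := ne_zero_of_norm_eq_one hx
    have h1 := hmin x hx (v - ⟪x, v⟫ • x)
      (by rw [inner_sub_right, inner_smul_right, real_inner_self_eq_norm_sq, hx]; ring)
    simp only [map_sub, map_smul, hh.d2_self h.c2 hx0,
      hh.d2_self_right h.c2 hx0, inner_sub_left, inner_sub_right, inner_smul_left,
      inner_smul_right, real_inner_self_eq_norm_sq x, hx, smul_zero, sub_zero,
      real_inner_comm x v, conj_trivial] at h1
    simp only [one_pow, mul_one, sub_self] at h1 ⊢
    refine h1.trans (le_of_eq ?_)
    ring
  have hsplit : (if i₀ = l then (1 : ℝ) else 0) * (if i₀ = l then 1 else 0) =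
      if i₀ = l then 1 else 0 := by split_ifs <;> simp
  refine ⟨by linarith, J2.trans (le_of_eq ?_)⟩
  simp only [nsmul_eq_mul, Nat.cast_ofNat]
  split_ifs <;> ring

theorem hasJet_frame (y : Euc n) (e : Fin n → Euc n) (m i : Fin n) :
    HasJet (fun t => if i = m then geo (e m) (-y) t else e i) (e i)
      (if i = m then -y else 0) (if i = m then -e m else 0) := by
  by_cases him : i = m
  · subst him
    simpa using hasJet_geo (e i) (-y)
  · simpa [him] using HasJet.const (e i)

theorem orthoFrame_geo (hy : ‖y‖ = 1) (he : OrthoFrame y e) (m : Fin n) (t : ℝ) :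
    OrthoFrame (geo y (e m) t) fun i => if i = m then geo (e m) (-y) t else e i := by
  have hyy : ⟪y, y⟫ = 1 := by rw [real_inner_self_eq_norm_sq, hy]; norm_num
  have hey : ∀ i, ⟪e i, y⟫ = 0 := fun i => by rw [real_inner_comm, he.1]
  have hcs := Real.cos_sq_add_sin_sq t
  constructor
  · intro i
    by_cases him : i = m
    · subst him
      simp only [if_true, geo, inner_add_left, inner_add_right, inner_smul_left, inner_smul_right,
        inner_neg_right, he.1, hey, he.2, hyy, conj_trivial]
      ring
    · simp [him, geo, inner_add_left, inner_smul_left, he.1, he.2, Ne.symm him]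
  · intro i j
    by_cases him : i = m
    · subst him
      by_cases hjm : j = i
      · subst hjm
        simp only [if_true, geo, inner_add_left, inner_add_right, inner_smul_left,
          inner_smul_right, inner_neg_right, inner_neg_left, hey, he.1, he.2, hyy, conj_trivial]
        linarith
      · simp [hjm, geo, inner_add_left, inner_smul_left, he.1, he.2, Ne.symm hjm]
    · by_cases hjm : j = m
      · subst hjm
        simp [him, geo, inner_add_right, inner_smul_right, hey, he.2]
      · simp [him, hjm, he.2]

theorem hasJet_Amat (h : C4Off Φ) (hh : Homog1 Φ) (hy : ‖y‖ = 1)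
    (he : OrthoFrame y e) (hW : ∀ l z, d2 Φ y (e l) z = W l * ⟪e l, z⟫)
    {m : Fin n} {κ₁ κ₂ : ℝ}
    (hκ : HasJet (fun t => kap Φ (geo y (e m) t)) (kap Φ y) κ₁ κ₂) (i j : Fin n) :
    HasJet (fun t => d2 Φ (geo y (e m) t) (if i = m then geo (e m) (-y) t else e i)
        (if j = m then geo (e m) (-y) t else e j) -
        kap Φ (geo y (e m) t) * if i = j then 1 else 0)
      (Matrix.diagonal (fun l => W l - kap Φ y) i j)
      (d3 Φ y (e m) (e i) (e j) - κ₁ * if i = j then 1 else 0)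
      (d4 Φ y (e m) (e m) (e i) (e j) + d2 Φ y (e i) (e j) * (1 + (if i = m then 1 else 0) +
        (if j = m then 1 else 0)) - κ₂ * if i = j then 1 else 0) := by
  have hy0 := ne_zero_of_norm_eq_one hy
  have hu := he.norm_eq_one m
  have hyu := he.1 m
  have J2 := h.hasJet_d2_geo hh hy hu hyu
  have J := ((J2.clm_apply (hasJet_frame y e m i)).clm_apply (hasJet_frame y e m j)).sub
    (hκ.mul (HasJet.const (if i = j then (1 : ℝ) else 0)))
  have ey : ∀ v, d2 Φ y v y = 0 := hh.d2_self_right h.c2 hy0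
  have ey' : d2 Φ y y = 0 := hh.d2_self h.c2 hy0
  have e3 : ∀ v, d3 Φ y (e m) v y = -d2 Φ y (e m) v := hh.d3_self₃ h hy0 _
  have e3' : d3 Φ y (e m) y = -d2 Φ y (e m) := hh.d3_self₂ h hy0 _
  refine J.of_eq ?_ ?_ ?_
  · rw [hW, he.2, Matrix.diagonal_apply]
    split_ifs <;> ring
  · by_cases him : i = m <;> by_cases hjm : j = m <;>
      simp [him, hjm, ey, ey']
  · by_cases him : i = m
    · subst him
      by_cases hjm : j = i
      · subst hjm
        simp [ey', e3, e3']
        ring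
      · simp [hjm, Ne.symm hjm, ey', e3']
        ring
    · by_cases hjm : j = m
      · subst hjm
        simp [him, e3, h.c2.d2_symm hy0 (e j) (e i)]
        ring
      · simp [him, hjm]

end JetsOnSphere

section CoreInequality

variable {n : ℕ}

theorem core_algebra {F d a η η₂ κ₂ T₄ R h₁ : Fin n → ℝ} {G : Fin n → Fin n → ℝ} {i₀ : Fin n}
    {κ φ Q h₂ N : ℝ} (hF : ∀ l, 0 ≤ F l) (hφ : 0 < φ)
    (hB : ∀ l, R l ≤ T₄ l + (d i₀ + κ) + 2 * (d i₀ + κ) * (if i₀ = l then 1 else 0) -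
      κ₂ l - η₂ l)
    (hκ₂ : ∀ l, κ₂ l = ∑ j, a j * G l j - 2 * d l * a l ^ 2 - d l + d l * (d l + κ) / φ)
    (hG₁ : ∀ j, ∑ l, F l * (G l j - d j * a j) = h₁ j) (hG₀ : ∀ j, G i₀ j = d j * a j + η j)
    (hN : ∑ l, F l * d l = N)
    (hQ : ∑ l, F l * (T₄ l + (d l + κ) * (1 + (if l = i₀ then 1 else 0) +
      (if l = i₀ then 1 else 0)) - κ₂ i₀) + Q = h₂) :
    ∑ l, F l * η₂ l ≤ h₂ - (Q + ∑ l, F l * R l - 2 * ∑ l, F l * (d l * a l ^ 2)) -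
      ∑ j, a j * h₁ j - κ * N / φ +
      (∑ l, F l) * (∑ j, a j * η j - 2 * d i₀ * a i₀ ^ 2 + d i₀ * (d i₀ + κ) / φ) := by
  have h1 : ∑ l, F l * R l ≤ ∑ l, F l * (T₄ l + (d i₀ + κ) +
      2 * (d i₀ + κ) * (if i₀ = l then 1 else 0) - κ₂ l - η₂ l) :=
    Finset.sum_le_sum fun l _ => mul_le_mul_of_nonneg_left (hB l) (hF l)
  have h2 : ∑ l, F l * (T₄ l + (d i₀ + κ) +
      2 * (d i₀ + κ) * (if i₀ = l then 1 else 0) - κ₂ l - η₂ l) =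
      ∑ l, F l * T₄ l + (∑ l, F l) * (d i₀ + κ) + 2 * (d i₀ + κ) * F i₀ -
        ∑ l, F l * κ₂ l - ∑ l, F l * η₂ l := by
    have : F i₀ = ∑ l, F l * (if i₀ = l then 1 else 0) := by simp
    rw [this, Finset.sum_mul, Finset.mul_sum, ← Finset.sum_add_distrib, ← Finset.sum_add_distrib,
      ← Finset.sum_sub_distrib, ← Finset.sum_sub_distrib]
    exact Finset.sum_congr rfl fun l _ => by ring
  have h3 : ∑ l, F l * (T₄ l + (d l + κ) * (1 + (if l = i₀ then 1 else 0) +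
      (if l = i₀ then 1 else 0)) - κ₂ i₀) = ∑ l, F l * T₄ l + N + κ * ∑ l, F l +
        2 * (d i₀ + κ) * F i₀ - (∑ l, F l) * κ₂ i₀ := by
    have : 2 * (d i₀ + κ) * F i₀ = ∑ l, F l * (2 * (d l + κ) * (if l = i₀ then 1 else 0)) := by
      simp; ring
    rw [this, ← hN, Finset.sum_mul, Finset.mul_sum, ← Finset.sum_add_distrib,
      ← Finset.sum_add_distrib, ← Finset.sum_add_distrib, ← Finset.sum_sub_distrib]
    exact Finset.sum_congr rfl fun l _ => by ring
  have h4 : ∑ l, F l * κ₂ l = ∑ j, a j * h₁ j + (∑ l, F l) * ∑ j, d j * a j ^ 2 -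
      2 * ∑ l, F l * (d l * a l ^ 2) - N + (∑ l, F l * d l ^ 2 + κ * N) / φ := by
    have e1 : ∑ l, F l * ∑ j, a j * G l j =
        ∑ j, a j * h₁ j + (∑ l, F l) * ∑ j, d j * a j ^ 2 := by
      rw [Finset.mul_sum, ← Finset.sum_add_distrib]
      simp_rw [Finset.mul_sum]
      rw [Finset.sum_comm]
      refine Finset.sum_congr rfl fun j _ => ?_
      rw [← hG₁, Finset.mul_sum, Finset.sum_mul, ← Finset.sum_add_distrib]
      exact Finset.sum_congr rfl fun l _ => by ring
    rw [← e1, ← hN, Finset.mul_sum, Finset.mul_sum, ← Finset.sum_add_distrib, Finset.sum_div,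
      ← Finset.sum_sub_distrib, ← Finset.sum_sub_distrib, ← Finset.sum_add_distrib]
    refine Finset.sum_congr rfl fun l _ => ?_
    rw [hκ₂]
    field_simp
  have h5 : κ₂ i₀ = ∑ j, d j * a j ^ 2 + ∑ j, a j * η j - 2 * d i₀ * a i₀ ^ 2 - d i₀ +
      d i₀ * (d i₀ + κ) / φ := by
    rw [hκ₂, ← Finset.sum_add_distrib]
    congr 3
    exact Finset.sum_congr rfl fun j _ => by rw [hG₀]; ring
  have h6 : 0 ≤ (∑ l, F l * d l ^ 2) / φ :=
    div_nonneg (Finset.sum_nonneg fun l _ => mul_nonneg (hF l) (sq_nonneg _)) hφ.le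
  have h7 : (∑ l, F l * d l ^ 2 + κ * N) / φ = (∑ l, F l * d l ^ 2) / φ + κ * N / φ := add_div _ _ _
  have h8 : (∑ l, F l) * κ₂ i₀ = (∑ l, F l) * (∑ j, d j * a j ^ 2) - (∑ l, F l) * d i₀ +
      (∑ l, F l) * (∑ j, a j * η j - 2 * d i₀ * a i₀ ^ 2 + d i₀ * (d i₀ + κ) / φ) := by
    rw [h5]; ring
  rw [h3] at hQ
  rw [h2, h4, h7] at h1
  linarith

theorem core_error_bound {a η : Fin n → ℝ} {T δ α κ φ C : ℝ} (hC : 1 ≤ C) (hT0 : 0 ≤ T)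
    (hT : T ≤ n * C) (ha : ∀ j, |a j| ≤ C) (hδ0 : 0 ≤ δ) (hδ : δ ≤ C)
    (hκ0 : 0 ≤ κ) (hκ : κ ≤ C) (hφ : 1 ≤ φ) :
    T * (∑ j, a j * η j - 2 * δ * α ^ 2 + δ * (δ + κ) / φ) ≤
      2 * n ^ 2 * C ^ 6 * (δ + ∑ j, |η j|) := by
  have h1 : ∑ j, a j * η j ≤ C * ∑ j, |η j| := by
    rw [Finset.mul_sum]
    refine Finset.sum_le_sum fun j _ => (le_abs_self _).trans ?_
    rw [abs_mul]
    exact mul_le_mul_of_nonneg_right (ha j) (abs_nonneg _)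
  have h2 : δ * (δ + κ) / φ ≤ δ * (2 * C) :=
    (div_le_self (by positivity) hφ).trans (by nlinarith)
  have h0 : 0 ≤ ∑ j, |η j| := Finset.sum_nonneg fun l _ => abs_nonneg _
  have h3 : ∑ j, a j * η j - 2 * δ * α ^ 2 + δ * (δ + κ) / φ ≤ 2 * C * (δ + ∑ j, |η j|) := by
    nlinarith [mul_nonneg hδ0 (sq_nonneg α)]
  calc _ ≤ T * (2 * C * (δ + ∑ j, |η j|)) := mul_le_mul_of_nonneg_left h3 hT0
    _ ≤ n * C * (2 * C * (δ + ∑ j, |η j|)) := mul_le_mul_of_nonneg_right hT (by positivity)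
    _ = 2 * n * C ^ 2 * (δ + ∑ j, |η j|) := by ring
    _ ≤ _ := by
      have : (n : ℝ) ≤ n ^ 2 := by exact_mod_cast Nat.le_self_pow two_ne_zero n
      have h4 : C ^ 2 ≤ C ^ 6 := pow_le_pow_right₀ hC (by norm_num)
      gcongr

variable {Φ η : Euc n → ℝ} {y : Euc n} {e : Fin n → Euc n} {W : Fin n → ℝ}

theorem third_deriv_bounds (h : C4Off Φ) (hh : Homog1 Φ) (hy : ‖y‖ = 1)
    (he : OrthoFrame y e) (hW : ∀ l z, d2 Φ y (e l) z = W l * ⟪e l, z⟫)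
    (hmin : ∀ x, ‖x‖ = 1 → ∀ v, ⟪x, v⟫ = 0 → 0 ≤ d2 Φ x v v - (kap Φ x + η x) * ⟪v, v⟫)
    {i₀ l : Fin n} (hi₀ : W i₀ = kap Φ y + η y) (hη0 : 0 ≤ η y) {κ₁ κ₂ η₁ η₂ : ℝ}
    (hκ : HasJet (fun t => kap Φ (geo y (e l) t)) (kap Φ y) κ₁ κ₂)
    (hη : HasJet (fun t => η (geo y (e l) t)) (η y) η₁ η₂) :
    d3 Φ y (e l) (e i₀) (e i₀) = κ₁ + η₁ ∧
      (∀ j, j ≠ i₀ → W j - kap Φ y = 0 → d3 Φ y (e l) (e i₀) (e j) = 0) ∧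
      ∑ j ∈ univ.erase i₀, 2 * (d3 Φ y (e l) (e i₀) (e j) ^ 2 / (W j - kap Φ y)) ≤
        d4 Φ y (e l) (e l) (e i₀) (e i₀) + W i₀ + 2 * W i₀ * (if i₀ = l then 1 else 0) -
          κ₂ - η₂ := by
  have key := fun w hyw hiw => min_condition h hh hy he hW hmin hi₀ hκ hη (w := w) hyw hiw
  have hWle : ∀ j, W i₀ ≤ W j := fun j => by
    have := hmin y hy (e j) (he.1 j)
    rw [hW, he.2, if_pos rfl, ← hi₀] at this
    linarith
  have hdeg : ∀ j, j ≠ i₀ → W j - kap Φ y = 0 → d3 Φ y (e l) (e i₀) (e j) = 0 := by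
    intro j hj hj0
    have hWj : W j = W i₀ := le_antisymm (by linarith) (hWle j)
    set B := d4 Φ y (e l) (e l) (e i₀) (e i₀) + W i₀ + 2 * W i₀ * (if i₀ = l then 1 else 0) -
      κ₂ - η₂ with hB
    have hs : ∀ s : ℝ, 0 ≤ B + 4 * s * d3 Φ y (e l) (e i₀) (e j) := fun s => by
      have := (key (s • e j) (by rw [inner_smul_right, he.1, mul_zero])
        (by rw [inner_smul_right, he.2, if_neg hj.symm, mul_zero])).2
      simp only [map_smul, smul_apply, hW, he.2, inner_smul_left, inner_smul_right, if_true,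
        hWj, smul_eq_mul, conj_trivial] at this
      linarith
    by_contra hne
    set S := d3 Φ y (e l) (e i₀) (e j)
    have := hs (-(B + 1) / (4 * S))
    have e1 : 4 * (-(B + 1) / (4 * S)) * S = -(B + 1) := by field_simp
    linarith
  refine ⟨(key 0 (inner_zero_right _) (inner_zero_right _)).1, hdeg, ?_⟩
  set S : Fin n → ℝ := fun j => d3 Φ y (e l) (e i₀) (e j)
  set c : Fin n → ℝ := fun j => if j = i₀ then 0 else -S j / (W j - kap Φ y) with hc
  have h1 : ∀ j, ⟪e j, ∑ i, c i • e i⟫ = c j := fun j => by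
    simp [inner_sum, inner_smul_right, he.2]
  have h2 := (key (∑ j, c j • e j)
    (by simp [inner_sum, inner_smul_right, he.1]) (by rw [h1]; simp [hc])).2
  have h3 : d2 Φ y (∑ j, c j • e j) (∑ j, c j • e j) -
      W i₀ * ⟪∑ j, c j • e j, ∑ j, c j • e j⟫ = ∑ j, (W j - W i₀) * c j ^ 2 := by
    have e1 : ∀ z, d2 Φ y (∑ j, c j • e j) z = ∑ j, c j * (W j * ⟪e j, z⟫) := fun z => by
      rw [map_sum, _root_.sum_apply]
      simp only [map_smul, smul_apply, hW, smul_eq_mul]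
    rw [e1, sum_inner, Finset.mul_sum, ← Finset.sum_sub_distrib]
    simp only [inner_smul_left, conj_trivial, h1]
    exact Finset.sum_congr rfl fun j _ => by ring
  have h4 : d3 Φ y (e l) (e i₀) (∑ j, c j • e j) = ∑ j, c j * S j := by
    simp only [map_sum, map_smul, smul_eq_mul, S]
  rw [h3, h4] at h2
  have h5 : ∑ j ∈ univ.erase i₀, 2 * (S j ^ 2 / (W j - kap Φ y)) ≤
      -(4 * ∑ j, c j * S j + 2 * ∑ j, (W j - W i₀) * c j ^ 2) := by
    rw [← Finset.sum_erase_add univ (fun j => c j * S j) (mem_univ i₀),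
      ← Finset.sum_erase_add univ (fun j => (W j - W i₀) * c j ^ 2) (mem_univ i₀)]
    simp only [hc, if_true, zero_mul, add_zero, sub_self]
    rw [Finset.mul_sum, Finset.mul_sum, ← Finset.sum_add_distrib, ← Finset.sum_neg_distrib]
    refine Finset.sum_le_sum fun j hj => ?_
    have hj := (Finset.mem_erase.1 hj).1
    simp only [if_neg hj]
    by_cases hd : W j - kap Φ y = 0
    · simp [hd]
    · have hdp : 0 < W j - kap Φ y :=
        lt_of_le_of_ne (by have := hWle j; linarith) (Ne.symm hd)
      have e1 : -(4 * (-S j / (W j - kap Φ y) * S j) +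
          2 * ((W j - W i₀) * (-S j / (W j - kap Φ y)) ^ 2)) =
          2 * (S j ^ 2 / (W j - kap Φ y)) +
            2 * (η y) * (-S j / (W j - kap Φ y)) ^ 2 := by
        rw [hi₀]
        field_simp
        ring
      rw [e1]
      have : 0 ≤ 2 * (η y) * (-S j / (W j - kap Φ y)) ^ 2 := by positivity
      linarith
  linarith

theorem core_inequality {k : ℕ} (hk : 1 ≤ k) (h : C4Off Φ) (hh : Homog1 Φ)
    (hΦ : ∀ x, ‖x‖ = 1 → 1 ≤ Φ x) (hy : ‖y‖ = 1)
    (he : OrthoFrame y e) (hW : ∀ l z, d2 Φ y (e l) z = W l * ⟪e l, z⟫)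
    (hmin : ∀ x, ‖x‖ = 1 → ∀ v, ⟪x, v⟫ = 0 → 0 ≤ d2 Φ x v v - (kap Φ x + η x) * ⟪v, v⟫)
    {i₀ : Fin n} (hi₀ : W i₀ = kap Φ y + η y) (hη0 : 0 ≤ η y) {η₁ η₂ h₁ h₂ : Fin n → ℝ}
    (hη : ∀ l, HasJet (fun t => η (geo y (e l) t)) (η y) (η₁ l) (η₂ l)) {H : Euc n → ℝ}
    (hH : ∀ l, HasJet (fun t => H (geo y (e l) t)) (H y) (h₁ l) (h₂ l))
    (hsol : ∀ x, ‖x‖ = 1 → ∀ e : Fin n → Euc n, OrthoFrame x e →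
      sigmaMat k (Matrix.of fun i j => d2 Φ x (e i) (e j) - kap Φ x * if i = j then 1 else 0) =
        H x)
    {C : ℝ} (hC : 1 ≤ C) (ha : ∀ j, |fderiv ℝ Φ y (e j) / Φ y| ≤ C)
    (hdC : ∀ j, W j - kap Φ y ≤ C) (hκC : kap Φ y ≤ C)
    (hSC : ∀ j l, |d3 Φ y (e i₀) (e j) (e l)| ≤ C)
    (hFC : ∀ i, esF k (fun l => W l - kap Φ y) i ≤ C)
    (hFFC : ∀ i j, esFF k (fun l => W l - kap Φ y) i j ≤ C) (hHC : 1 ≤ C * H y) :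
    ∑ l, esF k (fun l => W l - kap Φ y) l * η₂ l ≤
      h₂ i₀ - (1 + 1 / (k : ℝ)) * h₁ i₀ ^ 2 / H y -
        ∑ j, fderiv ℝ Φ y (e j) / Φ y * h₁ j - kap Φ y * (k * H y) / Φ y +
        32 * n ^ 2 * C ^ 6 * (η y + ∑ l, |η₁ l|) := by
  have hy0 := ne_zero_of_norm_eq_one hy
  have hΦy := hΦ y hy
  have hpos : ∀ x, ‖x‖ = 1 → 0 < Φ x := fun x hx => one_pos.trans_le (hΦ x hx)
  set d : Fin n → ℝ := fun l => W l - kap Φ y with hd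
  set a : Fin n → ℝ := fun l => fderiv ℝ Φ y (e l) / Φ y with ha'
  have hWd : ∀ l, W l = d l + kap Φ y := fun l => by simp [hd]
  have hdi₀ : d i₀ = η y := by simp [hd, hi₀]
  have hd0 : ∀ l, 0 ≤ d l := fun l => by
    have := hmin y hy (e l) (he.1 l)
    rw [hW, he.2, if_pos rfl] at this
    simp only [hd]
    linarith
  have hκ0 : 0 ≤ kap Φ y := div_nonneg (by positivity) (by linarith)
  have Jκ := fun m => hasJet_kap h hh hpos hy he hW m
  have hb := fun l => third_deriv_bounds h hh hy he hW hmin hi₀ hη0 (Jκ l) (hη l)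
  have Jσ := fun m => ((HasJet.sigmaMat k fun i j => hasJet_Amat h hh hy he hW (Jκ m) i j).congr
    fun t => ((hsol _ (norm_geo hy (he.norm_eq_one m) (he.1 m) t) _
      (orthoFrame_geo hy he m t)).symm)).eq (hH m)
  have hs1 : ∀ u v w, d3 Φ y u v w = d3 Φ y v u w := fun u v w => by rw [h.d3_symm₁ hy0]
  have hs2 : ∀ u v w, d3 Φ y u v w = d3 Φ y u w v := h.d3_symm₂ hy0
  have hσ : esS k d = H y := (Jσ i₀).1
  have hS0 : ∀ l, d3 Φ y (e i₀) (e i₀) (e l) = d l * a l + η₁ l := fun l => by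
    rw [hs2, hs1, (hb l).1]
  have hSs : ∀ j l, d3 Φ y (e i₀) (e j) (e l) = d3 Φ y (e l) (e i₀) (e j) := fun j l => by
    rw [hs2, hs1]
  have hG₁ : ∀ m, ∑ i, esF k d i * (d3 Φ y (e i) (e i) (e m) - d m * a m) = h₁ m := fun m => by
    rw [← (Jσ m).2.1]
    refine Finset.sum_congr rfl fun i _ => ?_
    rw [hs2 (e i) (e i), hs1 (e i) (e m), if_pos rfl, mul_one]
  have hX1 : ∑ i, esF k d i * (d3 Φ y (e i₀) (e i) (e i) - d i₀ * a i₀ * if i = i then 1 else 0) =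
      h₁ i₀ := (Jσ i₀).2.1
  have hF0 := esF_nonneg k hd0
  have hT0 : 0 ≤ ∑ l, esF k d l := Finset.sum_nonneg fun l _ => hF0 l
  have hT : ∑ l, esF k d l ≤ n * C := by
    simpa using Finset.sum_le_card_nsmul univ _ C fun l _ => hFC l
  have key := algebraic_inequality hk hC hd0 hS0 (fun j l => hs2 _ _ _)
    (fun j hj hj0 l => by rw [hSs]; exact (hb l).2.1 j hj hj0) ha hdC hSC hFC hFFC
    (by rw [hσ]; exact hHC) (X := fun i j => d3 Φ y (e i₀) (e i) (e j) -
      d i₀ * a i₀ * if i = j then 1 else 0) (fun _ _ => rfl)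
  rw [hX1, hσ] at key
  have hQ := (Jσ i₀).2.2
  have hcore := core_algebra (F := esF k d) (d := d) (a := a) (η := η₁) (η₂ := η₂)
    (κ₂ := fun m => ∑ l, a l * d3 Φ y (e m) (e m) (e l) - 2 * d m * a m ^ 2 - d m +
      d m * (d m + kap Φ y) / Φ y)
    (T₄ := fun l => d4 Φ y (e i₀) (e i₀) (e l) (e l))
    (R := fun l => ∑ j ∈ univ.erase i₀, 2 * (d3 Φ y (e i₀) (e j) (e l) ^ 2 / d j))
    (h₁ := h₁) (G := fun l j => d3 Φ y (e l) (e l) (e j)) (i₀ := i₀) (κ := kap Φ y) (φ := Φ y)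
    (h₂ := h₂ i₀) (N := k * H y) hF0 (hpos y hy)
    (fun l => by
      have := (hb l).2.2
      simp only [hSs]
      rw [h.d4_swap hy0 (e i₀) (e l), ← hWd i₀]
      refine this.trans (le_of_eq ?_)
      simp only [hd, ha', sub_add_cancel])
    (fun l => rfl) hG₁ hS0 (by rw [sum_esF_mul_self, hσ])
    (by
      rw [← hQ]
      congr 1
      refine Finset.sum_congr rfl fun i _ => ?_
      rw [hW, he.2, if_pos rfl, ← hWd i, ← hWd i₀]
      simp only [hd, ha']
      ring)
  have herr := core_error_bound (α := a i₀) (κ := kap Φ y) (φ := Φ y) (η := η₁) (δ := d i₀)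
    hC hT0 hT ha (hd0 i₀) (hdC i₀) hκ0 hκC hΦy
  simp only [hd, ha', show W i₀ - kap Φ y = η y from hdi₀] at key herr hcore ⊢
  linarith

end CoreInequality

section StructureCondition

theorem structure_inequality {k p a₁ b₁ α β s ℓ t D : ℝ} (hk : 0 < k) (hp : 0 ≤ p)
    (hα : 0 ≤ α) (hβ : 0 ≤ β) (ha₁ : a₁ ^ 2 ≤ α ^ 2) (hs : |s| ≤ α * β)
    (hr : 2 * a₁ * b₁ - s ≤ α * β) (hα1 : α ≤ 1) (ht0 : 0 ≤ t) (ht1 : t ≤ 1)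
    (h0 : p = 0 → 0 ≤ b₁ ^ 2 / k ^ 2 - ℓ / k - β / k + 1 / D ∧ 1 / D ≤ t)
    (h1 : 0 < p ∧ p ≤ k / 2 →
      0 ≤ b₁ ^ 2 / k ^ 2 - ℓ / k - (k + 2 * p) / k * (β / k) + p ^ 2 / k ^ 2)
    (h2 : k / 2 < p ∧ p < k → 0 ≤ b₁ ^ 2 / k ^ 2 - ℓ / k -
      (3 * k - 2 * p) ^ 2 / (p * (2 * p - k)) * (β ^ 2 / k ^ 2 / 2) + p / (2 * k))
    (h3 : k ≤ p ∧ p ≤ 2 * k → 0 ≤ b₁ ^ 2 / p ^ 2 - ℓ / p - β ^ 2 / p ^ 2 / 2 + 1 / 2)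
    (h4 : 2 * k < p → 0 ≤ b₁ ^ 2 / p ^ 2 - ℓ / p - β ^ 2 / p ^ 2 / 2 + k / p) :
    ℓ - 1 / k * ((p - k) * a₁ + b₁) ^ 2 - (p - k) * a₁ ^ 2 - p / 2 * α ^ 2 - p / 2 +
      (p - 2 * k) * t / 2 - s ≤ 0 := by
  have hs' := abs_le.1 hs
  have hαβ : α * β ≤ β := mul_le_of_le_one_left hβ hα1
  have hα2 : α ^ 2 ≤ 1 := by nlinarith
  have e1 : 1 / k * ((p - k) * a₁ + b₁) ^ 2 + (p - k) * a₁ ^ 2 =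
      (p * (p - k) * a₁ ^ 2 + 2 * (p - k) * (a₁ * b₁) + b₁ ^ 2) / k := by
    field_simp; ring
  rcases lt_or_ge p k with hpk | hpk
  · have e2 : (k - p) / k * (2 * a₁ * b₁ - s) + p / k * (-s) ≤ α * β := by
      have i1 : 0 ≤ (k - p) / k := div_nonneg (by linarith) hk.le
      have i2 : 0 ≤ p / k := div_nonneg hp hk.le
      have i3 : (k - p) / k + p / k = 1 := by field_simp; ring
      calc _ ≤ (k - p) / k * (α * β) + p / k * (α * β) :=
            add_le_add (mul_le_mul_of_nonneg_left hr i1)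
              (mul_le_mul_of_nonneg_left (by linarith) i2)
        _ = α * β := by rw [← add_mul, i3, one_mul]
    have e3 : ℓ - (p * (p - k) * a₁ ^ 2 + 2 * (p - k) * (a₁ * b₁) + b₁ ^ 2) / k - s =
        ℓ - b₁ ^ 2 / k + p * (k - p) / k * a₁ ^ 2 +
          ((k - p) / k * (2 * a₁ * b₁ - s) + p / k * (-s)) := by field_simp; ring
    have e4 : p * (k - p) / k * a₁ ^ 2 ≤ p * (k - p) / k * α ^ 2 :=
      mul_le_mul_of_nonneg_left ha₁ (div_nonneg (mul_nonneg hp (by linarith)) hk.le)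
    have e5 : (p - 2 * k) * t / 2 ≤ 0 := by nlinarith
    have e6 : p * (k - p) / k * α ^ 2 - p / 2 * α ^ 2 = p * (k - 2 * p) / (2 * k) * α ^ 2 := by
      field_simp; ring
    suffices ℓ - b₁ ^ 2 / k + α * β + p * (k - 2 * p) / (2 * k) * α ^ 2 - p / 2 +
        (p - 2 * k) * t / 2 ≤ 0 by linarith
    rcases hp.eq_or_lt with hp0 | hp0
    · obtain ⟨i1, i2⟩ := h0 hp0.symm
      have i3 := mul_nonneg hk.le i1
      have i4 : k * (b₁ ^ 2 / k ^ 2 - ℓ / k - β / k + 1 / D) =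
        b₁ ^ 2 / k - ℓ - β + k * (1 / D) := by field_simp
      rw [← hp0]
      have := mul_le_mul_of_nonneg_left i2 hk.le
      simp only [zero_mul, zero_div, sub_zero, zero_sub]
      linarith
    · rcases le_or_gt p (k / 2) with hpk2 | hpk2
      · have i3 := mul_nonneg hk.le (h1 ⟨hp0, hpk2⟩)
        have i4 : k * (b₁ ^ 2 / k ^ 2 - ℓ / k - (k + 2 * p) / k * (β / k) + p ^ 2 / k ^ 2) =
            b₁ ^ 2 / k - ℓ - β - 2 * p / k * β + p ^ 2 / k := by field_simp; ring
        have i5 : 0 ≤ 2 * p / k * β := by positivity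
        have i6 : p * (k - 2 * p) / (2 * k) * α ^ 2 ≤ p * (k - 2 * p) / (2 * k) :=
          mul_le_of_le_one_right (div_nonneg (mul_nonneg hp (by linarith)) (by linarith)) hα2
        have i7 : p * (k - 2 * p) / (2 * k) = p / 2 - p ^ 2 / k := by field_simp
        linarith
      · have i3 := mul_nonneg hk.le (h2 ⟨hpk2, hpk⟩)
        set P := p * (2 * p - k) with hP
        have hP0 : 0 < P := mul_pos hp0 (by linarith)
        have i4 : k * (b₁ ^ 2 / k ^ 2 - ℓ / k - (3 * k - 2 * p) ^ 2 / P * (β ^ 2 / k ^ 2 / 2) +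
            p / (2 * k)) = b₁ ^ 2 / k - ℓ - (3 * k - 2 * p) ^ 2 * β ^ 2 / (2 * P * k) + p / 2 := by
          field_simp
        have i5 : p * (k - 2 * p) / (2 * k) * α ^ 2 = -(P * α ^ 2 / (2 * k)) := by
          rw [hP]; field_simp; ring
        have i6 : α * β ≤ P * α ^ 2 / (2 * k) + (3 * k - 2 * p) ^ 2 * β ^ 2 / (2 * P * k) := by
          have j1 : P * α ^ 2 / (2 * k) + (3 * k - 2 * p) ^ 2 * β ^ 2 / (2 * P * k) -
              (3 * k - 2 * p) / k * (α * β) = (P * α - (3 * k - 2 * p) * β) ^ 2 / (2 * P * k) := by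
            field_simp; ring
          have j2 : 0 ≤ (P * α - (3 * k - 2 * p) * β) ^ 2 / (2 * P * k) := by positivity
          have j3 : α * β ≤ (3 * k - 2 * p) / k * (α * β) :=
            le_mul_of_one_le_left (mul_nonneg hα hβ) ((one_le_div hk).2 (by linarith))
          linarith
        linarith
  · have hp0 : 0 < p := hk.trans_le hpk
    have e2 : ℓ - (p * (p - k) * a₁ ^ 2 + 2 * (p - k) * (a₁ * b₁) + b₁ ^ 2) / k - s -
        p / 2 * α ^ 2 = ℓ - b₁ ^ 2 / p + β ^ 2 / (2 * p) -
          (p - k) / (p * k) * (b₁ + p * a₁) ^ 2 -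
          (β ^ 2 + 2 * p * s + p ^ 2 * α ^ 2) / (2 * p) := by field_simp; ring
    have e3 : 0 ≤ (p - k) / (p * k) * (b₁ + p * a₁) ^ 2 :=
      mul_nonneg (div_nonneg (by linarith) (by positivity)) (sq_nonneg _)
    have e4 : 0 ≤ (β ^ 2 + 2 * p * s + p ^ 2 * α ^ 2) / (2 * p) := by
      refine div_nonneg ?_ (by positivity)
      nlinarith [sq_nonneg (β - p * α), mul_le_mul_of_nonneg_left hs'.1 hp]
    have e5 : ∀ c, p * (b₁ ^ 2 / p ^ 2 - ℓ / p - β ^ 2 / p ^ 2 / 2 + c) =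
        b₁ ^ 2 / p - ℓ - β ^ 2 / (2 * p) + p * c := fun c => by field_simp
    rcases le_or_gt p (2 * k) with hpk2 | hpk2
    · have i3 := mul_nonneg hp (h3 ⟨hpk, hpk2⟩)
      rw [e5] at i3
      have : (p - 2 * k) * t / 2 ≤ 0 := by nlinarith
      linarith
    · have i3 := mul_nonneg hp (h4 hpk2)
      rw [e5, mul_div_cancel₀ _ hp0.ne'] at i3
      have : (p - 2 * k) * t / 2 ≤ (p - 2 * k) / 2 := by nlinarith
      linarith

theorem HasJet.rpow {f : ℝ → ℝ} {a b c : ℝ} (h : HasJet f a b c) (hf : ∀ t, 0 < f t) (r : ℝ) :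
    HasJet (fun t => f t ^ r) (a ^ r) (a ^ r * (r * (b / a)))
      (a ^ r * (r * (c / a) + r * (r - 1) * (b / a) ^ 2)) := by
  have ha : 0 < a := by obtain ⟨_, _, _, h0, _⟩ := h; rw [← h0]; exact hf 0
  have h2 : HasDerivAt (fun x : ℝ => r * x ^ (r - 1)) (r * ((r - 1) * a ^ (r - 1 - 1))) a :=
    (Real.hasDerivAt_rpow_const (Or.inl ha.ne')).const_mul r
  refine (h.scomp (g := fun x => x ^ r)
    (fun t => Real.hasDerivAt_rpow_const (Or.inl (hf t).ne')) h2).of_eq rfl ?_ ?_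
  · rw [Real.rpow_sub_one ha.ne']; field_simp
  · rw [Real.rpow_sub_one ha.ne', Real.rpow_sub_one ha.ne']; field_simp; ring

end StructureCondition

section NegPow

variable {n : ℕ} {f : Euc n → ℝ} {x v : Euc n}

theorem Homog0.pos_of_ne_zero (hf0 : Homog0 f) (hfpos : ∀ x ∈ uSphere n, 0 < f x) (hx : x ≠ 0) :
    0 < f x := by
  have h := hfpos (‖x‖⁻¹ • x) (mem_uSphere.2 (norm_smul_inv_norm hx))
  rwa [hf0 _ _ (inv_pos.2 (norm_pos_iff.2 hx))] at h

theorem SmoothFn.c2 (hfs : SmoothFn f) : C2Off f :=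
  ContDiffOn.of_le hfs (WithTop.coe_le_coe.2 (le_top : (2 : ℕ∞) ≤ ⊤))

theorem Homog0.negPowExt (hf0 : Homog0 f) (r : ℝ) : Homog0 (negPowExt f r) := fun c y hc => by
  simp only [_root_.negPowExt, hf0 c y hc]

theorem C2Off.negPowExt (hf : C2Off f) (hf0 : Homog0 f) (hfpos : ∀ x ∈ uSphere n, 0 < f x)
    (r : ℝ) : C2Off (negPowExt f r) :=
  ContDiffOn.rpow_const_of_ne hf fun _ hx => (hf0.pos_of_ne_zero hfpos hx).ne'

theorem negPowExt_derivs (hf : C2Off f) (hf0 : Homog0 f) (hfpos : ∀ x ∈ uSphere n, 0 < f x)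
    (hx : ‖x‖ = 1) (hv : ‖v‖ = 1) (hxv : ⟪x, v⟫ = 0) (r : ℝ) :
    fderiv ℝ (negPowExt f r) x v = negPowExt f r x * (-(1 / r) * (fderiv ℝ f x v / f x)) ∧
    hessS (negPowExt f r) x v v = negPowExt f r x * ((fderiv ℝ f x v / f x) ^ 2 / r ^ 2 -
      (hessS f x v v / f x - (fderiv ℝ f x v / f x) ^ 2) / r) := by
  have h1 := hasJet_geo_hessS (hf.negPowExt hf0 hfpos r) (hf0.negPowExt r) hx hv hxv
  have h2 := ((hasJet_geo_hessS hf hf0 hx hv hxv).rpow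
    (fun t => hf0.pos_of_ne_zero hfpos (geo_ne_zero hx hv hxv t)) (-(1 / r)))
  obtain ⟨-, h3, h4⟩ := h1.eq h2
  refine ⟨h3, h4.trans ?_⟩
  simp only [negPowExt]
  ring

theorem norm_gradS_negPowExt (hf : C2Off f) (hf0 : Homog0 f) (hfpos : ∀ x ∈ uSphere n, 0 < f x)
    (hx : ‖x‖ = 1) {e : Fin n → Euc n} (he : OrthoFrame x e) {r : ℝ} (hr : 0 < r) :
    ‖gradS (negPowExt f r) x‖ = negPowExt f r x * (‖gradS f x‖ / f x / r) := by
  have hfx := hfpos x (mem_uSphere.2 hx)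
  have hg : 0 < negPowExt f r x := Real.rpow_pos_of_pos hfx _
  refine (sq_eq_sq₀ (norm_nonneg _) (by positivity)).1 ?_
  rw [norm_gradS_sq (hf.negPowExt hf0 hfpos r) (hf0.negPowExt r) hx he, mul_pow, div_pow, div_pow,
    norm_gradS_sq hf hf0 hx he, Finset.sum_div, Finset.sum_div, Finset.mul_sum]
  refine Finset.sum_congr rfl fun l _ => ?_
  rw [(negPowExt_derivs hf hf0 hfpos hx (he.norm_eq_one l) (he.1 l) r).1]
  field_simp

theorem AssumptionA.structure {k : ℕ} {p : ℝ} (hA : AssumptionA n k p f) (hk : 1 ≤ k)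
    (hp : 0 ≤ p) (hf : C2Off f)
    (hf0 : Homog0 f) (hfpos : ∀ x ∈ uSphere n, 0 < f x) (hx : ‖x‖ = 1) {e : Fin n → Euc n}
    (he : OrthoFrame x e) (i : Fin n) {a₁ α s t : ℝ} (hα : 0 ≤ α) (ha₁ : a₁ ^ 2 ≤ α ^ 2)
    (hs : |s| ≤ α * (‖gradS f x‖ / f x))
    (hr : 2 * a₁ * (fderiv ℝ f x (e i) / f x) - s ≤ α * (‖gradS f x‖ / f x))
    (hα1 : α ≤ 1) (ht0 : 0 ≤ t) (ht1 : t ≤ 1)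
    (hD : p = 0 → 1 / (2 + 8 * sphSup fun y => (f y / (n.choose k : ℝ)) ^ (1 / (k : ℝ))) ≤ t) :
    (hessS f x (e i) (e i) / f x - (fderiv ℝ f x (e i) / f x) ^ 2) -
      1 / (k : ℝ) * ((p - k) * a₁ + fderiv ℝ f x (e i) / f x) ^ 2 - (p - k) * a₁ ^ 2 -
      p / 2 * α ^ 2 - p / 2 + (p - 2 * k) * t / 2 - s ≤ 0 := by
  have hk0 : (0 : ℝ) < k := by exact_mod_cast hk
  have hfx := hfpos x (mem_uSphere.2 hx)
  have hg : ∀ r, 0 < _root_.negPowExt f r x := fun r => Real.rpow_pos_of_pos hfx _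
  have hd := fun r => (negPowExt_derivs hf hf0 hfpos hx (he.norm_eq_one i) (he.1 i) r).2
  have hn := fun {r : ℝ} (hr : 0 < r) => norm_gradS_negPowExt hf hf0 hfpos hx he hr
  have hxs := mem_uSphere.2 hx
  have hei := he.1 i
  obtain ⟨A0, A1, A2, A3, A4, A5⟩ := hA
  refine structure_inequality hk0 hp hα (by positivity) ha₁ hs hr hα1 ht0 ht1
    (D := 2 + 8 * sphSup fun y => (f y / (n.choose k : ℝ)) ^ (1 / (k : ℝ))) ?_ ?_ ?_ ?_ ?_
  · intro h
    refine ⟨?_, hD h⟩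
    have := A0 h x hxs (e i) hei
    rw [hd, hn hk0, he.norm_eq_one] at this
    refine nonneg_of_mul_nonneg_right (this.trans (le_of_eq ?_)) (hg k)
    ring
  · intro h
    have := A1 h x hxs (e i) hei
    rw [hd, hn hk0, he.norm_eq_one] at this
    refine nonneg_of_mul_nonneg_right (this.trans (le_of_eq ?_)) (hg k)
    ring
  · intro h
    have := A2 h x hxs (e i) hei
    rw [hd, hn hk0, he.norm_eq_one] at this
    refine nonneg_of_mul_nonneg_right (this.trans (le_of_eq ?_)) (hg k)
    have := (hg k).ne'
    field_simp
  · intro h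
    have hp0 : 0 < p := by linarith
    have : 0 ≤ hessS (_root_.negPowExt f p) x (e i) (e i) -
            (‖gradS (_root_.negPowExt f p) x‖ ^ 2 / (2 * _root_.negPowExt f p x)) * ‖e i‖ ^ 2 +
          (1 / 2) * _root_.negPowExt f p x * ‖e i‖ ^ 2 := by
      rcases h.2.lt_or_eq with h2 | h2
      · exact A3 ⟨h.1, h2⟩ x hxs (e i) hei
      · exact (A4 h2).2 x hxs (e i) hei
    rw [hd, hn hp0, he.norm_eq_one] at this
    refine nonneg_of_mul_nonneg_right (this.trans (le_of_eq ?_)) (hg p)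
    have := (hg p).ne'
    field_simp
  · intro h
    have hp0 : 0 < p := by linarith
    have := (A5 h).2.2 x hxs (e i) hei
    rw [hd, hn hp0, he.norm_eq_one] at this
    refine nonneg_of_mul_nonneg_right (this.trans (le_of_eq ?_)) (hg p)
    have := (hg p).ne'
    field_simp

end NegPow

section GeodesicComparison

theorem le_of_hasDerivAt_nonneg {g g' : ℝ → ℝ} (hg : ∀ t, HasDerivAt g (g' t) t) {a b : ℝ}
    (hab : a ≤ b) (h : ∀ t ∈ Set.Ioo a b, 0 ≤ g' t) : g a ≤ g b := by
  have : MonotoneOn g (Set.Icc a b) := by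
    refine monotoneOn_of_deriv_nonneg (convex_Icc a b)
      (fun t _ => (hg t).continuousAt.continuousWithinAt)
      (fun t _ => (hg t).differentiableAt.differentiableWithinAt) fun t ht => ?_
    rw [interior_Icc] at ht
    rw [(hg t).deriv]
    exact h t ht
  exact this (Set.left_mem_Icc.2 hab) (Set.right_mem_Icc.2 hab) hab

variable {u u₁ u₂ : ℝ → ℝ}

theorem ode_deriv_le (hu : ∀ t, HasDerivAt u (u₁ t) t) (hu₁ : ∀ t, HasDerivAt u₁ (u₂ t) t)
    (hpos : ∀ t, 0 < u t) (hode : ∀ t, (u₁ t ^ 2 + 1 - u t ^ 2) / (2 * u t) ≤ u₂ t)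
    (hper : u Real.pi = u 0) : u₁ 0 ≤ u 0 := by
  have hv : ∀ t, HasDerivAt (fun t => √(u t)) (u₁ t / (2 * √(u t))) t := fun t =>
    (hu t).sqrt (hpos t).ne'
  have hs : ∀ t, 0 < √(u t) := fun t => Real.sqrt_pos.2 (hpos t)
  have hv₁ : ∀ t, HasDerivAt (fun t => u₁ t / (2 * √(u t)))
      ((u₂ t * (2 * √(u t)) - u₁ t * (2 * (u₁ t / (2 * √(u t))))) / (2 * √(u t)) ^ 2) t :=
    fun t => (hu₁ t).div ((hv t).const_mul 2) (by have := hs t; positivity)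
  have hc : ∀ t : ℝ, HasDerivAt (fun t => Real.cos (t / 2)) (-Real.sin (t / 2) * (1 / 2)) t :=
    fun t => ((hasDerivAt_id t).div_const 2).cos
  have hsn : ∀ t : ℝ, HasDerivAt (fun t => Real.sin (t / 2)) (Real.cos (t / 2) * (1 / 2)) t :=
    fun t => ((hasDerivAt_id t).div_const 2).sin
  have key := le_of_hasDerivAt_nonneg
    (fun t => ((hv₁ t).mul (hc t)).add (((hv t).mul (hsn t)).const_mul (1 / 2))) Real.pi_pos.le
    (fun t ht => by
      have hcos : 0 ≤ Real.cos (t / 2) := Real.cos_nonneg_of_mem_Icc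
        ⟨by linarith [ht.1, Real.pi_pos], by linarith [ht.2]⟩
      have h1 := hode t
      have h2 := hpos t
      have h3 := hs t
      have h4 : √(u t) ^ 2 = u t := Real.sq_sqrt h2.le
      set r := √(u t)
      rw [← h4] at h1
      have e1 : (u₂ t * (2 * r) - u₁ t * (2 * (u₁ t / (2 * r)))) / (2 * r) ^ 2 + r / 4 =
          (u₂ t - (u₁ t ^ 2 + 1 - (r ^ 2) ^ 2) / (2 * r ^ 2)) / (2 * r) + 1 / (4 * r ^ 3) := by
        field_simp; ring
      have e2 : 0 ≤ (u₂ t * (2 * r) - u₁ t * (2 * (u₁ t / (2 * r)))) / (2 * r) ^ 2 + r / 4 := by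
        rw [e1]
        have := sub_nonneg.2 h1
        positivity
      refine (mul_nonneg e2 hcos).trans (le_of_eq ?_)
      ring)
  simp only [Pi.add_apply, Pi.mul_apply, zero_div, Real.cos_zero, Real.sin_zero, mul_zero, add_zero, mul_one,
    Real.cos_pi_div_two, Real.sin_pi_div_two, zero_add, hper] at key
  have h3 := hs 0
  have h4 : √(u 0) ^ 2 = u 0 := Real.sq_sqrt (hpos 0).le
  rw [div_le_iff₀ (by positivity)] at key
  nlinarith

theorem ode_quadratic_le {ψ ψ₁ ψ₂ : ℝ → ℝ} (h : ∀ t, HasDerivAt ψ (ψ₁ t) t)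
    (h₁ : ∀ t, HasDerivAt ψ₁ (ψ₂ t) t) (hpos : ∀ t, 0 < ψ t)
    (hode : ∀ t, (ψ₁ t ^ 2 + 4) / (2 * ψ t) ≤ ψ₂ t) (h0 : ψ₁ 0 = 0) {t : ℝ} (ht : 0 ≤ t) :
    ψ 0 + t ^ 2 / ψ 0 ≤ ψ t := by
  have hψ₂ : ∀ t, 0 ≤ ψ₂ t := fun t => le_trans (by have := hpos t; positivity) (hode t)
  have hψ₁ : ∀ t, 0 ≤ t → 0 ≤ ψ₁ t := fun t ht => by
    simpa [h0] using le_of_hasDerivAt_nonneg h₁ ht fun s _ => hψ₂ s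
  have hE : ∀ t, 0 ≤ t → 4 / ψ 0 ≤ (ψ₁ t ^ 2 + 4) / ψ t := fun t ht => by
    have := le_of_hasDerivAt_nonneg
      (fun s => ((((h₁ s).pow 2).add_const 4).div (h s) (hpos s).ne')) ht fun s hs => by
        have h1 := hpos s
        have h2 := hode s
        rw [div_le_iff₀ (by positivity)] at h2
        have h3 := mul_nonneg (hψ₁ s hs.1.le) (sub_nonneg.2 h2)
        refine div_nonneg ?_ (sq_nonneg _)
        refine h3.trans (le_of_eq ?_)
        simp; ring
    simpa [h0] using this
  have h2 : ∀ t, 0 ≤ t → 2 / ψ 0 ≤ ψ₂ t := fun t ht => by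
    have e1 := hE t ht
    have e2 := hode t
    have e3 : (ψ₁ t ^ 2 + 4) / (2 * ψ t) = (ψ₁ t ^ 2 + 4) / ψ t / 2 := by
      rw [div_div, mul_comm]
    have e4 : 4 / ψ 0 = 2 / ψ 0 * 2 := by ring
    linarith
  have h3 : ∀ t, 0 ≤ t → 2 / ψ 0 * t ≤ ψ₁ t := fun t ht => by
    have := le_of_hasDerivAt_nonneg
      (fun s => (h₁ s).sub ((hasDerivAt_id s).const_mul (2 / ψ 0))) ht fun s hs => by
        have := h2 s hs.1.le
        simp only [mul_one]; linarith
    simp only [Pi.sub_apply, id, h0, mul_zero, sub_zero] at this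
    linarith
  have := le_of_hasDerivAt_nonneg
    (fun s => (h s).sub (((hasDerivAt_id s).pow 2).div_const (ψ 0))) ht fun s hs => by
      have := h3 s hs.1.le
      simp only [id, mul_one, Nat.cast_ofNat]
      have e : 2 / ψ 0 * s = 2 * s ^ (2 - 1) / ψ 0 := by norm_num; ring
      linarith
  simp at this
  linarith

theorem ode_half_le (hu : ∀ t, HasDerivAt u (u₁ t) t) (hu₁ : ∀ t, HasDerivAt u₁ (u₂ t) t)
    (hpos : ∀ t, 0 < u t) (hode : ∀ t, (u₁ t ^ 2 + 1 - u t ^ 2) / (2 * u t) ≤ u₂ t)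
    (h0 : u₁ 0 = 0) (h1 : 1 ≤ u 0) {t : ℝ} (ht : t ∈ Set.Icc 0 (Real.pi / 2)) :
    u 0 + 1 / u 0 ≤ 2 * u t := by
  have hρ : ∀ τ : ℝ, (0 : ℝ) < 1 + τ ^ 2 := fun τ => by positivity
  have hat : ∀ τ : ℝ, HasDerivAt (fun τ => 2 * Real.arctan τ) (2 * (1 / (1 + τ ^ 2))) τ := fun τ =>
    (Real.hasDerivAt_arctan τ).const_mul 2
  have hψ : ∀ τ : ℝ, HasDerivAt (fun τ => (1 + τ ^ 2) * u (2 * Real.arctan τ))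
      (2 * τ * u (2 * Real.arctan τ) + 2 * u₁ (2 * Real.arctan τ)) τ := fun τ => by
    have := (((hasDerivAt_id τ).pow 2).const_add 1).mul ((hu (2 * Real.arctan τ)).comp τ (hat τ))
    refine this.congr_deriv ?_
    have := hρ τ
    simp
    field_simp
  have hψ₁ : ∀ τ : ℝ, HasDerivAt
      (fun τ => 2 * τ * u (2 * Real.arctan τ) + 2 * u₁ (2 * Real.arctan τ))
      (2 * u (2 * Real.arctan τ) + 4 * τ * u₁ (2 * Real.arctan τ) / (1 + τ ^ 2) +
        4 * u₂ (2 * Real.arctan τ) / (1 + τ ^ 2)) τ := fun τ => by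
    have := (((hasDerivAt_id τ).const_mul 2).mul ((hu (2 * Real.arctan τ)).comp τ (hat τ))).add
      (((hu₁ (2 * Real.arctan τ)).comp τ (hat τ)).const_mul 2)
    refine this.congr_deriv ?_
    have := hρ τ
    simp
    field_simp
    ring
  have hτ : Real.tan (t / 2) ∈ Set.Icc 0 1 := by
    constructor
    · exact Real.tan_nonneg_of_nonneg_of_le_pi_div_two (by linarith [ht.1])
        (by linarith [ht.2, Real.pi_pos])
    · rw [← Real.tan_pi_div_four]
      refine (Real.strictMonoOn_tan.le_iff_le ⟨?_, ?_⟩ ⟨?_, ?_⟩).2 ?_ <;>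
        linarith [ht.1, ht.2, Real.pi_pos]
  have key := ode_quadratic_le hψ hψ₁ (fun τ => mul_pos (hρ τ) (hpos _)) (fun τ => by
      have e1 := hode (2 * Real.arctan τ)
      have e2 := hpos (2 * Real.arctan τ)
      have e3 := hρ τ
      set w := u (2 * Real.arctan τ)
      set w₁ := u₁ (2 * Real.arctan τ)
      have : (((2 * τ * w + 2 * w₁) ^ 2 + 4) / (2 * ((1 + τ ^ 2) * w))) =
          2 * w + 4 * τ * w₁ / (1 + τ ^ 2) +
            4 * ((w₁ ^ 2 + 1 - w ^ 2) / (2 * w)) / (1 + τ ^ 2) := by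
        field_simp; ring
      rw [this]
      gcongr) (by simp [h0]) hτ.1
  rw [Real.arctan_tan (by linarith [ht.1, Real.pi_pos]) (by linarith [ht.2, Real.pi_pos])] at key
  simp only [Real.arctan_zero, mul_zero, mul_div_cancel₀ t (two_ne_zero' ℝ)] at key
  set τ := Real.tan (t / 2)
  have hu0 : 0 < u 0 := hpos 0
  have e1 : 1 / u 0 ≤ u 0 := ((div_le_one hu0).2 h1).trans h1
  have e2 : τ ^ 2 ≤ 1 := by nlinarith [hτ.1, hτ.2]
  have e3 : τ ^ 2 / u 0 = τ ^ 2 * (1 / u 0) := by ring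
  norm_num at key
  rw [e3] at key
  have e4 : (1 + τ ^ 2) * (u 0 + 1 / u 0) ≤ 2 * (u 0 + τ ^ 2 * (1 / u 0)) := by
    nlinarith [mul_nonneg (sub_nonneg.2 e2) (sub_nonneg.2 e1)]
  refine le_of_mul_le_mul_left ?_ (hρ τ)
  linarith

end GeodesicComparison

section EvenConvex

variable {n : ℕ} {Φ : Euc n → ℝ} {x y v w : Euc n}

theorem sq_add_sq_le_norm_sq (T : Euc n →L[ℝ] ℝ) (hx : ‖x‖ = 1) (hv : ‖v‖ = 1)
    (hxv : ⟪x, v⟫ = 0) : T x ^ 2 + T v ^ 2 ≤ ‖T‖ ^ 2 := by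
  have h1 : ‖T x • x + T v • v‖ ^ 2 = T x ^ 2 + T v ^ 2 := by
    rw [norm_add_sq_real, norm_smul, norm_smul, hx, hv, real_inner_smul_left,
      real_inner_smul_right, hxv]
    simp
  have h2 := T.le_opNorm (T x • x + T v • v)
  have h3 : T (T x • x + T v • v) = T x ^ 2 + T v ^ 2 := by simp [sq]
  rw [h3, ← h1, Real.norm_of_nonneg (by positivity), sq] at h2
  by_cases h0 : ‖T x • x + T v • v‖ = 0
  · rw [← h1, h0]; simp
  · have := (norm_nonneg (T x • x + T v • v)).lt_of_ne' h0
    have := le_of_mul_le_mul_right h2 this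
    rw [← h1]
    gcongr

theorem geo_neg_neg (y v : Euc n) (t : ℝ) : geo (-y) (-v) t = -geo y v t := by
  simp [geo]; abel

theorem inner_geo_geo (hy : ‖y‖ = 1) (hv : ‖v‖ = 1) (hyv : ⟪y, v⟫ = 0) (t : ℝ) :
    ⟪geo y v t, geo v (-y) t⟫ = 0 := by
  simp only [geo, inner_add_left, inner_add_right, real_inner_smul_left, real_inner_smul_right,
    inner_neg_right, real_inner_comm y v, hyv, real_inner_self_eq_norm_sq, hy, hv]
  ring

theorem C2Off.hasDerivAt_comp_geo (h : C2Off Φ) (hy : ‖y‖ = 1) (hv : ‖v‖ = 1) (hyv : ⟪y, v⟫ = 0)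
    (t : ℝ) : HasDerivAt (fun t => Φ (geo y v t))
      (fderiv ℝ Φ (geo y v t) (geo v (-y) t)) t :=
  (h.hasFDerivAt (geo_ne_zero hy hv hyv t)).comp_hasDerivAt t (hasDerivAt_geo y v t)

theorem C2Off.hasDerivAt_fderiv_comp_geo (h : C2Off Φ) (hh : Homog1 Φ) (hy : ‖y‖ = 1)
    (hv : ‖v‖ = 1) (hyv : ⟪y, v⟫ = 0) (t : ℝ) :
    HasDerivAt (fun t => fderiv ℝ Φ (geo y v t) (geo v (-y) t))
      (d2 Φ (geo y v t) (geo v (-y) t) (geo v (-y) t) - Φ (geo y v t)) t := by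
  have h0 := geo_ne_zero hy hv hyv t
  have h1 := (h.hasFDerivAt_fderiv h0).comp_hasDerivAt t (hasDerivAt_geo y v t)
  have h2 := h1.clm_apply (hasDerivAt_geo v (-y) t)
  refine h2.congr_deriv ?_
  rw [geo_neg_neg, map_neg, Function.comp_apply, hh.fderiv_self h h0, ← sub_eq_add_neg]

theorem geo_ode (h : C2Off Φ) (hh : Homog1 Φ) (hpos : ∀ x, ‖x‖ = 1 → 0 < Φ x)
    (hconv : ∀ x w, ‖x‖ = 1 → ⟪x, w⟫ = 0 → kap Φ x * ⟪w, w⟫ ≤ d2 Φ x w w)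
    (hy : ‖y‖ = 1) (hv : ‖v‖ = 1) (hyv : ⟪y, v⟫ = 0) (t : ℝ) :
    (fderiv ℝ Φ (geo y v t) (geo v (-y) t) ^ 2 + 1 - Φ (geo y v t) ^ 2) / (2 * Φ (geo y v t)) ≤
      d2 Φ (geo y v t) (geo v (-y) t) (geo v (-y) t) - Φ (geo y v t) := by
  have h0 := norm_geo hy hv hyv t
  have h1 : ‖geo v (-y) t‖ = 1 := norm_geo hv (by simpa using hy) (by simp [real_inner_comm, hyv]) t
  have h2 := inner_geo_geo hy hv hyv t
  have h3 := hconv _ _ h0 h2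
  have h4 := sq_add_sq_le_norm_sq (fderiv ℝ Φ (geo y v t)) h0 h1 h2
  have h5 := hpos _ h0
  rw [real_inner_self_eq_norm_sq, h1, one_pow, mul_one] at h3
  rw [hh.fderiv_self h (ne_zero_of_norm_eq_one h0)] at h4
  refine le_trans ?_ (sub_le_sub_right h3 _)
  rw [kap, div_sub' (by positivity)]
  exact div_le_div_of_nonneg_right (by linarith) (by positivity)

theorem fderiv_le_of_even (h : C2Off Φ) (hh : Homog1 Φ) (hpos : ∀ x, ‖x‖ = 1 → 0 < Φ x)
    (hev : ∀ x, Φ (-x) = Φ x)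
    (hconv : ∀ x w, ‖x‖ = 1 → ⟪x, w⟫ = 0 → kap Φ x * ⟪w, w⟫ ≤ d2 Φ x w w)
    (hy : ‖y‖ = 1) (hv : ‖v‖ = 1) (hyv : ⟪y, v⟫ = 0) : fderiv ℝ Φ y v ≤ Φ y := by
  have := ode_deriv_le (h.hasDerivAt_comp_geo hy hv hyv) (h.hasDerivAt_fderiv_comp_geo hh hy hv hyv)
    (fun t => hpos _ (norm_geo hy hv hyv t)) (geo_ode h hh hpos hconv hy hv hyv)
    (by simp [geo, hev])
  simpa [geo] using this

theorem sum_sq_fderiv_le (h : C2Off Φ) (hh : Homog1 Φ) (hpos : ∀ x, ‖x‖ = 1 → 0 < Φ x)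
    (hev : ∀ x, Φ (-x) = Φ x)
    (hconv : ∀ x w, ‖x‖ = 1 → ⟪x, w⟫ = 0 → kap Φ x * ⟪w, w⟫ ≤ d2 Φ x w w)
    (hy : ‖y‖ = 1) {e : Fin n → Euc n} (he : OrthoFrame y e) :
    ∑ l, (fderiv ℝ Φ y (e l) / Φ y) ^ 2 ≤ 1 := by
  have hp := hpos y hy
  set s := ∑ l, fderiv ℝ Φ y (e l) ^ 2 with hs
  have hs0 : 0 ≤ s := by positivity
  have e1 : ∑ l, (fderiv ℝ Φ y (e l) / Φ y) ^ 2 = s / Φ y ^ 2 := by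
    simp [div_pow, hs, sum_div]
  rw [e1, div_le_one (by positivity)]
  rcases hs0.eq_or_lt with h0 | h0
  · rw [← h0]; positivity
  have hr := Real.sqrt_pos.2 h0
  have hr2 := Real.sq_sqrt hs0
  set r := √s
  set z : Euc n := ∑ l, fderiv ℝ Φ y (e l) • e l with hz
  have hyz : ⟪y, z⟫ = 0 := by simp [hz, inner_sum, real_inner_smul_right, he.1]
  have hez : ∀ l, ⟪e l, z⟫ = fderiv ℝ Φ y (e l) := fun l => by
    simp [hz, inner_sum, real_inner_smul_right, he.2]
  have hzz : ‖z‖ ^ 2 = s := by rw [he.norm_sq hy z, hyz]; simp [hez, hs]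
  have hzr : ‖z‖ = r := by
    rw [← Real.sqrt_sq (norm_nonneg z), hzz]
  have hDz : fderiv ℝ Φ y z = s := by simp [hz, hs, sq]
  have := fderiv_le_of_even h hh hpos hev hconv hy (v := r⁻¹ • z)
    (by rw [norm_smul, hzr, norm_inv, Real.norm_of_nonneg hr.le, inv_mul_cancel₀ hr.ne'])
    (by rw [real_inner_smul_right, hyz, mul_zero])
  rw [map_smul, hDz, smul_eq_mul, ← hr2, sq, inv_mul_cancel_left₀ hr.ne'] at this
  rw [← hr2]
  gcongr

theorem fderiv_eq_zero_of_max (h : C2Off Φ) (hy : ‖y‖ = 1) (hmax : ∀ z, ‖z‖ = 1 → Φ z ≤ Φ y)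
    (hv : ‖v‖ = 1) (hyv : ⟪y, v⟫ = 0) : fderiv ℝ Φ y v = 0 := by
  have h1 := (HasJet.const (Φ y)).sub (h.hasJet_geo hy hv hyv)
  have h2 := (h1.of_eq (sub_self _) rfl rfl).nonneg_min
    fun t => sub_nonneg.2 (hmax _ (norm_geo hy hv hyv t))
  simpa using h2.1

theorem add_inv_le_of_max (h : C2Off Φ) (hh : Homog1 Φ) (hΦ : ∀ x, ‖x‖ = 1 → 1 ≤ Φ x)
    (hev : ∀ x, Φ (-x) = Φ x)
    (hconv : ∀ x w, ‖x‖ = 1 → ⟪x, w⟫ = 0 → kap Φ x * ⟪w, w⟫ ≤ d2 Φ x w w)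
    (hy : ‖y‖ = 1) (hmax : ∀ z, ‖z‖ = 1 → Φ z ≤ Φ y) {z : Euc n} (hz : ‖z‖ = 1) :
    Φ y + 1 / Φ y ≤ 2 * Φ z := by
  wlog hyz : 0 ≤ ⟪y, z⟫ generalizing z
  · rw [← hev z]
    exact this (by simpa using hz) (by rw [inner_neg_right]; linarith)
  have hpos : ∀ x, ‖x‖ = 1 → 0 < Φ x := fun x hx => zero_lt_one.trans_le (hΦ x hx)
  set c := ⟪y, z⟫ with hc
  have hc1 : c ≤ 1 := by simpa [hy, hz] using real_inner_le_norm y z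
  have hw : ‖z - c • y‖ ^ 2 = 1 - c ^ 2 := by
    rw [norm_sub_sq_real, norm_smul, real_inner_smul_right, real_inner_comm y z, ← hc, hy, hz,
      Real.norm_of_nonneg hyz]
    ring
  rcases hc1.eq_or_lt with h1 | h1
  · have : z = y := by
      have : ‖z - c • y‖ = 0 := by
        have : ‖z - c • y‖ ^ 2 = 0 := by rw [hw, h1]; norm_num
        exact pow_eq_zero_iff two_ne_zero |>.1 this
      rw [norm_sub_eq_zero_iff, h1, one_smul] at this
      exact this
    rw [this]
    have : 1 / Φ y ≤ 1 := (div_le_one (hpos y hy)).2 (hΦ y hy)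
    linarith [hΦ y hy]
  set s := Real.sin (Real.arccos c) with hs
  have hs2 : s ^ 2 = 1 - c ^ 2 := by
    rw [hs, Real.sin_arccos, Real.sq_sqrt (by nlinarith)]
  have hs0 : 0 < s := by
    rw [hs, Real.sin_arccos]; exact Real.sqrt_pos.2 (by nlinarith)
  have hwn : ‖z - c • y‖ = s := by
    rw [← Real.sqrt_sq (norm_nonneg _), hw, ← hs2, Real.sqrt_sq hs0.le]
  have hv : ‖s⁻¹ • (z - c • y)‖ = 1 := by
    rw [norm_smul, hwn, norm_inv, Real.norm_of_nonneg hs0.le, inv_mul_cancel₀ hs0.ne']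
  have hyv : ⟪y, s⁻¹ • (z - c • y)⟫ = 0 := by
    rw [real_inner_smul_right, inner_sub_right, real_inner_smul_right, ← hc,
      real_inner_self_eq_norm_sq, hy]
    ring
  have key := ode_half_le (h.hasDerivAt_comp_geo hy hv hyv)
    (h.hasDerivAt_fderiv_comp_geo hh hy hv hyv)
    (fun t => hpos _ (norm_geo hy hv hyv t)) (geo_ode h hh hpos hconv hy hv hyv)
    (by simpa [geo] using fderiv_eq_zero_of_max h hy hmax hv hyv) (by simpa [geo] using hΦ y hy)
    (t := Real.arccos c) ⟨Real.arccos_nonneg c, Real.arccos_le_pi_div_two.2 hyz⟩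
  have hgz : geo y (s⁻¹ • (z - c • y)) (Real.arccos c) = z := by
    rw [geo, Real.cos_arccos (by linarith) hc1, ← hs, smul_inv_smul₀ hs0.ne']
    abel
  rw [hgz] at key
  simpa [geo] using key

theorem le_d2_of_min (h : C2Off Φ) (hh : Homog1 Φ) (hpos : ∀ x, ‖x‖ = 1 → 0 < Φ x) (hy : ‖y‖ = 1)
    (hmin : ∀ z, ‖z‖ = 1 → Φ y ≤ Φ z) (hv : ‖v‖ = 1) (hyv : ⟪y, v⟫ = 0) :
    (Φ y - 1 / Φ y) / 2 ≤ d2 Φ y v v - kap Φ y := by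
  have hjet : ∀ w, ‖w‖ = 1 → ⟪y, w⟫ = 0 → fderiv ℝ Φ y w = 0 ∧ Φ y ≤ d2 Φ y w w := by
    intro w hw hyw
    have h1 := (h.hasJet_geo hy hw hyw).sub (HasJet.const (Φ y))
    have h2 := (h1.of_eq (sub_self _) rfl rfl).nonneg_min
      fun t => sub_nonneg.2 (hmin _ (norm_geo hy hw hyw t))
    rw [hh.fderiv_self h (ne_zero_of_norm_eq_one hy)] at h2
    exact ⟨by simpa using h2.1, by simpa using h2.2⟩
  obtain ⟨e, W, he, -⟩ := exists_orthoFrame_of_isSymmetric hy 0 (by simp) (by simp)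
  have h3 := he.clm_norm_sq hy (fderiv ℝ Φ y)
  rw [hh.fderiv_self h (ne_zero_of_norm_eq_one hy)] at h3
  simp only [fun l => (hjet (e l) (he.norm_eq_one l) (he.1 l)).1] at h3
  have h4 := (hjet v hv hyv).2
  have hp := hpos y hy
  have h5 : kap Φ y = (Φ y + 1 / Φ y) / 2 := by
    rw [kap, h3]; field_simp; simp
  rw [h5]; linarith

end EvenConvex

section SphereBounds

variable {n : ℕ}

theorem exists_norm_le_on_sphere {G : Type*} [NormedAddCommGroup G] {g : Euc n → G}
    (hg : ContinuousOn g {y : Euc n | y ≠ 0}) : ∃ C, ∀ x, ‖x‖ = 1 → ‖g x‖ ≤ C := by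
  obtain ⟨C, hC⟩ := (isCompact_sphere (0 : Euc n) 1).exists_bound_of_continuousOn
    (hg.mono fun x hx => ne_zero_of_norm_eq_one (mem_uSphere.1 hx))
  exact ⟨C, fun x hx => hC x (mem_uSphere.2 hx)⟩

theorem exists_isMin_on_sphere {g : Euc n → ℝ} (hg : ContinuousOn g {y : Euc n | y ≠ 0}) :
    ∃ q, ‖q‖ = 1 ∧ ∀ z, ‖z‖ = 1 → g q ≤ g z := by
  have hne : (uSphere n).Nonempty := ⟨EuclideanSpace.single 0 1, by simp [mem_uSphere]⟩
  obtain ⟨q, hq, hmin⟩ := (isCompact_sphere (0 : Euc n) 1).exists_isMinOn hne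
    (hg.mono fun x hx => ne_zero_of_norm_eq_one (mem_uSphere.1 hx))
  exact ⟨q, mem_uSphere.1 hq, fun z hz => hmin (mem_uSphere.2 hz)⟩

theorem exists_isMax_on_sphere {g : Euc n → ℝ} (hg : ContinuousOn g {y : Euc n | y ≠ 0}) :
    ∃ q, ‖q‖ = 1 ∧ ∀ z, ‖z‖ = 1 → g z ≤ g q := by
  obtain ⟨q, hq, hmin⟩ := exists_isMin_on_sphere hg.neg
  exact ⟨q, hq, fun z hz => neg_le_neg_iff.1 (hmin z hz)⟩

variable {Φ f : Euc n → ℝ} {y : Euc n} {e : Fin n → Euc n} {W : Fin n → ℝ} {k : ℕ} {p : ℝ}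

theorem sigmaMat_of_frame (he : OrthoFrame y e) (hW : ∀ l z, d2 Φ y (e l) z = W l * ⟪e l, z⟫) :
    sigmaMat k (Matrix.of fun i j => d2 Φ y (e i) (e j) - kap Φ y * if i = j then 1 else 0) =
      esS k fun l => W l - kap Φ y := by
  rw [← sigmaMat_diagonal]
  congr 1
  ext i j
  by_cases hij : i = j
  · subst hij; simp [hW, he.2]
  · simp [hW, he.2, hij]

theorem one_div_le_one_div_sq (hf : C2Off f) (hf0 : Homog0 f) (hfpos : ∀ x ∈ uSphere n, 0 < f x)
    (h : C4Off Φ) (hh : Homog1 Φ) (hΦ : ∀ x, ‖x‖ = 1 → 1 < Φ x) (hev : ∀ x, Φ (-x) = Φ x)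
    (hconv : ∀ x w, ‖x‖ = 1 → ⟪x, w⟫ = 0 → kap Φ x * ⟪w, w⟫ ≤ d2 Φ x w w) (hk : 1 ≤ k)
    (hkn : k ≤ n)
    (hsol : ∀ x, ‖x‖ = 1 → ∀ e : Fin n → Euc n, OrthoFrame x e →
      sigmaMat k (Matrix.of fun i j => d2 Φ x (e i) (e j) - kap Φ x * if i = j then 1 else 0) =
        Φ x ^ (-(k : ℝ)) * f x) (hy : ‖y‖ = 1) :
    1 / (2 + 8 * sphSup fun y => (f y / (n.choose k : ℝ)) ^ (1 / (k : ℝ))) ≤ 1 / Φ y ^ 2 := by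
  have hΦ' : ∀ x, ‖x‖ = 1 → 1 ≤ Φ x := fun x hx => (hΦ x hx).le
  have hpos : ∀ x, ‖x‖ = 1 → 0 < Φ x := fun x hx => zero_lt_one.trans (hΦ x hx)
  obtain ⟨q, hq, hqmin⟩ := exists_isMin_on_sphere h.continuousOn
  obtain ⟨m, hm, hmmax⟩ := exists_isMax_on_sphere h.continuousOn
  have hq0 := ne_zero_of_norm_eq_one hq
  obtain ⟨e, W, he, hW⟩ := exists_orthoFrame_of_isSymmetric hq (d2 Φ q)
    (h.c2.d2_symm hq0) (fun v => by rw [hh.d2_self h.c2 hq0]; rfl)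
  have hΦq := hΦ q hq
  have hΦq0 := hpos q hq
  set F : Euc n → ℝ := fun y => (f y / (n.choose k : ℝ)) ^ (1 / (k : ℝ)) with hF
  have hch : (0 : ℝ) < n.choose k := by exact_mod_cast Nat.choose_pos hkn
  have hk0 : (0 : ℝ) < k := by exact_mod_cast hk
  have hFc : ContinuousOn F {y : Euc n | y ≠ 0} :=
    (hf.continuousOn.div_const _).rpow_const fun x hx =>
      Or.inl (div_pos (hf0.pos_of_ne_zero hfpos hx) hch).ne'
  have hFq : F q ≤ sphSup F := by
    obtain ⟨C, hC⟩ := exists_norm_le_on_sphere hFc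
    refine le_csSup ⟨C, ?_⟩ ⟨q, mem_uSphere.2 hq, rfl⟩
    rintro _ ⟨x, hx, rfl⟩
    exact (le_abs_self _).trans (hC x (mem_uSphere.1 hx))
  have hd : ∀ l, (Φ q - 1 / Φ q) / 2 ≤ W l - kap Φ q := fun l => by
    have := le_d2_of_min h.c2 hh hpos hq hqmin (he.norm_eq_one l) (he.1 l)
    rwa [hW, he.2, if_pos rfl, mul_one] at this
  have hc : 0 ≤ (Φ q - 1 / Φ q) / 2 := by
    have : 1 / Φ q ≤ 1 := (div_le_one hΦq0).2 hΦq.le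
    linarith
  have h1 := le_esS k hc hd
  rw [← sigmaMat_of_frame he hW, hsol q hq e he, Real.rpow_neg hΦq0.le, Real.rpow_natCast] at h1
  have h2 : ((Φ q ^ 2 - 1) / 2) ^ k ≤ f q / n.choose k := by
    have e1 : (Φ q ^ 2 - 1) / 2 = (Φ q - 1 / Φ q) / 2 * Φ q := by field_simp
    rw [e1, mul_pow, le_div_iff₀ hch]
    have := mul_le_mul_of_nonneg_right h1 (pow_pos hΦq0 k).le
    have e2 : (Φ q ^ k)⁻¹ * f q * Φ q ^ k = f q := by field_simp
    linarith
  have h3 : (Φ q ^ 2 - 1) / 2 ≤ F q := by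
    have hnn : 0 ≤ (Φ q ^ 2 - 1) / 2 := by nlinarith
    have := Real.rpow_le_rpow (by positivity) h2 (by positivity : 0 ≤ 1 / (k : ℝ))
    rwa [← Real.rpow_natCast, ← Real.rpow_mul hnn, mul_one_div_cancel hk0.ne', Real.rpow_one]
      at this
  have h4 := add_inv_le_of_max h.c2 hh hΦ' hev hconv hm hmmax hq
  have h5 := hmmax y hy
  have hy0 := hpos y hy
  have hm0 := hpos m hm
  have h6 : (Φ m + 1 / Φ m) ^ 2 ≤ (2 * Φ q) ^ 2 := by gcongr
  have h7 : (Φ m + 1 / Φ m) ^ 2 = Φ m ^ 2 + 2 + (1 / Φ m) ^ 2 := by field_simp; ring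
  refine one_div_le_one_div_of_le (by positivity) ?_
  nlinarith [sq_nonneg (1 / Φ m)]

end SphereBounds

section MainTerm

variable {n : ℕ} {Φ f : Euc n → ℝ} {y : Euc n} {e : Fin n → Euc n} {k : ℕ} {p : ℝ}

theorem hasJet_rhs (hf : C2Off f) (hf0 : Homog0 f) (hfpos : ∀ x ∈ uSphere n, 0 < f x)
    (h : C4Off Φ) (hh : Homog1 Φ) (hpos : ∀ x, ‖x‖ = 1 → 0 < Φ x)
    (hy : ‖y‖ = 1) {v : Euc n} (hv : ‖v‖ = 1) (hyv : ⟪y, v⟫ = 0) (q : ℝ) :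
    HasJet (fun t => Φ (geo y v t) ^ q * f (geo y v t)) (Φ y ^ q * f y)
      (Φ y ^ q * f y * (q * (fderiv ℝ Φ y v / Φ y) + fderiv ℝ f y v / f y))
      (Φ y ^ q * f y * ((q * (fderiv ℝ Φ y v / Φ y) + fderiv ℝ f y v / f y) ^ 2 +
        q * ((d2 Φ y v v - Φ y) / Φ y - (fderiv ℝ Φ y v / Φ y) ^ 2) +
        (hessS f y v v / f y - (fderiv ℝ f y v / f y) ^ 2))) := by
  have hfy := hfpos y (mem_uSphere.2 hy)
  have hΦy := hpos y hy
  have h1 := ((h.c2.hasJet_geo hy hv hyv).rpow (fun t => hpos _ (norm_geo hy hv hyv t)) q).mul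
    (hasJet_geo_hessS hf hf0 hy hv hyv)
  refine h1.of_eq rfl ?_ ?_
  · field_simp
  · rw [hh.fderiv_self h.c2 (ne_zero_of_norm_eq_one hy)]
    field_simp
    ring

theorem main_term_le (hk : 1 ≤ k) (hp : 0 ≤ p) (hA : AssumptionA n k p f)
    (hf : C2Off f) (hf0 : Homog0 f) (hfpos : ∀ x ∈ uSphere n, 0 < f x)
    (h : C2Off Φ) (hh : Homog1 Φ) (hΦ : ∀ x, ‖x‖ = 1 → 1 ≤ Φ x) (hev : ∀ x, Φ (-x) = Φ x)
    (hconv : ∀ x w, ‖x‖ = 1 → ⟪x, w⟫ = 0 → kap Φ x * ⟪w, w⟫ ≤ d2 Φ x w w)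
    (hD : p = 0 → ∀ x, ‖x‖ = 1 →
      1 / (2 + 8 * sphSup fun y => (f y / (n.choose k : ℝ)) ^ (1 / (k : ℝ))) ≤ 1 / Φ x ^ 2)
    (hy : ‖y‖ = 1) (he : OrthoFrame y e) (i : Fin n) :
    (hessS f y (e i) (e i) / f y - (fderiv ℝ f y (e i) / f y) ^ 2) -
      1 / (k : ℝ) * ((p - k) * (fderiv ℝ Φ y (e i) / Φ y) + fderiv ℝ f y (e i) / f y) ^ 2 +
      (p - k) * ((kap Φ y - Φ y) / Φ y - (fderiv ℝ Φ y (e i) / Φ y) ^ 2) -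
      ∑ j, fderiv ℝ Φ y (e j) / Φ y *
        ((p - k) * (fderiv ℝ Φ y (e j) / Φ y) + fderiv ℝ f y (e j) / f y) -
      k * kap Φ y / Φ y ≤ 0 := by
  have hpos : ∀ x, ‖x‖ = 1 → 0 < Φ x := fun x hx => zero_lt_one.trans_le (hΦ x hx)
  have hΦy := hΦ y hy
  have hΦ0 := hpos y hy
  have hfy := hfpos y (mem_uSphere.2 hy)
  set a : Fin n → ℝ := fun j => fderiv ℝ Φ y (e j) / Φ y with ha
  set b : Fin n → ℝ := fun j => fderiv ℝ f y (e j) / f y with hb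
  have hsum := sum_sq_fderiv_le h hh hpos hev hconv hy he
  have hα0 : 0 ≤ ∑ j, a j ^ 2 := Finset.sum_nonneg fun j _ => sq_nonneg _
  have hα2 := Real.sq_sqrt hα0
  set α := √(∑ j, a j ^ 2) with hα
  have hβ : ‖gradS f y‖ / f y = √(∑ j, b j ^ 2) := by
    rw [← Real.sqrt_sq (norm_nonneg (gradS f y)), norm_gradS_sq hf hf0 hy he]
    simp only [hb, div_pow, ← Finset.sum_div]
    rw [Real.sqrt_div' _ (by positivity), Real.sqrt_sq hfy.le]
  have hCS : ∀ c : Fin n → ℝ, (∀ j, c j ^ 2 = a j ^ 2) →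
      |∑ j, c j * b j| ≤ α * (‖gradS f y‖ / f y) := fun c hc => by
    rw [hβ, hα, ← Finset.sum_congr rfl fun j _ => hc j, ← Real.sqrt_mul (by positivity)]
    exact Real.abs_le_sqrt (Finset.sum_mul_sq_le_sq_mul_sq _ _ _)
  have ht : 1 / Φ y ^ 2 ≤ 1 := (div_le_one (by positivity)).2 (one_le_pow₀ hΦy)
  have key := hA.structure hk hp hf hf0 hfpos hy he i (a₁ := a i) (α := α) (s := ∑ j, a j * b j)
    (t := 1 / Φ y ^ 2) (Real.sqrt_nonneg _)
    (by rw [hα2]; exact Finset.single_le_sum (fun j _ => sq_nonneg (a j)) (Finset.mem_univ i))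
    (hCS a fun _ => rfl) (by
      have h1 := hCS (fun j => if j = i then -a i else a j) fun j => by
        split_ifs with hj
        · rw [hj, neg_sq]
        · rfl
      have h2 : ∑ j, (if j = i then -a i else a j) * b j =
          ∑ j, a j * b j - 2 * a i * b i := by
        have : ∀ j, (if j = i then -a i else a j) * b j =
            a j * b j - if j = i then 2 * a i * b i else 0 := fun j => by
          split_ifs with hj
          · rw [hj]; ring
          · ring
        simp only [this, Finset.sum_sub_distrib]
        simp
      rw [h2] at h1
      have := neg_abs_le (∑ j, a j * b j - 2 * a i * b i)
      linarith)
    (by rw [hα, Real.sqrt_le_one]; exact hsum) (by positivity) ht (fun h0 => hD h0 y hy)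
  have hκ : kap Φ y / Φ y = (α ^ 2 + 1 + 1 / Φ y ^ 2) / 2 := by
    have h1 : ∑ j, fderiv ℝ Φ y (e j) ^ 2 = Φ y ^ 2 * ∑ j, a j ^ 2 := by
      rw [Finset.mul_sum]
      refine Finset.sum_congr rfl fun j _ => ?_
      simp only [ha]
      field_simp
    rw [kap, he.clm_norm_sq hy, hh.fderiv_self h (ne_zero_of_norm_eq_one hy), h1, hα2]
    field_simp
    ring
  have hs : ∑ j, a j * ((p - k) * a j + b j) = (p - k) * α ^ 2 + ∑ j, a j * b j := by
    rw [hα2, Finset.mul_sum, ← Finset.sum_add_distrib]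
    exact Finset.sum_congr rfl fun j _ => by ring
  rw [hs, sub_div, div_self hΦ0.ne', mul_div_assoc, hκ]
  change _ ≤ (0 : ℝ) at key
  linarith

end MainTerm

section UniformInequality

set_option maxSynthPendingDepth 3

variable {n : ℕ} {Φ f : Euc n → ℝ} {k : ℕ} {p : ℝ}

theorem exists_uniform_bound (hf : C2Off f) (hfpos : ∀ x ∈ uSphere n, 0 < f x)
    (h : C4Off Φ) (hΦ : ∀ x, ‖x‖ = 1 → 1 ≤ Φ x) (q : ℝ) :
    ∃ B : ℝ, 1 ≤ B ∧ ∀ x, ‖x‖ = 1 → ‖fderiv ℝ Φ x‖ ≤ B ∧ ‖d2 Φ x‖ ≤ B ∧ ‖d3 Φ x‖ ≤ B ∧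
      Φ x ^ q * f x ≤ B ∧ 1 ≤ B * (Φ x ^ q * f x) := by
  have hpos : ∀ x, ‖x‖ = 1 → 0 < Φ x := fun x hx => zero_lt_one.trans_le (hΦ x hx)
  have hsub : ∀ x, x ∈ uSphere n → x ≠ 0 := fun x hx => ne_zero_of_norm_eq_one (mem_uSphere.1 hx)
  have hH : ContinuousOn (fun x => Φ x ^ q * f x) (uSphere n) :=
    ((h.continuousOn.mono hsub).rpow_const fun x hx => Or.inl (hpos x (mem_uSphere.1 hx)).ne').mul
      (hf.continuousOn.mono hsub)
  have hH0 : ∀ x ∈ uSphere n, 0 < Φ x ^ q * f x := fun x hx =>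
    mul_pos (Real.rpow_pos_of_pos (hpos x (mem_uSphere.1 hx)) q) (hfpos x hx)
  have hcpt : IsCompact (uSphere n) := isCompact_sphere (0 : Euc n) 1
  obtain ⟨B₁, h₁⟩ := exists_norm_le_on_sphere h.contDiffOn_fderiv.continuousOn
  obtain ⟨B₂, h₂⟩ := exists_norm_le_on_sphere h.contDiffOn_d2.continuousOn
  obtain ⟨B₃, h₃⟩ := exists_norm_le_on_sphere h.contDiffOn_d3.continuousOn
  obtain ⟨B₄, h₄⟩ := hcpt.exists_bound_of_continuousOn hH
  obtain ⟨B₅, h₅⟩ := hcpt.exists_bound_of_continuousOn (hH.inv₀ fun x hx => (hH0 x hx).ne')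
  have i₁ := abs_nonneg B₁
  have i₂ := abs_nonneg B₂
  have i₃ := abs_nonneg B₃
  have i₄ := abs_nonneg B₄
  have i₅ := abs_nonneg B₅
  refine ⟨1 + |B₁| + |B₂| + |B₃| + |B₄| + |B₅|, by linarith, fun x hx => ?_⟩
  have hxs := mem_uSphere.2 hx
  have e0 := hH0 x hxs
  have e4 := (le_abs_self _).trans (h₄ x hxs)
  have e5 : (Φ x ^ q * f x)⁻¹ ≤ B₅ := (le_abs_self _).trans (h₅ x hxs)
  refine ⟨?_, ?_, ?_, ?_, ?_⟩
  · linarith [h₁ x hx, le_abs_self B₁]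
  · linarith [h₂ x hx, le_abs_self B₂]
  · linarith [h₃ x hx, le_abs_self B₃]
  · linarith [le_abs_self B₄]
  · rw [← div_le_iff₀ e0, one_div]
    linarith [le_abs_self B₅]

theorem assemble_bound {H P κ η G L a S q k E D K : ℝ} (hH : 0 < H) (hP : 1 ≤ P) (hη : 0 ≤ η)
    (hE : 0 ≤ E) (hD : 0 ≤ D) (hHD : H ≤ D)
    (main : L - 1 / k * G ^ 2 + q * ((κ - P) / P - a ^ 2) - S - k * κ / P ≤ 0) :
    H * (G ^ 2 + q * ((κ + η - P) / P - a ^ 2) + L) - (1 + 1 / k) * (H * G) ^ 2 / H - H * S -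
      κ * (k * H) / P + K * (η + E) ≤ (D + |q| * D + K) * (η + E) := by
  have hP0 : 0 < P := zero_lt_one.trans_le hP
  have e2 : q * (η / P) * H ≤ |q| * D * η := by
    have h1 : η / P ≤ η := div_le_self hη hP
    calc q * (η / P) * H ≤ |q| * (η / P) * H := by
          gcongr; exact le_abs_self _
      _ ≤ |q| * η * D := by gcongr
      _ = _ := by ring
  have e3 := mul_nonpos_of_nonneg_of_nonpos hH.le main
  have e5 : H * (G ^ 2 + q * ((κ + η - P) / P - a ^ 2) + L) -
      (1 + 1 / k) * (H * G) ^ 2 / H - H * S - κ * (k * H) / P =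
      H * (L - 1 / k * G ^ 2 + q * ((κ - P) / P - a ^ 2) - S - k * κ / P) + q * (η / P) * H := by
    field_simp
    ring
  have e6 : (D + |q| * D + K) * (η + E) =
      D * η + D * E + |q| * D * η + |q| * D * E + K * (η + E) := by ring
  have e7 : 0 ≤ |q| * D * E := by positivity
  rw [e5, e6]
  linarith [mul_nonneg hD hη, mul_nonneg hD hE]

theorem exists_uniform_inequality (hk : 1 ≤ k) (hp : 0 ≤ p) (hA : AssumptionA n k p f)
    (hf : C2Off f) (hf0 : Homog0 f) (hfpos : ∀ x ∈ uSphere n, 0 < f x)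
    (h : C4Off Φ) (hh : Homog1 Φ) (hΦ : ∀ x, ‖x‖ = 1 → 1 ≤ Φ x) (hev : ∀ x, Φ (-x) = Φ x)
    (hconv : ∀ x w, ‖x‖ = 1 → ⟪x, w⟫ = 0 → kap Φ x * ⟪w, w⟫ ≤ d2 Φ x w w)
    (hD : p = 0 → ∀ x, ‖x‖ = 1 →
      1 / (2 + 8 * sphSup fun y => (f y / (n.choose k : ℝ)) ^ (1 / (k : ℝ))) ≤ 1 / Φ x ^ 2)
    (hsol : ∀ x, ‖x‖ = 1 → ∀ e : Fin n → Euc n, OrthoFrame x e →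
      sigmaMat k (Matrix.of fun i j => d2 Φ x (e i) (e j) - kap Φ x * if i = j then 1 else 0) =
        Φ x ^ (p - k) * f x) :
    ∃ C c : ℝ, 0 < c ∧ 0 ≤ C ∧ ∀ (η : Euc n → ℝ) (y : Euc n) (e : Fin n → Euc n)
      (W η₁ η₂ : Fin n → ℝ) (i₀ : Fin n), ‖y‖ = 1 → OrthoFrame y e →
      (∀ l z, d2 Φ y (e l) z = W l * ⟪e l, z⟫) →
      (∀ x, ‖x‖ = 1 → ∀ v, ⟪x, v⟫ = 0 → 0 ≤ d2 Φ x v v - (kap Φ x + η x) * ⟪v, v⟫) →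
      W i₀ = kap Φ y + η y → 0 ≤ η y →
      (∀ l, HasJet (fun t => η (geo y (e l) t)) (η y) (η₁ l) (η₂ l)) →
      ∃ F : Fin n → ℝ, (∀ l, c ≤ F l ∧ F l ≤ C) ∧
        ∑ l, F l * η₂ l ≤ C * (η y + ∑ l, |η₁ l|) := by
  have hpos : ∀ x, ‖x‖ = 1 → 0 < Φ x := fun x hx => zero_lt_one.trans_le (hΦ x hx)
  obtain ⟨B, hB1, hB⟩ := exists_uniform_bound hf hfpos h hΦ (p - k)
  have hB2 : B ≤ B ^ 2 := by nlinarith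
  have hB21 : 1 ≤ B ^ 2 := hB1.trans hB2
  set D : ℝ := 2 ^ n * (B ^ 2) ^ n + B ^ 2 with hDdef
  have hDB : B ^ 2 ≤ D := by
    have : (0 : ℝ) ≤ 2 ^ n * (B ^ 2) ^ n := by positivity
    linarith
  have hDF : 2 ^ n * (B ^ 2) ^ n ≤ D := by
    have : (0 : ℝ) ≤ B ^ 2 := by positivity
    linarith
  have hD1 : 1 ≤ D := hB21.trans hDB
  have hD0 : 0 < D := zero_lt_one.trans_le hD1
  have hn0 : (0 : ℝ) ≤ 32 * n ^ 2 * D ^ 6 := by positivity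
  have hq0 : 0 ≤ |p - k| * D := by positivity
  refine ⟨D + |p - k| * D + 32 * n ^ 2 * D ^ 6, 1 / (2 ^ n * B ^ 2 * D), by positivity,
    by positivity, ?_⟩
  intro η y e W η₁ η₂ i₀ hy he hW hmin hi₀ hη0 hη
  obtain ⟨b1, b2, b3, b4, b5⟩ := hB y hy
  have hΦy := hΦ y hy
  have hΦ0 := hpos y hy
  have hen := he.norm_eq_one
  have hWe : ∀ l, W l = d2 Φ y (e l) (e l) := fun l => by rw [hW, he.2, if_pos rfl, mul_one]
  have hκ0 : 0 ≤ kap Φ y := by rw [kap]; positivity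
  have hd : ∀ l, 0 ≤ W l - kap Φ y := fun l => by
    have := hconv y (e l) hy (he.1 l)
    rw [he.2, if_pos rfl, mul_one] at this
    rw [hWe]; linarith
  have hdB : ∀ l, W l - kap Φ y ≤ B ^ 2 := fun l => by
    have h1 := (le_abs_self _).trans ((d2 Φ y).le_opNorm₂ (e l) (e l))
    rw [hen, mul_one, mul_one, ← hWe] at h1
    linarith
  have hκB : kap Φ y ≤ B ^ 2 := by
    rw [kap, div_le_iff₀ (by positivity)]
    have : ‖fderiv ℝ Φ y‖ ^ 2 ≤ B ^ 2 := by gcongr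
    nlinarith
  have haC : ∀ j, |fderiv ℝ Φ y (e j) / Φ y| ≤ D := fun j => by
    have h1 := (fderiv ℝ Φ y).le_opNorm (e j)
    rw [hen, mul_one, Real.norm_eq_abs] at h1
    rw [abs_div, abs_of_pos hΦ0]
    exact (div_le_self (abs_nonneg _) hΦy).trans (by linarith)
  have hSC : ∀ j l, |d3 Φ y (e i₀) (e j) (e l)| ≤ D := fun j l => by
    have h1 := (d3 Φ y (e i₀)).le_opNorm₂ (e j) (e l)
    have h2 := (d3 Φ y).le_opNorm (e i₀)
    rw [hen, hen, mul_one, mul_one, Real.norm_eq_abs] at h1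
    rw [hen, mul_one] at h2
    linarith
  have hH := sigmaMat_of_frame (k := k) he hW
  rw [hsol y hy e he] at hH
  have hJ := fun l => hasJet_rhs hf hf0 hfpos h hh hpos hy (hen l) (he.1 l) (p - k)
  set H := Φ y ^ (p - k) * f y with hHdef
  have hH0 : 0 < H := mul_pos (Real.rpow_pos_of_pos hΦ0 _) (hfpos y (mem_uSphere.2 hy))
  have hDH : 1 ≤ D * H := b5.trans (by gcongr; linarith)
  have core := core_inequality hk h hh hΦ hy he hW hmin hi₀ hη0 hη
    (H := fun x => Φ x ^ (p - k) * f x) hJ hsol hD1 haC (fun l => (hdB l).trans hDB)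
    (hκB.trans hDB) hSC (fun i => (esF_le k hB21 hd hdB i).trans hDF)
    (fun i j => (esFF_le k hB21 hd hdB i j).trans hDF) hDH
  have main := main_term_le hk hp hA hf hf0 hfpos h.c2 hh hΦ hev hconv hD hy he i₀
  refine ⟨fun l => esF k (fun l => W l - kap Φ y) l, fun l => ⟨?_, ?_⟩, core.trans ?_⟩
  · have h1 := esS_le_mul_esF hk hB21 hd hdB l
    rw [← hH] at h1
    rw [div_le_iff₀ (by positivity)]
    nlinarith
  · exact ((esF_le k hB21 hd hdB l).trans hDF).trans (by linarith)
  · have e1 : ∀ j, fderiv ℝ Φ y (e j) / Φ y *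
        (H * ((p - k) * (fderiv ℝ Φ y (e j) / Φ y) + fderiv ℝ f y (e j) / f y)) =
        H * (fderiv ℝ Φ y (e j) / Φ y *
          ((p - k) * (fderiv ℝ Φ y (e j) / Φ y) + fderiv ℝ f y (e j) / f y)) := fun j => by ring
    simp only [← hHdef, e1, ← Finset.mul_sum, ← hWe, hi₀]
    exact assemble_bound hH0 hΦy hη0 (Finset.sum_nonneg fun _ _ => abs_nonneg _) hD0.le
      (by linarith) main

end UniformInequality

section StrongMaximum

variable {n : ℕ} {Φ : Euc n → ℝ}

theorem exists_weight_eq {W c : Fin n → ℝ} {μ : ℝ} (hW : ∀ l, μ ≤ W l) (hc : ∑ l, c l ^ 2 = 1)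
    (h : ∑ l, W l * c l ^ 2 = μ) : ∃ i, W i = μ := by
  by_contra! hne
  have h1 : ∀ l, 0 ≤ (W l - μ) * c l ^ 2 := fun l =>
    mul_nonneg (sub_nonneg.2 (hW l)) (sq_nonneg _)
  have h2 : ∑ l, (W l - μ) * c l ^ 2 = 0 := by
    simp only [sub_mul, Finset.sum_sub_distrib, ← Finset.mul_sum, hc, h]; ring
  have h3 := (Finset.sum_eq_zero_iff_of_nonneg fun l _ => h1 l).1 h2
  have h4 : ∀ l, c l ^ 2 = 0 := fun l =>
    (mul_eq_zero.1 (h3 l (Finset.mem_univ l))).resolve_left (sub_ne_zero.2 (hne l))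
  simp [h4] at hc

theorem hasJet_exp_inner {y u q : Euc n} (m ε α : ℝ) :
    HasJet (fun t => ε * Real.exp (α * ⟪geo y u t, q⟫) - m) (ε * Real.exp (α * ⟪y, q⟫) - m)
      (ε * Real.exp (α * ⟪y, q⟫) * (α * ⟪u, q⟫))
      (ε * Real.exp (α * ⟪y, q⟫) * (α ^ 2 * ⟪u, q⟫ ^ 2 - α * ⟪y, q⟫)) := by
  have h1 : ∀ (y u : Euc n) t, HasDerivAt (fun t => α * ⟪geo y u t, q⟫) (α * ⟪geo u (-y) t, q⟫) t :=
    fun y u t => by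
      have := ((hasDerivAt_geo y u t).inner ℝ (hasDerivAt_const t q)).const_mul α
      refine this.congr_deriv ?_
      simp
  have h2 : ∀ t, HasDerivAt (fun t => ε * Real.exp (α * ⟪geo y u t, q⟫))
      (ε * (Real.exp (α * ⟪geo y u t, q⟫) * (α * ⟪geo u (-y) t, q⟫))) t := fun t =>
    ((h1 y u t).exp).const_mul ε
  have h3 := (((h1 y u 0).exp).mul (h1 u (-y) 0)).const_mul ε
  refine ⟨_, fun t => (h2 t).sub_const m, h3.congr_deriv ?_, by simp [geo], ?_⟩
  · simp [geo]; ring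
  · simp [geo]; ring

theorem continuousOn_kap (h : C2Off Φ) (hpos : ∀ x, ‖x‖ = 1 → 0 < Φ x) :
    ContinuousOn (kap Φ) (uSphere n) := by
  have hsub : ∀ x, x ∈ uSphere n → x ≠ 0 := fun x hx => ne_zero_of_norm_eq_one (mem_uSphere.1 hx)
  exact (((h.contDiffOn_fderiv.continuousOn.mono hsub).norm.pow 2).add_const 1).div
    ((h.continuousOn.mono hsub).const_mul 2)
    fun x hx => (mul_pos two_pos (hpos x (mem_uSphere.1 hx))).ne'

/-- The unit tangent bundle of the sphere. -/
def unitTangent (n : ℕ) : Set (Euc n × Euc n) :=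
  {z | ‖z.1‖ = 1 ∧ ‖z.2‖ = 1 ∧ ⟪z.1, z.2⟫ = 0}

theorem isCompact_unitTangent (n : ℕ) : IsCompact (unitTangent n) := by
  have hc : IsCompact (Metric.sphere (0 : Euc n) 1 ×ˢ Metric.sphere (0 : Euc n) 1) :=
    (isCompact_sphere _ _).prod (isCompact_sphere _ _)
  refine hc.of_isClosed_subset ?_ fun z hz => ⟨by simpa using hz.1, by simpa using hz.2.1⟩
  exact (isClosed_eq continuous_fst.norm continuous_const).inter
    ((isClosed_eq continuous_snd.norm continuous_const).inter
      (isClosed_eq (continuous_fst.inner continuous_snd) continuous_const))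

theorem continuousOn_secondForm (h : C4Off Φ) (hpos : ∀ x, ‖x‖ = 1 → 0 < Φ x) :
    ContinuousOn (fun z : Euc n × Euc n => d2 Φ z.1 z.2 z.2 - kap Φ z.1) (unitTangent n) := by
  have hm : Set.MapsTo Prod.fst (unitTangent n) (uSphere n) := fun z hz => mem_uSphere.2 hz.1
  have h1 : ContinuousOn (fun z : Euc n × Euc n => d2 Φ z.1) (unitTangent n) :=
    (h.contDiffOn_d2.continuousOn.mono fun x hx =>
      ne_zero_of_norm_eq_one (mem_uSphere.1 hx)).comp continuousOn_fst hm
  exact ((h1.clm_apply continuousOn_snd).clm_apply continuousOn_snd).sub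
    ((continuousOn_kap h.c2 hpos).comp continuousOn_fst hm)

theorem secondForm_smul (x v : Euc n) (c : ℝ) (r : ℝ) :
    d2 Φ x (c • v) (c • v) - r * ⟪c • v, c • v⟫ = c ^ 2 * (d2 Φ x v v - r * ⟪v, v⟫) := by
  rw [real_inner_smul_left, real_inner_smul_right, map_smul, map_smul, smul_apply]
  simp only [smul_eq_mul]
  ring

theorem secondForm_pos (h : C4Off Φ) (hh : Homog1 Φ) (hΦ : ∀ x, ‖x‖ = 1 → 1 < Φ x)
    (hev : ∀ x, Φ (-x) = Φ x)
    (hconv : ∀ x w, ‖x‖ = 1 → ⟪x, w⟫ = 0 → kap Φ x * ⟪w, w⟫ ≤ d2 Φ x w w)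
    {C c : ℝ} (hc : 0 < c) (hC : 0 ≤ C)
    (hunif : ∀ (η : Euc n → ℝ) (y : Euc n) (e : Fin n → Euc n)
      (W η₁ η₂ : Fin n → ℝ) (i₀ : Fin n), ‖y‖ = 1 → OrthoFrame y e →
      (∀ l z, d2 Φ y (e l) z = W l * ⟪e l, z⟫) →
      (∀ x, ‖x‖ = 1 → ∀ v, ⟪x, v⟫ = 0 → 0 ≤ d2 Φ x v v - (kap Φ x + η x) * ⟪v, v⟫) →
      W i₀ = kap Φ y + η y → 0 ≤ η y →
      (∀ l, HasJet (fun t => η (geo y (e l) t)) (η y) (η₁ l) (η₂ l)) →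
      ∃ F : Fin n → ℝ, (∀ l, c ≤ F l ∧ F l ≤ C) ∧
        ∑ l, F l * η₂ l ≤ C * (η y + ∑ l, |η₁ l|))
    {z₀ : Euc n × Euc n} (hz₀ : z₀ ∈ unitTangent n) :
    0 < d2 Φ z₀.1 z₀.2 z₀.2 - kap Φ z₀.1 := by
  by_contra! hneg
  have hpos : ∀ x, ‖x‖ = 1 → 0 < Φ x := fun x hx => zero_lt_one.trans (hΦ x hx)
  have hA0 : ∀ z ∈ unitTangent n, 0 ≤ d2 Φ z.1 z.2 z.2 - kap Φ z.1 := fun z hz => by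
    have := hconv z.1 z.2 hz.1 hz.2.2
    rw [real_inner_self_eq_norm_sq, hz.2.1] at this
    linarith
  have hAc := continuousOn_secondForm h hpos
  obtain ⟨q, hq, hqmin⟩ := exists_isMin_on_sphere h.continuousOn
  have hip : Continuous fun z : Euc n × Euc n => ⟪z.1, q⟫ := continuous_fst.inner continuous_const
  have hip1 : ∀ x : Euc n, ‖x‖ = 1 → ⟪x, q⟫ ^ 2 ≤ 1 := fun x hx => by
    have := abs_real_inner_le_norm x q
    rw [hx, hq, one_mul] at this
    exact (sq_le_one_iff_abs_le_one _).2 this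
  have hmin_pos : ∀ x, ‖x‖ = 1 → (∀ z, ‖z‖ = 1 → Φ x ≤ Φ z) → ∀ v, ‖v‖ = 1 → ⟪x, v⟫ = 0 →
      0 < d2 Φ x v v - kap Φ x := fun x hx hxmin v hv hxv => by
    have h1 := le_d2_of_min h.c2 hh hpos hx hxmin hv hxv
    have h2 : 1 / Φ x < Φ x := ((div_lt_one (hpos x hx)).2 (hΦ x hx)).trans (hΦ x hx)
    linarith
  obtain ⟨δ, hδ, hδle⟩ : ∃ δ > 0, ∀ z ∈ unitTangent n,
      δ ≤ d2 Φ z.1 z.2 z.2 - kap Φ z.1 + (1 - ⟪z.1, q⟫ ^ 2) := by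
    obtain ⟨z, hz, hzmin⟩ := (isCompact_unitTangent n).exists_isMinOn ⟨z₀, hz₀⟩
      (hAc.add (continuous_const.sub (hip.pow 2)).continuousOn)
    refine ⟨_, ?_, fun z' hz' => hzmin hz'⟩
    rcases (hip1 z.1 hz.1).lt_or_eq with hlt | heq
    · exact add_pos_of_nonneg_of_pos (hA0 z hz) (sub_pos.2 hlt)
    · refine add_pos_of_pos_of_nonneg ?_ (by simp [heq])
      rcases mul_self_eq_one_iff.1 ((sq _).symm.trans heq) with h1 | h1
      · rw [inner_eq_one_iff_of_norm_eq_one hz.1 hq] at h1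
        exact hmin_pos z.1 hz.1 (h1 ▸ hqmin) z.2 hz.2.1 hz.2.2
      · rw [inner_eq_neg_one_iff_of_norm_eq_one hz.1 hq] at h1
        exact hmin_pos z.1 hz.1 (by rw [h1, hev]; exact hqmin) z.2 hz.2.1 hz.2.2
  obtain ⟨α, hα1, hα⟩ : ∃ α : ℝ, 1 ≤ α ∧ C * (1 + 2 * n) < c * α * (δ / 2) := by
    refine ⟨1 + 2 * (C * (1 + 2 * n)) / (c * δ), le_add_of_nonneg_right (by positivity), ?_⟩
    have : c * (1 + 2 * (C * (1 + 2 * n)) / (c * δ)) * (δ / 2) =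
        c * δ / 2 + C * (1 + 2 * n) := by field_simp
    rw [this]
    exact lt_add_of_pos_left _ (by positivity)
  have hα0 : 0 < α := zero_lt_one.trans_le hα1
  set ε : ℝ := δ / 2 * Real.exp (-α) with hε
  set ξ : Euc n → ℝ := fun x => ε * Real.exp (α * ⟪x, q⟫) with hξ
  have hξ0 : ∀ x, 0 < ξ x := fun x => by positivity
  have hξle : ∀ x, ‖x‖ = 1 → ξ x ≤ δ / 2 := fun x hx => by
    have h1 : ⟪x, q⟫ ≤ 1 := (le_abs_self _).trans ((sq_le_one_iff_abs_le_one _).1 (hip1 x hx))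
    calc ξ x = δ / 2 * Real.exp (-α + α * ⟪x, q⟫) := by rw [hξ, Real.exp_add, ← mul_assoc]
      _ ≤ δ / 2 * 1 := by
        gcongr
        rw [Real.exp_le_one_iff]
        nlinarith
      _ = δ / 2 := mul_one _
  obtain ⟨z, hz, hzmin⟩ := (isCompact_unitTangent n).exists_isMinOn ⟨z₀, hz₀⟩
    (hAc.sub (continuous_const.mul (continuous_const.mul hip).rexp).continuousOn :
      ContinuousOn (fun z => d2 Φ z.1 z.2 z.2 - kap Φ z.1 - ξ z.1) (unitTangent n))
  set m := ξ z.1 - (d2 Φ z.1 z.2 z.2 - kap Φ z.1) with hm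
  have hm0 : 0 < m := by
    have : d2 Φ z.1 z.2 z.2 - kap Φ z.1 - ξ z.1 ≤ d2 Φ z₀.1 z₀.2 z₀.2 - kap Φ z₀.1 - ξ z₀.1 :=
      hzmin hz₀
    linarith [hξ0 z₀.1]
  obtain ⟨y, w⟩ := z
  obtain ⟨hy, hw, hyw⟩ := hz
  dsimp only at hm hy hw hyw
  have hη0 : 0 ≤ ξ y - m := by
    have := hA0 (y, w) ⟨hy, hw, hyw⟩
    simp only [hm]; linarith
  have hmin : ∀ x, ‖x‖ = 1 → ∀ v, ⟪x, v⟫ = 0 →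
      0 ≤ d2 Φ x v v - (kap Φ x + (ξ x - m)) * ⟪v, v⟫ := fun x hx v hxv => by
    by_cases hv0 : v = 0
    · simp [hv0]
    have hvn := norm_pos_iff.2 hv0
    have hu : ‖(‖v‖⁻¹ • v)‖ = 1 := norm_smul_inv_norm hv0
    have h1 : d2 Φ y w w - kap Φ y - ξ y ≤
        d2 Φ x (‖v‖⁻¹ • v) (‖v‖⁻¹ • v) - kap Φ x - ξ x :=
      hzmin (show (x, ‖v‖⁻¹ • v) ∈ unitTangent n from
        ⟨hx, hu, by rw [real_inner_smul_right, hxv, mul_zero]⟩)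
    have h2 : v = ‖v‖ • (‖v‖⁻¹ • v) := (smul_inv_smul₀ hvn.ne' v).symm
    rw [h2, secondForm_smul, real_inner_self_eq_norm_sq (‖v‖⁻¹ • v), hu]
    refine mul_nonneg (sq_nonneg _) ?_
    linarith
  have hy0 := ne_zero_of_norm_eq_one hy
  obtain ⟨e, W, he, hW⟩ := exists_orthoFrame_of_isSymmetric hy (d2 Φ y)
    (h.c2.d2_symm hy0) (fun v => by rw [hh.d2_self h.c2 hy0]; rfl)
  obtain ⟨i₀, hi₀⟩ : ∃ i, W i = kap Φ y + (ξ y - m) := by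
    have hex := he.expand hy w
    rw [hyw, zero_smul, zero_add] at hex
    refine exists_weight_eq (c := fun l => ⟪e l, w⟫) (fun l => ?_) ?_ ?_
    · have := hmin y hy (e l) (he.1 l)
      rw [hW, he.2, if_pos rfl] at this
      linarith
    · have := he.norm_sq hy w
      rw [hw, hyw] at this
      simpa using this.symm
    · have h1 : d2 Φ y w w = ∑ l, W l * ⟪e l, w⟫ ^ 2 := by
        calc d2 Φ y w w = d2 Φ y (∑ l, ⟪e l, w⟫ • e l) w := by rw [← hex]
          _ = _ := by
            rw [map_sum, _root_.sum_apply]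
            refine Finset.sum_congr rfl fun l _ => ?_
            rw [map_smul, smul_apply, hW, smul_eq_mul]
            ring
      rw [← h1, hm]; ring
  obtain ⟨F, hF, hle⟩ := hunif (fun x => ξ x - m) y e W _ _ i₀ hy he hW hmin hi₀ hη0
    fun l => hasJet_exp_inner m ε α
  have hsum := he.norm_sq hy q
  rw [hq] at hsum
  have hs : 1 - ⟪y, q⟫ ^ 2 ≥ δ / 2 := by
    have h1 := hδle (y, w) ⟨hy, hw, hyw⟩
    have h2 := hξle y hy
    dsimp only at h1
    linarith
  have hs1 : |⟪y, q⟫| ≤ 1 := (sq_le_one_iff_abs_le_one _).1 (hip1 y hy)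
  have hl1 : ∀ l, |⟪e l, q⟫| ≤ 1 := fun l =>
    (sq_le_one_iff_abs_le_one _).1 (hip1 (e l) (he.norm_eq_one l))
  have hξy := hξ0 y
  have hlow : ξ y * (c * α ^ 2 * (δ / 2) - α * (n * C)) ≤
      ∑ l, F l * (ξ y * (α ^ 2 * ⟪e l, q⟫ ^ 2 - α * ⟪y, q⟫)) := by
    have h1 : ∀ l, ξ y * (c * α ^ 2 * ⟪e l, q⟫ ^ 2 - α * C) ≤
        F l * (ξ y * (α ^ 2 * ⟪e l, q⟫ ^ 2 - α * ⟪y, q⟫)) := fun l => by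
      have e1 : c * (α ^ 2 * ⟪e l, q⟫ ^ 2) ≤ F l * (α ^ 2 * ⟪e l, q⟫ ^ 2) := by
        gcongr; exact (hF l).1
      have e2 : F l * ⟪y, q⟫ ≤ C := by
        calc F l * ⟪y, q⟫ ≤ F l * 1 :=
              mul_le_mul_of_nonneg_left ((le_abs_self _).trans hs1) (hc.le.trans (hF l).1)
          _ ≤ C := by linarith [(hF l).2]
      have e3 := mul_le_mul_of_nonneg_left e2 hα0.le
      have e4 : c * α ^ 2 * ⟪e l, q⟫ ^ 2 - α * C ≤
          F l * (α ^ 2 * ⟪e l, q⟫ ^ 2 - α * ⟪y, q⟫) := by linarith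
      calc _ ≤ ξ y * (F l * (α ^ 2 * ⟪e l, q⟫ ^ 2 - α * ⟪y, q⟫)) := by gcongr
        _ = _ := by ring
    refine le_trans ?_ (Finset.sum_le_sum fun l _ => h1 l)
    rw [← Finset.mul_sum, Finset.sum_sub_distrib, ← Finset.mul_sum, Finset.sum_const,
      Finset.card_univ, Fintype.card_fin, nsmul_eq_mul]
    have e5 : ∑ l, ⟪e l, q⟫ ^ 2 = 1 - ⟪y, q⟫ ^ 2 := by linarith
    rw [e5]
    have e6 : c * α ^ 2 * (δ / 2) ≤ c * α ^ 2 * (1 - ⟪y, q⟫ ^ 2) := by gcongr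
    gcongr ξ y * ?_
    linarith
  have hup : C * (ξ y - m + ∑ l, |ξ y * (α * ⟪e l, q⟫)|) ≤ ξ y * (C * (1 + n * α)) := by
    have h1 : ∑ l, |ξ y * (α * ⟪e l, q⟫)| ≤ n * (ξ y * α) := by
      calc ∑ l, |ξ y * (α * ⟪e l, q⟫)| ≤ ∑ _l : Fin n, ξ y * α := by
            refine Finset.sum_le_sum fun l _ => ?_
            rw [abs_mul (ξ y), abs_mul α, abs_of_pos hξy, abs_of_pos hα0]
            refine mul_le_mul_of_nonneg_left ?_ hξy.le
            exact mul_le_of_le_one_right hα0.le (hl1 l)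
        _ = n * (ξ y * α) := by simp
    calc C * (ξ y - m + ∑ l, |ξ y * (α * ⟪e l, q⟫)|) ≤ C * (ξ y + n * (ξ y * α)) := by
          gcongr; linarith
      _ = _ := by ring
  have hfin := le_of_mul_le_mul_left (hlow.trans (hle.trans hup)) hξy
  have h3 := mul_lt_mul_of_pos_left hα hα0
  have h4 : C ≤ C * α := le_mul_of_one_le_right hC hα1
  linarith

end StrongMaximum

/-- **Full rank theorem** (Theorem 4.2 of Luo–Wei): for `n ≥ 2`, `1 ≤ k ≤ n-1`, `p ≥ 0` and a
smooth, even, positive `f` satisfying Assumption (A), every even, h-convex `C⁴` solution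
`φ > 1` of `σ_k(A[φ]) = φ^{p-k} f` is in fact uniformly h-convex: `A[φ] > 0` everywhere. -/
theorem full_rank_theorem (n k : ℕ) (p : ℝ)
    (hn : 2 ≤ n) (hk1 : 1 ≤ k) (hk2 : k ≤ n - 1) (hp : 0 ≤ p)
    (f : Euc n → ℝ) (hf0 : Homog0 f) (hfs : SmoothFn f) (hfe : EvenFn f)
    (hfpos : ∀ x ∈ uSphere n, 0 < f x) (hfA : AssumptionA n k p f)
    (φ : Euc n → ℝ) (hφ0 : Homog0 φ) (hφC4 : ContDiffOn ℝ 4 φ {y : Euc n | y ≠ 0})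
    (hφe : EvenFn φ) (hφ1 : ∀ x ∈ uSphere n, 1 < φ x) (hφc : HConvex φ)
    (hsol : SolvesCM n k p f φ) :
    UnifHConvex φ := by
  have hΦe : ∀ x, ‖x‖ = 1 → radial φ x = φ x := fun x hx => radial_of_norm_eq_one hx
  have h1 : ∀ x, ‖x‖ = 1 → 1 < φ x := fun x hx => hφ1 x (mem_uSphere.2 hx)
  have hΦ1 : ∀ x, ‖x‖ = 1 → 1 < radial φ x := fun x hx => (h1 x hx).trans_eq (hΦe x hx).symm
  have h4 : C4Off φ := hφC4
  have hev : ∀ x, radial φ (-x) = radial φ x := fun x => by simp only [radial, norm_neg, hφe x]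
  have hA : ∀ x v w, ‖x‖ = 1 → ⟪x, v⟫ = 0 → ⟪x, w⟫ = 0 →
      Aform φ x v w = d2 (radial φ) x v w - kap (radial φ) x * ⟪v, w⟫ := fun x v w hx hv hw =>
    Aform_eq h4 hφ0 hx (zero_lt_one.trans (h1 x hx)) hv hw
  have hconv : ∀ x w, ‖x‖ = 1 → ⟪x, w⟫ = 0 →
      kap (radial φ) x * ⟪w, w⟫ ≤ d2 (radial φ) x w w := fun x w hx hw => by
    have := hφc x (mem_uSphere.2 hx) w hw
    rw [hA x w w hx hw hw] at this
    linarith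
  have hs : ∀ x, ‖x‖ = 1 → ∀ e : Fin n → Euc n, OrthoFrame x e →
      sigmaMat k (Matrix.of fun i j =>
        d2 (radial φ) x (e i) (e j) - kap (radial φ) x * if i = j then 1 else 0) =
        radial φ x ^ (p - k) * f x := fun x hx e he => by
    rw [hΦe x hx, ← hsol x (mem_uSphere.2 hx) e he]
    congr 1
    ext i j
    simp only [Amat, Matrix.of_apply]
    rw [hA x (e i) (e j) hx (he.1 i) (he.1 j), he.2]
  have hD : p = 0 → ∀ x, ‖x‖ = 1 →
      1 / (2 + 8 * sphSup fun y => (f y / (n.choose k : ℝ)) ^ (1 / (k : ℝ))) ≤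
        1 / radial φ x ^ 2 := fun hp0 x hx =>
    one_div_le_one_div_sq hfs.c2 hf0 hfpos h4.radial hφ0.radial hΦ1 hev hconv hk1 (by omega)
      (by simpa only [hp0, zero_sub] using hs) hx
  obtain ⟨C, c, hc, hC, hunif⟩ := exists_uniform_inequality hk1 hp hfA hfs.c2 hf0 hfpos h4.radial
    hφ0.radial (fun x hx => (hΦ1 x hx).le) hev hconv hD hs
  intro x hx v hv hv0
  rw [mem_uSphere] at hx
  have hu : ‖(‖v‖⁻¹ • v)‖ = 1 := norm_smul_inv_norm hv0
  have hpos := secondForm_pos h4.radial hφ0.radial hΦ1 hev hconv hc hC hunif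
    (z₀ := (x, ‖v‖⁻¹ • v)) ⟨hx, hu, by rw [real_inner_smul_right, hv, mul_zero]⟩
  have hvn := norm_pos_iff.2 hv0
  rw [hA x v v hx hv hv, ← smul_inv_smul₀ hvn.ne' v, secondForm_smul,
    real_inner_self_eq_norm_sq, hu, one_pow, mul_one]
  exact mul_pos (by positivity) hpos
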